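/- Let X ⊂ ℙ^r be an integral and non-degenerate projective variety of dimension n over an algebraically closed field of characteristic 0, weakly k-defective with dim σ_{k+n−1}(X) = (k+n−1)(n+1)−1 < r. Then the k-th secant degree of X is equal to the k-th secant degree of the intersection of X with the linear span of its general tangential k-contact locus. -/

import Mathlib

noncomputable section

namespace ContactLoci

variable {K : Type*} [Field K] {ι : Type*} [Fintype ι]

/-- Projective space over `K` with homogeneous coordinates indexed by `ι`. -/
abbrev PP (K : Type*) [Field K] (ι : Type*) : Type _ :=
  Projectivization K (ι → K)

/-- The affine cone over a set of projective points. -/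
def coneOf (S : Set (PP K ι)) : Set (ι → K) :=
  ⋃ x ∈ S, (x.submodule : Set (ι → K))

/-- The linear span, in the underlying vector space, of the cone over `S`. -/
def vspan (S : Set (PP K ι)) : Submodule K (ι → K) :=
  Submodule.span K (coneOf S)

/-- The projective linear span of a set of projective points. -/
def projSpan (S : Set (PP K ι)) : Set (PP K ι) :=
  {x | x.submodule ≤ vspan S}

/-- The projective dimension of the linear span of `S` (`-1` for `S = ∅`). -/
def projDim (S : Set (PP K ι)) : ℤ :=
  (Module.finrank K (vspan S) : ℤ) - 1

/-- A set of projective points is non-degenerate if its linear span is everything. -/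
def Nondegenerate (S : Set (PP K ι)) : Prop :=
  vspan S = ⊤

/-- The common zero locus in projective space of a set of polynomials. -/
def zeroLocus (S : Set (MvPolynomial ι K)) : Set (PP K ι) :=
  {x | ∀ f ∈ S, ∀ v ∈ x.submodule, MvPolynomial.eval v f = 0}

/-- Zariski-closed subsets of projective space: common zero loci of sets of
homogeneous polynomials. -/
def IsZClosed (X : Set (PP K ι)) : Prop :=
  ∃ S : Set (MvPolynomial ι K), (∀ f ∈ S, ∃ d : ℕ, f.IsHomogeneous d) ∧ X = zeroLocus S

/-- Zariski closure. -/
def zclosure (S : Set (PP K ι)) : Set (PP K ι) :=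
  ⋂₀ {Y | IsZClosed Y ∧ S ⊆ Y}

/-- Irreducibility with respect to the Zariski topology. -/
def IsZIrreducible (S : Set (PP K ι)) : Prop :=
  S.Nonempty ∧ ∀ Y Z : Set (PP K ι), IsZClosed Y → IsZClosed Z → S ⊆ Y ∪ Z → S ⊆ Y ∨ S ⊆ Z

/-- An integral projective variety: a Zariski-closed irreducible subset. -/
def IsIntegralVariety (X : Set (PP K ι)) : Prop :=
  IsZClosed X ∧ IsZIrreducible X

/-- `C` is an irreducible component of `S`: a maximal irreducible subset of `S`. -/
def IsZIrredComponent (S C : Set (PP K ι)) : Prop :=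
  IsZIrreducible C ∧ C ⊆ S ∧ ∀ D : Set (PP K ι), IsZIrreducible D → D ⊆ S → C ⊆ D → C = D

/-- The dimension of a set: the Krull dimension of the poset of irreducible
Zariski-closed subsets of its Zariski closure (`⊥` for the empty set). -/
def zdim (S : Set (PP K ι)) : WithBot ℕ∞ :=
  Order.krullDim ({Y : Set (PP K ι) // IsZClosed Y ∧ IsZIrreducible Y ∧ Y ⊆ zclosure S})

/-- A property holds at a general point of `X`: it holds away from a proper
Zariski-closed subset. -/
def HoldsGenerically (X : Set (PP K ι)) (P : PP K ι → Prop) : Prop :=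
  ∃ Y : Set (PP K ι), IsZClosed Y ∧ ¬X ⊆ Y ∧ ∀ x ∈ X \ Y, P x

/-- Zero locus of multihomogeneous polynomials in a self-product of projective space. -/
def multiZeroLocus {m : ℕ} (S : Set (MvPolynomial (Fin m × ι) K)) :
    Set (Fin m → PP K ι) :=
  {u | ∀ f ∈ S, ∀ v : Fin m → ι → K, (∀ i, v i ∈ (u i).submodule) →
    MvPolynomial.eval (fun p => v p.1 p.2) f = 0}

/-- Zariski-closed subsets of the `m`-fold self-product of projective space. -/
def IsMultiZClosed {m : ℕ} (T : Set (Fin m → PP K ι)) : Prop :=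
  ∃ S : Set (MvPolynomial (Fin m × ι) K),
    (∀ f ∈ S, ∀ i : Fin m, ∃ d : ℕ,
      MvPolynomial.IsWeightedHomogeneous (fun p : Fin m × ι => if p.1 = i then 1 else 0) f d) ∧
    T = multiZeroLocus S

/-- A property holds for a general `m`-tuple of points of `X`. -/
def HoldsForGeneralTuples (X : Set (PP K ι)) (m : ℕ) (P : (Fin m → PP K ι) → Prop) : Prop :=
  ∃ T : Set (Fin m → PP K ι), IsMultiZClosed T ∧
    (∃ u : Fin m → PP K ι, (∀ i, u i ∈ X) ∧ u ∉ T) ∧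
    ∀ u : Fin m → PP K ι, (∀ i, u i ∈ X) → u ∉ T → P u

/-- The homogeneous vanishing ideal of `X` (as a set of homogeneous polynomials). -/
def homogVanishingIdeal (X : Set (PP K ι)) : Set (MvPolynomial ι K) :=
  {f | (∃ d : ℕ, f.IsHomogeneous d) ∧ ∀ x ∈ X, ∀ v ∈ x.submodule, MvPolynomial.eval v f = 0}

/-- The embedded (projective) tangent space of `X` at `x`. -/
def embTangentSpace (X : Set (PP K ι)) (x : PP K ι) : Set (PP K ι) :=
  {y | ∀ f ∈ homogVanishingIdeal X,
    ∑ i : ι, y.rep i * MvPolynomial.eval x.rep (MvPolynomial.pderiv i f) = 0}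

/-- Smooth points of `X`. -/
def IsSmoothPoint (X : Set (PP K ι)) (x : PP K ι) : Prop :=
  x ∈ X ∧ zdim (embTangentSpace X x) = zdim X

/-- `M_A`: the linear span of the tangent spaces of `X` at the points of `A`. -/
def tangentSpan (X A : Set (PP K ι)) : Set (PP K ι) :=
  projSpan (⋃ a ∈ A, embTangentSpace X a)

/-- The locus of smooth points of `X` at which `M_A` is tangent to `X`. -/
def tangencyLocus (X A : Set (PP K ι)) : Set (PP K ι) :=
  {x | IsSmoothPoint X x ∧ embTangentSpace X x ⊆ tangentSpan X A}

/-- The tangential contact locus of `X` at `A`: the closure of the union of the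
irreducible components of the tangency locus meeting `A`. -/
def contactLocus (X A : Set (PP K ι)) : Set (PP K ι) :=
  zclosure (⋃ C ∈ {C : Set (PP K ι) |
    IsZIrredComponent (tangencyLocus X A) C ∧ (C ∩ A).Nonempty}, C)

/-- `X` is weakly `k`-defective: the tangential contact locus at `k` general points
has positive dimension. -/
def WeaklyDefective (X : Set (PP K ι)) (k : ℕ) : Prop :=
  HoldsForGeneralTuples X k fun u => 0 < zdim (contactLocus X (Set.range u))

/-- The `k`-th secant variety of `X`. -/
def secant (k : ℕ) (X : Set (PP K ι)) : Set (PP K ι) :=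
  zclosure {q | ∃ S : Finset (PP K ι), ↑S ⊆ X ∧ S.card = k ∧ q ∈ projSpan (S : Set (PP K ι))}

/-- The `X`-rank of a point. -/
def xrank (X : Set (PP K ι)) (q : PP K ι) : ℕ :=
  sInf {k | ∃ S : Finset (PP K ι), ↑S ⊆ X ∧ S.card = k ∧ q ∈ projSpan (S : Set (PP K ι))}

/-- `𝒮(q,X)`: the set of minimal `X`-decompositions of `q`. -/
def decompositions (X : Set (PP K ι)) (q : PP K ι) : Set (Finset (PP K ι)) :=
  {S | ↑S ⊆ X ∧ S.card = xrank X q ∧ q ∈ projSpan (S : Set (PP K ι))}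

/-- `X` is `k`-identifiable: a general point of `σ_k(X)` has a unique minimal
decomposition. -/
def Identifiable (X : Set (PP K ι)) (k : ℕ) : Prop :=
  HoldsGenerically (secant k X) fun q => ∃! S : Finset (PP K ι), S ∈ decompositions X q

/-- `α` is the `k`-th secant degree of `X`. -/
def HasSecantDegree (X : Set (PP K ι)) (k α : ℕ) : Prop :=
  HoldsGenerically (secant k X) fun q => (decompositions X q).ncard = α

/-- Projective linear subspaces. -/
def IsProjLinear (L : Set (PP K ι)) : Prop :=
  L = projSpan L

/-- Lines in projective space. -/
def IsLine (L : Set (PP K ι)) : Prop :=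
  IsProjLinear L ∧ Module.finrank K (vspan L) = 2

/-- `X` is uniruled by lines: through a general point of `X` there is a line
contained in `X`. -/
def UniruledByLines (X : Set (PP K ι)) : Prop :=
  HoldsGenerically X fun x => ∃ L : Set (PP K ι), IsLine L ∧ x ∈ L ∧ L ⊆ X

/-- The join of two sets in projective space. -/
def join (A B : Set (PP K ι)) : Set (PP K ι) :=
  zclosure (⋃ a ∈ A, ⋃ b ∈ B, projSpan {a, b})

/-- The linear space `M` is tangent to `X` along `W`. -/
def TangentAlong (M X W : Set (PP K ι)) : Prop :=
  ∀ x ∈ W, IsSmoothPoint X x → embTangentSpace X x ⊆ M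

/-- `S` has exactly `m` irreducible components, all of them projective linear
subspaces, and these components are linearly independent. -/
def ComponentsAreIndepLinear (S : Set (PP K ι)) (m : ℕ) : Prop :=
  ∃ C : Fin m → Set (PP K ι), Function.Injective C ∧
    (∀ D : Set (PP K ι), IsZIrredComponent S D ↔ ∃ i, D = C i) ∧
    (∀ i, IsProjLinear (C i)) ∧
    Module.finrank K (vspan S) = ∑ i, Module.finrank K (vspan (C i))


/-- The Segre variety: the image of `ℙ^{n 1} × ⋯ × ℙ^{n s}` under the Segre
embedding, given by the complete linear system `|O(1,…,1)|`. -/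
def segreVariety (K : Type*) [Field K] (s : ℕ) (n : Fin s → ℕ) :
    Set (PP K (∀ i : Fin s, Fin (n i + 1))) :=
  {x | ∃ u : ∀ i : Fin s, Fin (n i + 1) → K,
    x.submodule = Submodule.span K
      ({fun t => ∏ i, u i (t i)} : Set ((∀ i : Fin s, Fin (n i + 1)) → K))}

/-- The projection of `L ⊆ Segre` to the `i`-th factor is a single point, i.e. `L`
lies in a single fiber of the `i`-th projection. -/
def SegreFactorIsPoint (K : Type*) [Field K] (s : ℕ) (n : Fin s → ℕ) (i : Fin s)
    (L : Set (PP K (∀ j : Fin s, Fin (n j + 1)))) : Prop :=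
  ∃ w : Fin (n i + 1) → K, w ≠ 0 ∧ ∀ x ∈ L,
    ∃ u : ∀ j : Fin s, Fin (n j + 1) → K,
      x.submodule = Submodule.span K
        ({fun t => ∏ j, u j (t j)} : Set ((∀ j : Fin s, Fin (n j + 1)) → K)) ∧
      u i ∈ Submodule.span K ({w} : Set (Fin (n i + 1) → K))

/-- Index type for the Segre–Veronese embedding of multidegree `d`:
multi-indices of degree `d i` in the homogeneous variables of the `i`-th factor. -/
abbrev svIndex (s : ℕ) (n d : Fin s → ℕ) : Type :=
  ∀ i : Fin s, {w : Fin (n i + 1) → Fin (d i + 1) // ∑ j, (w j : ℕ) = d i}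

/-- The Segre–Veronese variety of multidegree `d`: the image of
`ℙ^{n 1} × ⋯ × ℙ^{n s}` under the embedding by `|L_1^{d 1} ⊗ ⋯ ⊗ L_s^{d s}|`. -/
def segreVeroneseVariety (K : Type*) [Field K] (s : ℕ) (n d : Fin s → ℕ) :
    Set (PP K (svIndex s n d)) :=
  {x | ∃ u : ∀ i : Fin s, Fin (n i + 1) → K,
    x.submodule = Submodule.span K
      ({fun t => ∏ i, ∏ j, u i j ^ ((t i).1 j : ℕ)} : Set (svIndex s n d → K))}

/-- The vector of the moments of degree `≤ d` of the one-dimensional Gaussian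
distribution with mean `μ` and variance `t`. -/
def gaussMomentVec (K : Type*) [Field K] (d : ℕ) (μ t : K) : Fin (d + 1) → K := fun i =>
  ∑ j ∈ Finset.range ((i : ℕ) / 2 + 1),
    ((Nat.choose (i : ℕ) (2 * j) * Nat.doubleFactorial (2 * j - 1) : ℕ) : K) *
      t ^ j * μ ^ ((i : ℕ) - 2 * j)

/-- The Gaussian moment variety `𝒢_{1,d} ⊆ ℙ^d`. -/
def gaussianMomentVariety (K : Type*) [Field K] (d : ℕ) : Set (PP K (Fin (d + 1))) :=
  zclosure {x | ∃ μ t : K,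
    x.submodule = Submodule.span K ({gaussMomentVec K d μ t} : Set (Fin (d + 1) → K))}

/-- Zariski-closed families of `m`-tuples of coefficient vectors of linear forms. -/
def IsAffineClosedFamily {m : ℕ} (T : Set (Fin m → ι → K)) : Prop :=
  ∃ S : Set (MvPolynomial (Fin m × ι) K),
    T = {h | ∀ f ∈ S, MvPolynomial.eval (fun p => h p.1 p.2) f = 0}

/-- The linear subspace cut out by the `m` linear forms with coefficient vectors `h`. -/
def linearSlice {m : ℕ} (h : Fin m → ι → K) : Set (PP K ι) :=
  {x | ∀ j : Fin m, ∑ i : ι, h j i * x.rep i = 0}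

/-- `x` lies on the hyperplane with coefficient vector `f`. -/
def inHyperplane (f : ι → K) (x : PP K ι) : Prop :=
  ∑ i : ι, f i * x.rep i = 0

/-- `X ⊆ ℙ^r` (of dimension `n`, `r + 1 = card ι`) is very strange: for a general
codimension-`n` linear subspace `M`, some `r - n + 2` points of `X ∩ M` lie in a
hyperplane of `M`, i.e. in a linear subspace of projective dimension `r - n - 1`. -/
def VeryStrange (n : ℕ) (X : Set (PP K ι)) : Prop :=
  ∃ T : Set (Fin n → ι → K), IsAffineClosedFamily T ∧ (∃ h, h ∉ T) ∧
    ∀ h : Fin n → ι → K, h ∉ T →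
      ∃ A : Finset (PP K ι), ↑A ⊆ X ∩ linearSlice h ∧
        A.card = Fintype.card ι + 1 - n ∧
        Module.finrank K (vspan (A : Set (PP K ι))) ≤ Fintype.card ι - 1 - n


section
open MvPolynomial
universe u w
variable {K : Type*} [Field K] {ι : Type*} [Fintype ι]

section Generic
variable {J : Type*}

/-- irreducibility of a set of vectors, tested on polynomials -/
def GIrr (S : Set (J → K)) : Prop :=
  S.Nonempty ∧ ∀ f g : MvPolynomial J K, (∃ v ∈ S, eval v f ≠ 0) → (∃ v ∈ S, eval v g ≠ 0) →
    ∃ v ∈ S, eval v f ≠ 0 ∧ eval v g ≠ 0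

/-- generic point -/
def Gen {F : Type*} [Field F] [Algebra K F] (S : Set (J → K)) (z : J → F) : Prop :=
  ∀ f : MvPolynomial J K, aeval z f = 0 ↔ ∀ v ∈ S, eval v f = 0

theorem exists_gen {K : Type u} {J : Type w} [Field K] {S : Set (J → K)} (hS : GIrr S) :
    ∃ (F : Type (max u w)) (_ : Field F) (_ : Algebra K F) (z : J → F), Gen S z ∧
      ∀ φ : F, ∃ f g : MvPolynomial J K, aeval z g ≠ 0 ∧ φ * aeval z g = aeval z f := by
  classical
  let I : Ideal (MvPolynomial J K) := vanishingIdeal K S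
  have hI : ∀ f, f ∈ I ↔ ∀ v ∈ S, eval v f = 0 := by
    intro f
    simp only [I, mem_vanishingIdeal_iff, MvPolynomial.aeval_eq_eval]
  have hp : I.IsPrime := by
    constructor
    · intro h
      obtain ⟨v, hv⟩ := hS.1
      have := (hI 1).1 (by rw [h]; trivial) v hv
      simp at this
    · intro f g hfg
      by_contra hc
      push Not at hc
      rw [hI, hI] at hc
      push Not at hc
      obtain ⟨v, hv, h1, h2⟩ := hS.2 f g hc.1 hc.2
      have := (hI _).1 hfg v hv
      simp [h1, h2] at this
  let R := MvPolynomial J K ⧸ I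
  have : IsDomain R := Ideal.Quotient.isDomain I
  let F := FractionRing R
  let z : J → F := fun j => algebraMap R F (Ideal.Quotient.mk I (X j))
  have hz : ∀ f, aeval z f = algebraMap R F (Ideal.Quotient.mk I f) := by
    intro f
    have : aeval z = (IsScalarTower.toAlgHom K R F).comp (Ideal.Quotient.mkₐ K I) := by
      ext j; simp [z]; rfl
    rw [this]; rfl
  refine ⟨F, inferInstance, inferInstance, z, ?_, ?_⟩
  · intro f
    rw [hz, ← hI]
    rw [FaithfulSMul.algebraMap_eq_zero_iff, Ideal.Quotient.eq_zero_iff_mem]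
  · intro φ
    obtain ⟨a, b, hb, rfl⟩ := IsFractionRing.div_surjective (A := R) φ
    obtain ⟨f, rfl⟩ := Ideal.Quotient.mk_surjective a
    obtain ⟨g, rfl⟩ := Ideal.Quotient.mk_surjective b
    have hg : aeval z g ≠ 0 := by
      rw [hz, Ne, FaithfulSMul.algebraMap_eq_zero_iff]
      exact nonZeroDivisors.ne_zero hb
    refine ⟨f, g, hg, ?_⟩
    rw [← hz g, ← hz f, div_mul_cancel₀ _ hg]

theorem norm0 {F : Type*} [Field F] [Algebra K F] {L : Type*} {y : L → F}
    (A : Subalgebra K F) (hyA : ∀ l, y l ∈ A) {φ : F}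
    (hφA : φ ∈ A) (hφ : φ ≠ 0) (halg : IsAlgebraic (Algebra.adjoin K (Set.range y)) φ) :
    ∃ c : MvPolynomial L K, c ≠ 0 ∧ ∃ h ∈ A, aeval y c = φ * h := by
  obtain ⟨p, hp0, hp⟩ := halg.exists_nonzero_coeff_and_aeval_eq_zero
    (mem_nonZeroDivisors_of_ne_zero hφ)
  have hle : Algebra.adjoin K (Set.range y) ≤ A := by
    rw [Algebra.adjoin_le_iff]; rintro _ ⟨l, rfl⟩; exact hyA l
  have hmem : ((p.coeff 0 : Algebra.adjoin K (Set.range y)) : F) ∈ (aeval y : MvPolynomial L K →ₐ[K] F).range := by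
    rw [← Algebra.adjoin_range_eq_range_aeval]; exact (p.coeff 0).2
  obtain ⟨c, hc⟩ := hmem
  refine ⟨c, ?_, -(Polynomial.aeval φ p.divX), ?_, ?_⟩
  · rintro rfl
    apply hp0
    apply Subtype.ext
    rw [← hc]; simp
  · apply neg_mem
    rw [Polynomial.aeval_eq_sum_range]
    refine sum_mem fun i _ => ?_
    rw [Algebra.smul_def]
    exact mul_mem (hle (p.divX.coeff i).2) (pow_mem hφA i)
  · have h1 : Polynomial.aeval φ p = Polynomial.aeval φ p.divX * φ + aeval y c := by
      conv_lhs => rw [← Polynomial.divX_mul_X_add p]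
      simp only [map_add, map_mul, Polynomial.aeval_X, Polynomial.aeval_C]
      congr 1
      exact hc.symm
    rw [hp] at h1
    linear_combination -h1

/-- rank lemma -/
theorem rank_le {F : Type*} [Field F] [Algebra K F] {L : Type*} [Fintype L] {y : L → F}
    (hy : AlgebraicIndependent K y) (B : Finset F)
    (hB : ∀ l, IsAlgebraic (Algebra.adjoin K (B : Set F)) (y l)) : Fintype.card L ≤ B.card := by
  classical
  let M := AlgebraicIndependent.matroid K F
  have h1 : M.Indep (Set.range y) := by
    rw [AlgebraicIndependent.matroid_indep_iff]
    exact hy.coe_range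
  have h2 : Set.range y ⊆ M.closure (B : Set F) := by
    rintro _ ⟨l, rfl⟩
    rw [AlgebraicIndependent.matroid_closure_eq]
    exact hB l
  have h3 : M.eRk (Set.range y) ≤ M.eRk (B : Set F) := by
    rw [← M.eRk_closure_eq (B : Set F)]
    exact M.eRk_mono h2
  have h4 := h3.trans (M.eRk_le_encard _)
  rw [h1.eRk_eq_encard, Set.encard_coe_eq_coe_finsetCard, ← Set.image_univ,
    hy.injective.encard_image, Set.encard_univ, ENat.card_eq_coe_fintype_card] at h4
  exact_mod_cast h4

/-- independence of coordinates on a set of vectors -/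
def Indep (S : Set (J → K)) (s : Set J) : Prop :=
  ∀ f : MvPolynomial s K, (∀ v ∈ S, eval (fun i : s => v i) f = 0) → f = 0

theorem Indep.mono_left {S S' : Set (J → K)} {s : Set J} (h : Indep S s) (hS : S ⊆ S') :
    Indep S' s := fun f hf => h f fun v hv => hf v (hS hv)

theorem Gen.indep_iff {F : Type*} [Field F] [Algebra K F] {S : Set (J → K)} {z : J → F}
    (hz : Gen S z) (s : Set J) : AlgebraicIndepOn K z s ↔ Indep S s := by
  rw [AlgebraicIndepOn, algebraicIndependent_iff]
  refine forall_congr' fun f => ?_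
  have h1 := hz (rename Subtype.val f)
  rw [aeval_rename] at h1
  simp only [eval_rename] at h1
  rw [show (fun i : s => z i) = z ∘ Subtype.val from rfl, h1]
  rfl

theorem Indep.mono_right {S : Set (J → K)} {s t : Set J} (h : Indep S t) (hs : s ⊆ t) :
    Indep S s := by
  intro f hf
  have : rename (Set.inclusion hs) f = 0 := by
    apply h
    intro v hv
    rw [eval_rename]
    exact hf v hv
  exact rename_injective _ (Set.inclusion_injective hs) (by simpa using this)

theorem Gen.maximal_alg {F : Type*} [Field F] [Algebra K F] {S : Set (J → K)} {z : J → F}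
    (hz : Gen S z) {s : Set J} (hs : Indep S s)
    (hmax : ∀ j ∉ s, ¬ Indep S (insert j s)) (j : J) :
    IsAlgebraic (Algebra.adjoin K (z '' s)) (z j) := by
  by_cases hj : j ∈ s
  · exact isAlgebraic_algebraMap (⟨z j, Algebra.subset_adjoin ⟨j, hj, rfl⟩⟩ : Algebra.adjoin K (z '' s))
  · by_contra hc
    apply hmax j hj
    rw [← hz.indep_iff]
    rw [AlgebraicIndepOn.insert_iff hj]
    exact ⟨(hz.indep_iff s).2 hs, hc⟩

theorem alg_aeval {R F : Type*} [Field F] [CommRing R] [IsDomain R] [Algebra K R] [Algebra K F] [Algebra R F]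
    [IsScalarTower K R F] {z : J → F}
    (halg : ∀ j, IsAlgebraic R (z j)) (f : MvPolynomial J K) : IsAlgebraic R (aeval z f) := by
  have hle : (aeval z : MvPolynomial J K →ₐ[K] F).range ≤ Subalgebra.restrictScalars K
    (Subalgebra.algebraicClosure R F) := by
    rw [← Algebra.adjoin_range_eq_range_aeval, Algebra.adjoin_le_iff]
    rintro _ ⟨j, rfl⟩
    exact halg j
  exact hle ⟨f, rfl⟩

theorem Gen.range {F : Type*} [Field F] [Algebra K F] {S : Set (J → K)} {z : J → F}
    (hz : Gen S z) {s : Set J} {f : MvPolynomial J K} (hf : ∃ v ∈ S, eval v f ≠ 0)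
    (halg : ∀ j, IsAlgebraic (Algebra.adjoin K (z '' s)) (z j)) :
    ∃ c : MvPolynomial s K, c ≠ 0 ∧ ∃ h : MvPolynomial J K,
      ∀ v ∈ S, eval (fun i : s => v i) c = eval v f * eval v h := by
  have e : z '' s = Set.range (fun i : s => z i) := by
    rw [Set.image_eq_range]
  rw [e] at halg
  have hfz : aeval z f ≠ 0 := by
    rw [Ne, hz]; push Not; exact hf
  obtain ⟨c, hc, h, hh, hch⟩ := norm0 (y := fun i : s => z i)
    (aeval z : MvPolynomial J K →ₐ[K] F).range
    (fun l => ⟨X l.1, by simp⟩) (φ := aeval z f) ⟨f, rfl⟩ hfz (by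
      exact alg_aeval halg f)
  obtain ⟨h, rfl⟩ := hh
  refine ⟨c, hc, h, ?_⟩
  have h2 : aeval z (rename Subtype.val c - f * h) = 0 := by
    rw [map_sub, map_mul, aeval_rename]
    rw [sub_eq_zero]
    exact hch
  rw [hz] at h2
  intro v hv
  have := h2 v hv
  rw [map_sub, map_mul, eval_rename, sub_eq_zero] at this
  exact this

end Generic

end

section
open MvPolynomial
universe u w
set_option linter.unusedSectionVars false
set_option linter.style.haveILetI false
variable {K : Type*} [Field K] {ι : Type*} [Fintype ι]

section Lines
variable {J : Type*}

/-- restriction of a polynomial to a line -/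
def linePoly (f : MvPolynomial J K) (v w : J → K) : Polynomial K :=
  aeval (fun j => Polynomial.C (v j) + Polynomial.C (w j) * Polynomial.X) f

theorem linePoly_eval (f : MvPolynomial J K) (v w : J → K) (t : K) :
    (linePoly f v w).eval t = eval (v + t • w) f := by
  have : (Polynomial.evalRingHom t).comp
      (aeval (fun j => Polynomial.C (v j) + Polynomial.C (w j) * Polynomial.X) :
        MvPolynomial J K →ₐ[K] Polynomial K).toRingHom = eval (v + t • w) := by
    apply MvPolynomial.ringHom_ext
    · intro r; simp
    · intro i; simp; ring
  rw [← this]; rfl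

theorem poly_two_ne [Infinite K] {p q : Polynomial K} (hp : ∃ s, p.eval s ≠ 0)
    (hq : ∃ s, q.eval s ≠ 0) : ∃ t, p.eval t ≠ 0 ∧ q.eval t ≠ 0 := by
  have hp' : p ≠ 0 := by rintro rfl; simp at hp
  have hq' : q ≠ 0 := by rintro rfl; simp at hq
  by_contra hc
  push Not at hc
  have : p * q = 0 := by
    apply Polynomial.funext
    intro t
    rw [Polynomial.eval_mul, Polynomial.eval_zero]
    by_cases h : p.eval t = 0
    · rw [h, zero_mul]
    · rw [hc t h, mul_zero]
  exact mul_ne_zero hp' hq' this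

theorem GIrr_submodule [Infinite K] (T : Submodule K (J → K)) : GIrr (T : Set (J → K)) := by
  refine ⟨⟨0, T.zero_mem⟩, ?_⟩
  rintro f g ⟨v, hv, hfv⟩ ⟨w, hw, hgw⟩
  obtain ⟨t, h1, h2⟩ := poly_two_ne (p := linePoly f v (w - v)) (q := linePoly g v (w - v))
    ⟨0, by rw [linePoly_eval]; simpa using hfv⟩ ⟨1, by rw [linePoly_eval]; simpa using hgw⟩
  rw [linePoly_eval] at h1 h2
  exact ⟨_, T.add_mem hv (T.smul_mem t (T.sub_mem hw hv)), h1, h2⟩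

theorem homog_eval_smul {f : MvPolynomial J K} {d : ℕ} (hf : f.IsHomogeneous d) (v : J → K) (t : K) :
    eval (t • v) f = t ^ d * eval v f := by
  rw [eval_eq, eval_eq, Finset.mul_sum]
  refine Finset.sum_congr rfl fun m hm => ?_
  have h1 : ∑ i ∈ m.support, m i = d := by
    have := hf (mem_support_iff.1 hm)
    rw [← this, Finsupp.weight_apply]
    simp [Finsupp.sum]
  have h2 : ∏ i ∈ m.support, (t • v) i ^ m i = t ^ d * ∏ i ∈ m.support, v i ^ m i := by
    rw [← h1, ← Finset.prod_pow_eq_pow_sum, ← Finset.prod_mul_distrib]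
    refine Finset.prod_congr rfl fun i _ => ?_
    simp [mul_pow]
  rw [h2]; ring

theorem eval_smul_sum (f : MvPolynomial J K) (v : J → K) (t : K) :
    eval (t • v) f = ∑ d ∈ Finset.range (f.totalDegree + 1),
      t ^ d * eval v (homogeneousComponent d f) := by
  conv_lhs => rw [← sum_homogeneousComponent f]
  rw [map_sum]
  refine Finset.sum_congr rfl fun d _ => ?_
  exact homog_eval_smul (homogeneousComponent_isHomogeneous d f) v t

theorem homog_vanish [Infinite K] {f : MvPolynomial J K} {v : J → K}
    (h : ∀ t : K, eval (t • v) f = 0) (d : ℕ) : eval v (homogeneousComponent d f) = 0 := by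
  by_cases hd : f.totalDegree < d
  · rw [homogeneousComponent_eq_zero _ _ hd, map_zero]
  have hp : (∑ e ∈ Finset.range (f.totalDegree + 1),
      Polynomial.C (eval v (homogeneousComponent e f)) * Polynomial.X ^ e : Polynomial K) = 0 := by
    apply Polynomial.funext
    intro t
    rw [Polynomial.eval_finsetSum, Polynomial.eval_zero, ← h t, eval_smul_sum]
    refine Finset.sum_congr rfl fun e _ => ?_
    simp only [Polynomial.eval_mul, Polynomial.eval_C, Polynomial.eval_pow, Polynomial.eval_X]; ring
  have h2 := congrArg (fun p => Polynomial.coeff p d) hp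
  simp only [Polynomial.finsetSum_coeff, Polynomial.coeff_C_mul_X_pow, Polynomial.coeff_zero] at h2
  rw [Finset.sum_ite_eq, if_pos (by simp; omega)] at h2
  exact h2

end Lines

section Proj

theorem mem_coneOf {S : Set (PP K ι)} {v : ι → K} : v ∈ coneOf S ↔ ∃ x ∈ S, v ∈ x.submodule := by
  simp [coneOf]

theorem rep_mem (x : PP K ι) : x.rep ∈ x.submodule := by
  rw [Projectivization.submodule_eq]; exact Submodule.mem_span_singleton_self _

theorem mem_line_iff {x : PP K ι} {v : ι → K} : v ∈ x.submodule ↔ ∃ t : K, t • x.rep = v := by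
  rw [Projectivization.submodule_eq, Submodule.mem_span_singleton]

theorem eq_mk_of_mem {x : PP K ι} {v : ι → K} (hv : v ≠ 0) (h : v ∈ x.submodule) :
    x = Projectivization.mk K v hv := by
  obtain ⟨t, rfl⟩ := mem_line_iff.1 h
  have ht : t ≠ 0 := by rintro rfl; simp at hv
  conv_lhs => rw [← Projectivization.mk_rep x]
  rw [Projectivization.mk_eq_mk_iff']
  refine ⟨t⁻¹, ?_⟩
  rw [smul_smul, inv_mul_cancel₀ ht, one_smul]

theorem mem_mk_submodule {v : ι → K} (hv : v ≠ 0) : v ∈ (Projectivization.mk K v hv).submodule := by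
  rw [Projectivization.submodule_mk]; exact Submodule.mem_span_singleton_self _

theorem mem_coneOf_iff {S : Set (PP K ι)} {v : ι → K} (hv : v ≠ 0) :
    v ∈ coneOf S ↔ Projectivization.mk K v hv ∈ S := by
  rw [mem_coneOf]
  constructor
  · rintro ⟨x, hx, h⟩
    rwa [← eq_mk_of_mem hv h]
  · intro h
    exact ⟨_, h, mem_mk_submodule hv⟩

theorem coneOf_smul {S : Set (PP K ι)} {v : ι → K} (hv : v ∈ coneOf S) (t : K) :
    t • v ∈ coneOf S := by
  rw [mem_coneOf] at *
  obtain ⟨x, hx, h⟩ := hv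
  exact ⟨x, hx, Submodule.smul_mem _ _ h⟩

theorem coneOf_mono {S S' : Set (PP K ι)} (h : S ⊆ S') : coneOf S ⊆ coneOf S' := by
  intro v hv
  rw [mem_coneOf] at *
  obtain ⟨x, hx, h'⟩ := hv
  exact ⟨x, h hx, h'⟩

theorem zeroLocus_closed [Infinite K] (S : Set (MvPolynomial ι K)) : IsZClosed (zeroLocus S) := by
  refine ⟨{f | ∃ g ∈ S, ∃ d, f = homogeneousComponent d g}, ?_, ?_⟩
  · rintro _ ⟨g, _, d, rfl⟩
    exact ⟨d, homogeneousComponent_isHomogeneous d g⟩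
  · ext x
    constructor
    · rintro hx _ ⟨g, hg, d, rfl⟩ v hv
      exact homog_vanish (fun t => hx g hg _ (Submodule.smul_mem _ t hv)) d
    · intro hx g hg v hv
      rw [← one_smul K v, eval_smul_sum]
      refine Finset.sum_eq_zero fun d _ => ?_
      rw [hx _ ⟨g, hg, d, rfl⟩ v hv, mul_zero]

theorem zclosure_closed [Infinite K] (S : Set (PP K ι)) : IsZClosed (zclosure S) := by
  have : zclosure S = zeroLocus {f : MvPolynomial ι K | ∀ v ∈ coneOf S, eval v f = 0} := by
    apply Set.Subset.antisymm
    · refine Set.sInter_subset_of_mem ⟨zeroLocus_closed _, ?_⟩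
      intro x hx f hf v hv
      exact hf v (mem_coneOf.2 ⟨x, hx, hv⟩)
    · intro x hx Y hY
      obtain ⟨⟨T, -, rfl⟩, h2⟩ := hY
      intro f hf v hv
      refine hx f ?_ v hv
      intro w hw
      obtain ⟨y, hy, hwy⟩ := mem_coneOf.1 hw
      exact h2 hy f hf w hwy
  rw [this]; exact zeroLocus_closed _

theorem subset_zclosure (S : Set (PP K ι)) : S ⊆ zclosure S :=
  Set.subset_sInter fun _ h => h.2

theorem zclosure_subset {S Y : Set (PP K ι)} (hY : IsZClosed Y) (h : S ⊆ Y) : zclosure S ⊆ Y :=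
  Set.sInter_subset_of_mem ⟨hY, h⟩

theorem zclosure_eq {S : Set (PP K ι)} (h : IsZClosed S) : zclosure S = S :=
  Set.Subset.antisymm (zclosure_subset h subset_rfl) (subset_zclosure S)

theorem vanish_zclosure [Infinite K] {S : Set (PP K ι)} {f : MvPolynomial ι K}
    (h : ∀ v ∈ coneOf S, eval v f = 0) : ∀ v ∈ coneOf (zclosure S), eval v f = 0 := by
  intro v hv
  obtain ⟨x, hx, hvx⟩ := mem_coneOf.1 hv
  exact zclosure_subset (zeroLocus_closed {f}) (fun y hy g hg w hw => by
    rw [Set.mem_singleton_iff.1 hg]; exact h w (mem_coneOf.2 ⟨y, hy, hw⟩)) hx f rfl v hvx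

theorem girr_of_irr [Infinite K] {S : Set (PP K ι)} (h : IsZIrreducible S) : GIrr (coneOf S) := by
  obtain ⟨⟨x0, hx0⟩, h2⟩ := h
  refine ⟨⟨_, mem_coneOf.2 ⟨x0, hx0, rep_mem x0⟩⟩, ?_⟩
  intro f g hf hg
  have key := h2 (zeroLocus {f}) (zeroLocus {g}) (zeroLocus_closed _) (zeroLocus_closed _)
  have hne : ∀ f : MvPolynomial ι K, (∃ v ∈ coneOf S, eval v f ≠ 0) → ¬ S ⊆ zeroLocus {f} := by
    rintro f ⟨v, hv, hf⟩ hs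
    obtain ⟨x, hx, hvx⟩ := mem_coneOf.1 hv
    exact hf (hs hx f rfl v hvx)
  have : ¬ S ⊆ zeroLocus {f} ∪ zeroLocus {g} := fun h => (key h).elim (hne f hf) (hne g hg)
  rw [Set.not_subset] at this
  obtain ⟨x, hx, hxu⟩ := this
  simp only [Set.mem_union, not_or, zeroLocus, Set.mem_setOf_eq, Set.mem_singleton_iff,
    forall_eq, not_forall] at hxu
  obtain ⟨⟨v, hv, hfv⟩, ⟨w, hw, hgw⟩⟩ := hxu
  obtain ⟨t, h1, h2⟩ := poly_two_ne (p := linePoly f v (w - v)) (q := linePoly g v (w - v))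
    ⟨0, by rw [linePoly_eval]; simpa using hfv⟩ ⟨1, by rw [linePoly_eval]; simpa using hgw⟩
  rw [linePoly_eval] at h1 h2
  exact ⟨_, mem_coneOf.2 ⟨x, hx, Submodule.add_mem _ hv
    (Submodule.smul_mem _ t (Submodule.sub_mem _ hw hv))⟩, h1, h2⟩

theorem irr_of_girr {S : Set (PP K ι)} (h : GIrr (coneOf S)) : IsZIrreducible S := by
  obtain ⟨⟨v, hv⟩, h2⟩ := h
  obtain ⟨x, hx, -⟩ := mem_coneOf.1 hv
  refine ⟨⟨x, hx⟩, ?_⟩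
  rintro _ _ ⟨A, -, rfl⟩ ⟨B, -, rfl⟩ hsub
  by_contra hc
  push Not at hc
  simp only [Set.not_subset, zeroLocus, Set.mem_setOf_eq, not_forall] at hc
  obtain ⟨⟨x, hx, f, hf, v, hv, hfv⟩, ⟨y, hy, g, hg, w, hw, hgw⟩⟩ := hc
  obtain ⟨u, hu, h1, h3⟩ := h2 f g ⟨v, mem_coneOf.2 ⟨x, hx, hv⟩, hfv⟩ ⟨w, mem_coneOf.2 ⟨y, hy, hw⟩, hgw⟩
  obtain ⟨z, hz, huz⟩ := mem_coneOf.1 hu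
  rcases hsub hz with h | h
  · exact h1 (h f hf u huz)
  · exact h3 (h g hg u huz)

/-- cone over a closed set is cut out by its polynomials -/
theorem mem_of_vanish {S : Set (PP K ι)} (hS : IsZClosed S) {x : PP K ι}
    (h : ∀ f : MvPolynomial ι K, (∀ v ∈ coneOf S, eval v f = 0) → ∀ v ∈ x.submodule, eval v f = 0) :
    x ∈ S := by
  obtain ⟨T, -, rfl⟩ := hS
  intro f hf v hv
  refine h f ?_ v hv
  intro w hw
  obtain ⟨y, hy, hwy⟩ := mem_coneOf.1 hw
  exact hy f hf w hwy

end Proj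

end

section
open MvPolynomial
universe u w
set_option linter.unusedSectionVars false
set_option linter.style.haveILetI false
variable {K : Type*} [Field K] {ι : Type*} [Fintype ι]

section Dim
open Classical in
/-- max number of independent coordinates -/
def rho (S : Set (ι → K)) : ℕ :=
  ((Finset.univ : Finset (Finset ι)).filter (fun s : Finset ι => Indep S (s : Set ι))).sup Finset.card

theorem card_le_rho {S : Set (ι → K)} {s : Finset ι} (h : Indep S (s : Set ι)) :
    s.card ≤ rho S := by
  classical
  unfold rho
  exact Finset.le_sup (f := Finset.card) (by simp [h])

theorem indep_empty {S : Set (ι → K)} (hS : S.Nonempty) : Indep S (∅ : Set ι) := by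
  intro f hf
  obtain ⟨v, hv⟩ := hS
  have h := hf v hv
  rw [eq_C_of_isEmpty f] at h ⊢
  simpa using h

theorem exists_rho {S : Set (ι → K)} (hS : S.Nonempty) :
    ∃ s : Finset ι, Indep S (s : Set ι) ∧ s.card = rho S := by
  classical
  have hne : ((Finset.univ : Finset (Finset ι)).filter (fun s : Finset ι => Indep S (s : Set ι))).Nonempty :=
    ⟨∅, by simpa using indep_empty hS⟩
  obtain ⟨s, hs, h⟩ := Finset.exists_mem_eq_sup _ hne Finset.card
  refine ⟨s, by simpa using hs, ?_⟩
  unfold rho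
  rw [h]

theorem rho_mono {S S' : Set (ι → K)} (hS : S.Nonempty) (h : S ⊆ S') : rho S ≤ rho S' := by
  obtain ⟨s, hs, hc⟩ := exists_rho hS
  rw [← hc]
  exact card_le_rho (hs.mono_left h)

theorem rho_pos [Infinite K] {S : Set (PP K ι)} (hS : S.Nonempty) : 1 ≤ rho (coneOf S) := by
  classical
  obtain ⟨x, hx⟩ := hS
  obtain ⟨j, hj⟩ := Function.ne_iff.1 x.rep_nonzero
  rw [← Finset.card_singleton j]
  apply card_le_rho
  rw [Finset.coe_singleton]
  intro f hf
  apply MvPolynomial.funext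
  intro t
  rw [map_zero]
  have := hf ((t ⟨j, rfl⟩ / x.rep j) • x.rep) (mem_coneOf.2 ⟨x, hx, Submodule.smul_mem _ _ (rep_mem x)⟩)
  rw [← this]
  congr 2
  ext ⟨i, hi⟩
  obtain rfl := Set.mem_singleton_iff.1 hi
  have hj' : x.rep i ≠ 0 := hj
  simp [hj']

/-- a maximal independent set of coordinates makes all coordinates algebraic -/
theorem rho_alg {F : Type*} [Field F] [Algebra K F] {S : Set (ι → K)} {z : ι → F}
    (hz : Gen S z) {s : Finset ι} (hs : Indep S (s : Set ι)) (hc : s.card = rho S) (j : ι) :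
    IsAlgebraic (Algebra.adjoin K (z '' s)) (z j) := by
  classical
  refine hz.maximal_alg hs ?_ j
  intro i hi hI
  have : Indep S ((insert i s : Finset ι) : Set ι) := by simpa using hI
  have h := card_le_rho this
  rw [Finset.card_insert_of_notMem (by simpa using hi)] at h
  omega

theorem rho_strict [Infinite K] {S S' : Set (PP K ι)} (hS : IsZClosed S) (hi : IsZIrreducible S)
    (hi' : IsZIrreducible S') (hlt : S ⊂ S') : rho (coneOf S) < rho (coneOf S') := by
  have hg := girr_of_irr hi
  have hg' := girr_of_irr hi'
  obtain ⟨s, hs, hc⟩ := exists_rho hg.1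
  have hsub := coneOf_mono hlt.1
  rw [← hc]
  refine lt_of_le_of_ne (card_le_rho (hs.mono_left hsub)) fun heq => ?_
  obtain ⟨F, _, _, z, hz, -⟩ := exists_gen hg'
  obtain ⟨x, hx', hx⟩ := Set.exists_of_ssubset hlt
  have : ∃ f : MvPolynomial ι K, (∀ v ∈ coneOf S, eval v f = 0) ∧ ∃ v ∈ x.submodule, eval v f ≠ 0 := by
    by_contra hcon
    push Not at hcon
    exact hx (mem_of_vanish hS hcon)
  obtain ⟨f, hf, v, hv, hfv⟩ := this
  obtain ⟨c, hc0, h, hh⟩ := hz.range (s := (s : Set ι)) ⟨v, mem_coneOf.2 ⟨x, hx', hv⟩, hfv⟩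
    (rho_alg hz (hs.mono_left hsub) heq)
  apply hc0
  apply hs
  intro w hw
  rw [hh w (hsub hw), hf w hw, zero_mul]

theorem length_le_rho [Infinite K] {S : Set (PP K ι)} (hS : IsZClosed S)
    (p : LTSeries {Y : Set (PP K ι) // IsZClosed Y ∧ IsZIrreducible Y ∧ Y ⊆ zclosure S}) :
    p.length + 1 ≤ rho (coneOf S) := by
  let φ : {Y : Set (PP K ι) // IsZClosed Y ∧ IsZIrreducible Y ∧ Y ⊆ zclosure S} → ℕ :=
    fun Y => rho (coneOf Y.1)
  have hφ : StrictMono φ := fun Y Z h => rho_strict Y.2.1 Y.2.2.1 Z.2.2.1 h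
  have h1 := (p.map φ hφ).head_add_length_le_nat
  rw [LTSeries.head_map, LTSeries.last_map, LTSeries.map_length] at h1
  have h2 : 1 ≤ φ p.head := rho_pos p.head.2.2.1.1
  have h3 : φ p.last ≤ rho (coneOf S) := by
    apply rho_mono (girr_of_irr p.last.2.2.1).1
    apply coneOf_mono
    exact p.last.2.2.2.trans (zclosure_eq hS).subset
  omega

theorem zdim_upper [Infinite K] {S : Set (PP K ι)} (hS : IsZClosed S) {d : ℕ}
    (h : ((d : ℕ∞) : WithBot ℕ∞) ≤ zdim S) : d + 1 ≤ rho (coneOf S) := by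
  unfold zdim at h
  rw [show ((d : ℕ∞) : WithBot ℕ∞) = ((d : ℕ) : WithBot ℕ∞) from rfl, Order.le_krullDim_iff] at h
  obtain ⟨p, hp⟩ := h
  have := length_le_rho hS p
  omega

theorem zdim_eq_of_rho_aux [Infinite K] {S : Set (PP K ι)} (hS : IsZClosed S) {d : ℕ}
    (h : rho (coneOf S) ≤ d + 1) : zdim S ≤ ((d : ℕ∞) : WithBot ℕ∞) := by
  unfold zdim Order.krullDim
  refine iSup_le fun p => ?_
  have := length_le_rho hS p
  have h2 : p.length ≤ d := by omega
  exact_mod_cast h2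

theorem exists_map_ltSeries {R S : Type*} [CommRing R] [CommRing S] (f : R →+* S)
    (hinj : Function.Injective f) (hint : f.IsIntegral) :
    ringKrullDim R ≤ ringKrullDim S := by
  algebraize [f]
  haveI : Algebra.IsIntegral R S := ⟨hint⟩
  unfold ringKrullDim
  conv_lhs => unfold Order.krullDim
  refine iSup_le fun l => ?_
  obtain ⟨P, hP⟩ := RingHom.IsIntegral.comap_surjective hint hinj l.head
  haveI : P.asIdeal.LiesOver (RelSeries.head l).asIdeal := ⟨by rw [← hP]; rfl⟩
  obtain ⟨L, hL, -⟩ := Ideal.exists_ltSeries_of_hasGoingUp (S := S) l P.asIdeal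
  rw [← hL]
  exact Order.LTSeries.length_le_krullDim L

theorem homog_aeval_smul {F : Type*} [Field F] [Algebra K F] {f : MvPolynomial ι K} {d : ℕ}
    (hf : f.IsHomogeneous d) (v : ι → F) (t : F) :
    aeval (t • v) f = t ^ d * aeval v f := by
  have := homog_eval_smul (hf.map (algebraMap K F)) v t
  rwa [eval_map, eval_map] at this

theorem zdim_lower [IsAlgClosed K] {S : Set (PP K ι)} (hS : IsZClosed S)
    (hi : IsZIrreducible S) {d : ℕ} (h : d + 1 ≤ rho (coneOf S)) :
    ((d : ℕ∞) : WithBot ℕ∞) ≤ zdim S := by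
  classical
  haveI : Infinite K := IsAlgClosed.instInfinite
  have hg := girr_of_irr hi
  obtain ⟨F, _, _, z, hz, -⟩ := exists_gen hg
  obtain ⟨x0, hx0⟩ := hi.1
  obtain ⟨i0, hi0⟩ := Function.ne_iff.1 x0.rep_nonzero
  have hz0 : z i0 ≠ 0 := by
    intro h0
    have := (hz (X i0)).1 (by simpa using h0) x0.rep (mem_coneOf.2 ⟨x0, hx0, rep_mem x0⟩)
    exact hi0 (by simpa using this)
  let a : ι → F := (z i0)⁻¹ • z
  have ha0 : a i0 = 1 := by simp [a, hz0]
  let R : Subalgebra K F := Algebra.adjoin K (Set.range a)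
  have hfg : Algebra.FiniteType K R := by
    rw [← Subalgebra.fg_iff_finiteType]
    exact ⟨(Set.finite_range a).toFinset, by simp [R]⟩
  have haR : ∀ j, a j ∈ R := fun j => Algebra.subset_adjoin ⟨j, rfl⟩
  obtain ⟨s, g, ginj, gint⟩ := exists_integral_inj_algHom_of_fg K R
  -- rank estimate
  have hds : d ≤ s := by
    obtain ⟨J0, hJ0, hcard⟩ := exists_rho hg.1
    let B : Finset F := insert (z i0) (Finset.univ.image fun i : Fin s => ((g (X i) : R) : F))
    have hB : ∀ j, IsAlgebraic (Algebra.adjoin K (B : Set F)) (z j) := by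
      intro j
      have h1 : IsAlgebraic (Algebra.adjoin K (B : Set F)) (a j) := by
        obtain ⟨p, pm, hp⟩ := gint ⟨a j, haR j⟩
        have hgB : ∀ i : Fin s, ((g (X i) : R) : F) ∈ Algebra.adjoin K (B : Set F) :=
          fun i => Algebra.subset_adjoin (by simp [B])
        let g' : MvPolynomial (Fin s) K →ₐ[K] Algebra.adjoin K (B : Set F) :=
          aeval (fun i => ⟨((g (X i) : R) : F), hgB i⟩)
        have hgg : (Algebra.adjoin K (B : Set F)).val.comp g' = R.val.comp g := by
          ext i; simp [g']
        refine IsIntegral.isAlgebraic ⟨p.map g'.toRingHom, pm.map _, ?_⟩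
        rw [Polynomial.eval₂_map]
        have h2 : (algebraMap (Algebra.adjoin K (B : Set F)) F).comp g'.toRingHom
            = R.val.toRingHom.comp g.toRingHom :=
          congrArg AlgHom.toRingHom hgg
        rw [h2]
        have h3 := congrArg R.val hp
        rw [map_zero] at h3
        rw [← h3]
        exact (Polynomial.hom_eval₂ p g.toRingHom R.val.toRingHom ⟨a j, haR j⟩).symm
      have h2 : IsAlgebraic (Algebra.adjoin K (B : Set F)) (z i0) :=
        isAlgebraic_algebraMap (⟨z i0, Algebra.subset_adjoin (by simp [B])⟩ :
          Algebra.adjoin K (B : Set F))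
      have h3 := h1.mul h2
      rwa [show a j * z i0 = z j by simp [a]; field_simp] at h3
    have h4 := rank_le ((hz.indep_iff _).2 hJ0) B (fun l => hB l)
    have h5 : B.card ≤ s + 1 := by
      refine (Finset.card_insert_le _ _).trans ?_
      have := Finset.card_image_le (s := (Finset.univ : Finset (Fin s)))
        (f := fun i : Fin s => ((g (X i) : R) : F))
      simp at this
      omega
    have h6 : Fintype.card (J0 : Set ι) = J0.card := by simp
    rw [h6] at h4
    omega
  have hdim : ((d : ℕ∞) : WithBot ℕ∞) ≤ ringKrullDim R := by
    refine le_trans ?_ (exists_map_ltSeries g.toRingHom ginj gint)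
    refine le_trans ?_ (ringKrullDim_add_natCard_le_ringKrullDim_mvPolynomial (Fin s))
    rw [ringKrullDim_eq_zero_of_field, zero_add, Nat.card_eq_fintype_card, Fintype.card_fin]
    exact_mod_cast hds
  refine hdim.trans ?_
  let q : MvPolynomial ι K →ₐ[K] R := aeval (fun j => ⟨a j, haR j⟩)
  have hqv : ∀ f, ((q f : R) : F) = aeval a f := by
    intro f
    have : R.val.comp q = aeval a := by ext j; simp [q]
    rw [← this]; rfl
  let Y : PrimeSpectrum R → Set (PP K ι) := fun p =>
    zeroLocus {f | (∃ d : ℕ, f.IsHomogeneous d) ∧ q f ∈ p.asIdeal}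
  let V : PrimeSpectrum R → Set (ι → K) := fun p =>
    MvPolynomial.zeroLocus K (Ideal.comap q.toRingHom p.asIdeal)
  have hV : ∀ p f, (∀ v ∈ V p, eval v f = 0) → q f ∈ p.asIdeal := by
    intro p f hf
    have h1 : f ∈ vanishingIdeal K (MvPolynomial.zeroLocus K (Ideal.comap q.toRingHom p.asIdeal)) := by
      rw [mem_vanishingIdeal_iff]
      intro v hv
      have := hf v hv
      rwa [← MvPolynomial.aeval_eq_eval] at this
    rw [IsPrime.vanishingIdeal_zeroLocus] at h1
    exact h1
  have hVe : ∀ p v, v ∈ V p → ∀ f, q f ∈ p.asIdeal → eval v f = 0 := by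
    intro p v hv f hf
    have := mem_zeroLocus_iff.1 hv f hf
    rwa [MvPolynomial.aeval_eq_eval] at this
  have hV1 : ∀ p v, v ∈ V p → v i0 = 1 := by
    intro p v hv
    have h1 : q (X i0 - 1) = 0 := by
      apply Subtype.ext
      rw [hqv]; simp [ha0]
    have := hVe p v hv (X i0 - 1) (by rw [h1]; exact zero_mem _)
    simpa [sub_eq_zero] using this
  have hVne : ∀ p v, v ∈ V p → v ≠ 0 := by
    rintro p v hv rfl
    simpa using hV1 p _ hv
  have hVY : ∀ p v, v ∈ V p → v ∈ coneOf (Y p) := by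
    intro p v hv
    rw [mem_coneOf_iff (hVne p v hv)]
    rintro f ⟨⟨d, hd⟩, hf⟩ w hw
    rw [Projectivization.submodule_mk, Submodule.mem_span_singleton] at hw
    obtain ⟨t, rfl⟩ := hw
    rw [homog_eval_smul hd, hVe p v hv f hf, mul_zero]
  have hYcl : ∀ p, IsZClosed (Y p) := fun p => zeroLocus_closed _
  have hYirr : ∀ p, IsZIrreducible (Y p) := by
    intro p
    constructor
    · by_contra hc
      have h1 := hV p 1 (fun v hv => by
        obtain ⟨x, hx, -⟩ := mem_coneOf.1 (hVY p v hv)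
        exact absurd ⟨x, hx⟩ hc)
      rw [map_one] at h1
      exact p.2.ne_top ((Ideal.eq_top_iff_one _).2 h1)
    · rintro _ _ ⟨A, hA, rfl⟩ ⟨B, hB, rfl⟩ hsub
      by_contra hc
      push Not at hc
      obtain ⟨⟨x, hx, hxA⟩, ⟨y, hy, hyB⟩⟩ := And.imp Set.not_subset.1 Set.not_subset.1 hc
      simp only [zeroLocus, Set.mem_ofPred_eq, not_forall] at hxA hyB
      obtain ⟨f, hf, v, hv, hfv⟩ := hxA
      obtain ⟨f', hf', v', hv', hfv'⟩ := hyB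
      have h1 : q f ∉ p.asIdeal := fun hh => hfv (hx f ⟨hA f hf, hh⟩ v hv)
      have h2 : q f' ∉ p.asIdeal := fun hh => hfv' (hy f' ⟨hB f' hf', hh⟩ v' hv')
      have h3 : q (f * f') ∉ p.asIdeal := by
        rw [map_mul]
        intro hh
        exact (p.2.mem_or_mem hh).elim h1 h2
      apply h3
      apply hV
      intro u hu
      obtain ⟨x, hx, hux⟩ := mem_coneOf.1 (hVY p u hu)
      rw [map_mul]
      rcases hsub hx with h | h
      · rw [h f hf u hux, zero_mul]
      · rw [h f' hf' u hux, mul_zero]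
  have hYS : ∀ p, Y p ⊆ S := by
    intro p x hx
    apply mem_of_vanish hS
    intro f hf v hv
    rw [← one_smul K v, eval_smul_sum]
    refine Finset.sum_eq_zero fun e _ => ?_
    rw [hx (homogeneousComponent e f) ⟨⟨e, homogeneousComponent_isHomogeneous e f⟩, ?_⟩ v hv, mul_zero]
    have h1 : aeval z (homogeneousComponent e f) = 0 := by
      rw [hz]
      intro w hw
      exact homog_vanish (fun t => hf _ (coneOf_smul hw t)) e
    have h2 : q (homogeneousComponent e f) = 0 := by
      apply Subtype.ext
      rw [hqv, homog_aeval_smul (homogeneousComponent_isHomogeneous e f), h1, mul_zero]; rfl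
    rw [h2]; exact zero_mem _
  let Φ : (PrimeSpectrum R)ᵒᵈ → {Y : Set (PP K ι) // IsZClosed Y ∧ IsZIrreducible Y ∧ Y ⊆ zclosure S} :=
    fun p => ⟨Y p, hYcl p, hYirr p, (hYS p).trans (subset_zclosure S)⟩
  have hΦ : StrictMono Φ := by
    intro p' p hlt
    have hlt' : OrderDual.ofDual p < OrderDual.ofDual p' := hlt
    have hle : p.asIdeal ≤ p'.asIdeal := hlt'.le
    have hss : Y p' ⊂ Y p := by
      refine ⟨fun x hx f hf v hv => hx f ⟨hf.1, hle hf.2⟩ v hv, fun hsub => ?_⟩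
      apply hlt'.not_ge
      intro φ hφ
      have hsurj : ∃ f, q f = φ := by
        have h1 : ((φ : R) : F) ∈ (aeval a : MvPolynomial ι K →ₐ[K] F).range := by
          rw [← Algebra.adjoin_range_eq_range_aeval]; exact φ.2
        obtain ⟨f, hf⟩ := h1
        exact ⟨f, Subtype.ext ((hqv f).trans hf)⟩
      obtain ⟨f, rfl⟩ := hsurj
      apply hV
      intro v hv
      obtain ⟨x, hx, hvx⟩ := mem_coneOf.1 (hVY p v hv)
      let G : MvPolynomial ι K := ∑ e ∈ Finset.range (f.totalDegree + 1),
        X i0 ^ (f.totalDegree - e) * homogeneousComponent e f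
      have hG : G.IsHomogeneous f.totalDegree := by
        refine IsHomogeneous.sum _ _ _ fun e he => ?_
        have := ((isHomogeneous_X K i0).pow (f.totalDegree - e)).mul
          (homogeneousComponent_isHomogeneous e f)
        convert! this using 1
        simp at he; omega
      have h2 : q G ∈ (OrderDual.ofDual p').asIdeal := by
        have : q G = q f := by
          apply Subtype.ext
          rw [hqv, hqv]
          conv_rhs => rw [← sum_homogeneousComponent f]
          simp [G, ha0]
        rw [this]; exact hφ
      have h3 := hsub hx G ⟨⟨_, hG⟩, h2⟩ v hvx
      rw [← h3]
      conv_lhs => rw [← sum_homogeneousComponent f]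
      simp [G, hV1 p v hv]
    exact hss
  rw [ringKrullDim, ← Order.krullDim_orderDual]
  exact Order.krullDim_le_of_strictMono Φ hΦ

theorem zdim_eq_iff [IsAlgClosed K] {S : Set (PP K ι)} (hS : IsZClosed S)
    (hi : IsZIrreducible S) {d : ℕ} :
    zdim S = ((d : ℕ∞) : WithBot ℕ∞) ↔ rho (coneOf S) = d + 1 := by
  haveI : Infinite K := IsAlgClosed.instInfinite
  constructor
  · intro h
    refine le_antisymm ?_ (zdim_upper hS h.ge)
    by_contra hc
    have h2 := zdim_lower hS hi (d := d + 1) (by omega)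
    rw [h] at h2
    have : d + 1 ≤ d := by exact_mod_cast h2
    omega
  · intro h
    exact le_antisymm (zdim_eq_of_rho_aux hS h.le) (zdim_lower hS hi h.ge)

end Dim

end

section
open MvPolynomial
universe u w
set_option linter.unusedSectionVars false
set_option linter.style.haveILetI false
variable {K : Type*} [Field K] {ι : Type*} [Fintype ι]

section Linear

/-- polynomial of a linear functional -/
def linP (l : (ι → K) →ₗ[K] K) : MvPolynomial ι K := by
  classical exact ∑ i, C (l (Pi.single i 1)) * X i

theorem linP_eval (l : (ι → K) →ₗ[K] K) (v : ι → K) : eval v (linP l) = l v := by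
  classical
  unfold linP
  rw [map_sum]
  conv_rhs => rw [← LinearMap.sum_single_apply (fun _ => K) v, map_sum]
  refine Finset.sum_congr rfl fun i _ => ?_
  have : (Pi.single i (v i) : ι → K) = v i • Pi.single i 1 := by
    rw [← Pi.single_smul]; simp
  rw [this, map_smul]
  simp [mul_comm]

/-- projectivization of a subspace -/
def PT (T : Submodule K (ι → K)) : Set (PP K ι) := {x | x.submodule ≤ T}

theorem mem_PT {T : Submodule K (ι → K)} {x : PP K ι} : x ∈ PT T ↔ x.rep ∈ T := by
  constructor
  · intro h; exact h (rep_mem x)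
  · intro h v hv
    obtain ⟨t, rfl⟩ := mem_line_iff.1 hv
    exact T.smul_mem t h

theorem PT_closed [Infinite K] (T : Submodule K (ι → K)) : IsZClosed (PT T) := by
  have : PT T = zeroLocus {f | ∃ l : (ι → K) →ₗ[K] K, T ≤ LinearMap.ker l ∧ f = linP l} := by
    ext x
    constructor
    · rintro hx _ ⟨l, hl, rfl⟩ v hv
      rw [linP_eval]
      exact hl (hx hv)
    · intro hx
      rw [mem_PT]
      by_contra hc
      obtain ⟨l, hl, h2⟩ := Submodule.exists_le_ker_of_notMem hc
      exact hl (by rw [← linP_eval]; exact hx _ ⟨l, h2, rfl⟩ _ (rep_mem x))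
  rw [this]; exact zeroLocus_closed _

theorem coneOf_PT {T : Submodule K (ι → K)} (hT : T ≠ ⊥) : coneOf (PT T) = T := by
  ext v
  rw [mem_coneOf]
  constructor
  · rintro ⟨x, hx, hv⟩; exact hx hv
  · intro hv
    have key : ∀ w ∈ T, ∀ hw : w ≠ 0, Projectivization.mk K w hw ∈ PT T := by
      intro w hwT hw
      show (Projectivization.mk K w hw).submodule ≤ T
      rw [Projectivization.submodule_mk, Submodule.span_singleton_le_iff_mem]
      exact hwT
    by_cases h0 : v = 0
    · obtain ⟨w, hwT, hw⟩ := (Submodule.ne_bot_iff _).1 hT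
      exact ⟨_, key w hwT hw, by rw [h0]; exact zero_mem _⟩
    · exact ⟨_, key v hv h0, mem_mk_submodule h0⟩

theorem rho_linear [Infinite K] (T : Submodule K (ι → K)) :
    rho (T : Set (ι → K)) = Module.finrank K T := by
  classical
  let pr : ι → Module.Dual K T := fun i => (LinearMap.proj i).comp T.subtype
  have hpr : ∀ i (w : T), pr i w = (w : ι → K) i := fun i w => rfl
  have key : ∀ s : Set ι, Indep (T : Set (ι → K)) s ↔ LinearIndependent K (fun i : s => pr i) := by
    intro s
    rw [Fintype.linearIndependent_iff]
    constructor
    · intro h g hg i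
      have h1 := h (∑ i, C (g i) * X i) (by
        intro v hv
        have := LinearMap.congr_fun hg ⟨v, hv⟩
        simpa [hpr, map_sum] using this)
      have h2 := congrArg (MvPolynomial.eval (Pi.single i 1)) h1
      simpa [Pi.single_apply] using h2
    · intro h f hf
      let φ : T →ₗ[K] (s → K) := LinearMap.pi fun i => pr i
      have hs : Function.Surjective φ := by
        rw [← LinearMap.range_eq_top]
        by_contra hne
        obtain ⟨w, hw⟩ : ∃ w, w ∉ LinearMap.range φ := by
          by_contra hc
          push Not at hc
          exact hne (Submodule.eq_top_iff'.2 hc)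
        obtain ⟨l, hl, h2⟩ := Submodule.exists_le_ker_of_notMem hw
        have h3 := h (fun i => l (Pi.single i 1)) (by
          ext t
          have h4 : l (φ t) = 0 := h2 ⟨t, rfl⟩
          rw [← linP_eval, linP, map_sum] at h4
          simp only [map_mul, eval_C, eval_X] at h4
          simp only [LinearMap.sum_apply, LinearMap.smul_apply, smul_eq_mul, LinearMap.zero_apply]
          convert! h4)
        apply hl
        rw [← linP_eval, linP, map_sum]
        refine Finset.sum_eq_zero fun i _ => ?_
        have := h3 i
        have h5 : l (@Pi.single s (fun _ => K) _ (fun a b => Classical.propDecidable (a = b)) i 1) = 0 := by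
          convert! this
        rw [h5]
        simp
      apply MvPolynomial.funext
      intro t
      obtain ⟨w, rfl⟩ := hs t
      rw [map_zero]
      exact hf w w.2
  apply le_antisymm
  · obtain ⟨s, hs, hc⟩ := exists_rho (S := (T : Set (ι → K))) ⟨0, T.zero_mem⟩
    rw [← hc]
    have := ((key _).1 hs).fintype_card_le_finrank
    rw [Subspace.dual_finrank_eq] at this
    simpa using this
  · obtain ⟨κ, a, ha, hspan, hli⟩ := exists_linearIndependent' K pr
    haveI : Finite κ := Finite.of_injective a ha
    haveI := Fintype.ofFinite κ
    have htop : Submodule.span K (Set.range pr) = ⊤ := by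
      rw [← Subspace.dualCoannihilator_dualAnnihilator_eq (W := Submodule.span K (Set.range pr)), Submodule.dualAnnihilator_eq_top_iff]
      rw [Submodule.eq_bot_iff]
      intro w hw
      apply Subtype.ext
      funext i
      exact (Submodule.mem_dualCoannihilator _).1 hw (pr i) (Submodule.subset_span ⟨i, rfl⟩)
    have hcard : Fintype.card κ = Module.finrank K T := by
      rw [← Subspace.dual_finrank_eq (K := K) (V := T), ← finrank_top K (Module.Dual K T), ← htop, ← hspan,
        finrank_span_eq_card hli]
    rw [← hcard, ← Finset.card_univ, ← Finset.card_image_of_injective _ ha]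
    apply card_le_rho
    rw [key]
    have hr : ((Finset.univ.image a : Finset ι) : Set ι) = Set.range a := by simp
    rw [hr]
    exact (linearIndependent_equiv' (Equiv.ofInjective a ha) rfl).1 hli

theorem zdim_PT [IsAlgClosed K] {T : Submodule K (ι → K)} {n : ℕ}
    (hT : Module.finrank K T = n + 1) : zdim (PT T) = ((n : ℕ∞) : WithBot ℕ∞) := by
  haveI : Infinite K := IsAlgClosed.instInfinite
  have hne : T ≠ ⊥ := by rintro rfl; simp at hT
  rw [zdim_eq_iff (PT_closed T) (irr_of_girr (by rw [coneOf_PT hne]; exact GIrr_submodule T)),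
    coneOf_PT hne, rho_linear, hT]

end Linear

section Prod
variable {k : ℕ}

/-- k-fold product of a set of vectors -/
def CK (k : ℕ) (S : Set (ι → K)) : Set (Fin k × ι → K) := {A | ∀ i, (fun b => A (i, b)) ∈ S}

/-- sum of the rows -/
def sumv (A : Fin k × ι → K) : ι → K := fun b => ∑ i, A (i, b)

/-- replace a row -/
def upd (A : Fin k × ι → K) (i : Fin k) (w : ι → K) : Fin k × ι → K :=
  fun p => if p.1 = i then w p.2 else A p

/-- slice polynomial -/
def slice (f : MvPolynomial (Fin k × ι) K) (A : Fin k × ι → K) (i : Fin k) : MvPolynomial ι K :=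
  aeval (fun p => if p.1 = i then X p.2 else C (A p)) f

theorem slice_eval (f : MvPolynomial (Fin k × ι) K) (A : Fin k × ι → K) (i : Fin k) (w : ι → K) :
    eval w (slice f A i) = eval (upd A i w) f := by
  have : (eval w).comp (aeval (fun p => if p.1 = i then X p.2 else C (A p)) :
      MvPolynomial (Fin k × ι) K →ₐ[K] MvPolynomial ι K).toRingHom = eval (upd A i w) := by
    apply MvPolynomial.ringHom_ext
    · intro r; simp
    · intro p
      by_cases h : p.1 = i <;> simp [upd, h]
  rw [← this]; rfl

theorem upd_mem {S : Set (ι → K)} {A : Fin k × ι → K} (hA : A ∈ CK k S) (i : Fin k) {w : ι → K}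
    (hw : w ∈ S) : upd A i w ∈ CK k S := by
  intro j
  by_cases h : j = i
  · simpa [upd, h] using hw
  · simpa [upd, h] using hA j

theorem upd_self (A : Fin k × ι → K) (i : Fin k) : upd A i (fun b => A (i, b)) = A := by
  funext ⟨j, b⟩
  by_cases h : j = i <;> simp [upd, h]

theorem girr_CK {S : Set (ι → K)} (hS : GIrr S) : GIrr (CK k S) := by
  classical
  obtain ⟨v0, hv0⟩ := hS.1
  refine ⟨⟨fun p => v0 p.2, fun i => hv0⟩, ?_⟩
  rintro f g ⟨A, hA, hfA⟩ ⟨B, hB, hgB⟩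
  have key : ∀ s : Finset (Fin k), ∃ A' ∈ CK k S, ∃ B' ∈ CK k S, eval A' f ≠ 0 ∧ eval B' g ≠ 0 ∧
      ∀ i ∈ s, ∀ b, A' (i, b) = B' (i, b) := by
    intro s
    induction s using Finset.induction_on with
    | empty => exact ⟨A, hA, B, hB, hfA, hgB, by simp⟩
    | insert i s hi ih =>
      obtain ⟨A', hA', B', hB', h1, h2, h3⟩ := ih
      obtain ⟨w, hw, h4, h5⟩ := hS.2 (slice f A' i) (slice g B' i)
        ⟨_, hA' i, by rwa [slice_eval, upd_self]⟩ ⟨_, hB' i, by rwa [slice_eval, upd_self]⟩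
      rw [slice_eval] at h4 h5
      refine ⟨_, upd_mem hA' i hw, _, upd_mem hB' i hw, h4, h5, ?_⟩
      intro j hj b
      by_cases h : j = i
      · simp [upd, h]
      · simp only [upd, h, if_false]
        exact h3 j ((Finset.mem_insert.1 hj).resolve_left h) b
  obtain ⟨A', hA', B', hB', h1, h2, h3⟩ := key Finset.univ
  obtain rfl : A' = B' := by
    funext ⟨i, b⟩; exact h3 i (Finset.mem_univ i) b
  exact ⟨A', hA', h1, h2⟩

theorem sum_of_mem_projSpan {X : Set (PP K ι)} {S : Finset (PP K ι)} (hS : ↑S ⊆ X)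
    (hc : S.card = k) {v : ι → K} (hv : v ∈ vspan (S : Set (PP K ι))) :
    ∃ A ∈ CK k (coneOf X), sumv A = v ∧ ∃ e : Fin k ≃ S, ∀ i, (fun b => A (i, b)) ∈ (e i).1.submodule := by
  have h1 : vspan (S : Set (PP K ι)) ≤ ⨆ x ∈ S, x.submodule := by
    unfold vspan
    rw [Submodule.span_le]
    intro w hw
    obtain ⟨x, hx, hwx⟩ := mem_coneOf.1 hw
    exact (le_iSup₂_of_le x hx le_rfl : x.submodule ≤ ⨆ x ∈ S, x.submodule) hwx
  obtain ⟨μ, hμ⟩ := (Submodule.mem_iSup_finset_iff_exists_sum _ _).1 (h1 hv)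
  let e : Fin k ≃ S := (finCongr hc.symm).trans S.equivFin.symm
  refine ⟨fun p => (μ (e p.1).1 : ι → K) p.2, ?_, ?_, e, ?_⟩
  · intro i
    exact mem_coneOf.2 ⟨(e i).1, hS (e i).2, (μ (e i).1).2⟩
  · funext b
    rw [← hμ]
    unfold sumv
    rw [Finset.sum_apply, ← Finset.sum_coe_sort S, ← e.sum_comp]
  · intro i
    exact (μ (e i).1).2

theorem vanish_secant [Infinite K] {X : Set (PP K ι)} {f : MvPolynomial ι K}
    (h : ∀ A ∈ CK k (coneOf X), eval (sumv A) f = 0) :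
    ∀ v ∈ coneOf (secant k X), eval v f = 0 := by
  apply vanish_zclosure
  intro v hv
  obtain ⟨q, ⟨S, hS, hc, hq⟩, hvq⟩ := mem_coneOf.1 hv
  obtain ⟨A, hA, rfl, -⟩ := sum_of_mem_projSpan hS hc (hq hvq)
  exact h A hA

end Prod

end

section
open MvPolynomial
universe u w
set_option linter.unusedSectionVars false
set_option linter.style.haveILetI false
variable {K : Type*} [Field K] {ι : Type*} [Fintype ι]

theorem Gen.push {J J' F : Type*} [Field F] [Algebra K F] {S : Set (J → K)} {S' : Set (J' → K)}
    {z : J → F} (hz : Gen S z) (p : J' → MvPolynomial J K)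
    (h1 : ∀ v ∈ S, (fun j => eval v (p j)) ∈ S') (h2 : ∀ w ∈ S', ∃ v ∈ S, (fun j => eval v (p j)) = w) :
    Gen S' (fun j => aeval z (p j)) := by
  intro f
  have e1 : aeval (fun j => aeval z (p j)) f = aeval z (aeval p f) := by
    rw [← AlgHom.comp_apply, comp_aeval]
  have e2 : ∀ v : J → K, eval v (aeval p f) = eval (fun j => eval v (p j)) f := by
    intro v
    rw [← aeval_eq_eval, ← aeval_eq_eval]
    show (aeval v) ((aeval p) f) = aeval _ f
    rw [← AlgHom.comp_apply, comp_aeval]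
  rw [e1, hz]
  constructor
  · intro h w hw
    obtain ⟨v, hv, rfl⟩ := h2 w hw
    rw [← e2]; exact h v hv
  · intro h v hv
    rw [e2]; exact h _ (h1 v hv)

/-- set of sums -/
def SumSet (k : ℕ) (S : Set (ι → K)) : Set (ι → K) := sumv '' CK k S

theorem gen_row {F : Type*} [Field F] [Algebra K F] {k : ℕ} {S : Set (ι → K)}
    {x : Fin k × ι → F} (hx : Gen (CK k S) x) (i : Fin k) : Gen S (fun b => x (i, b)) := by
  have := hx.push (S' := S) (fun b => X (i, b)) (fun v hv => by simpa using hv i)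
    (fun w hw => ⟨fun p => w p.2, fun _ => hw, by simp⟩)
  simpa using this

theorem gen_sum {F : Type*} [Field F] [Algebra K F] {k : ℕ} {S : Set (ι → K)}
    {x : Fin k × ι → F} (hx : Gen (CK k S) x) : Gen (SumSet k S) (fun b => ∑ i, x (i, b)) := by
  have := hx.push (S' := SumSet k S) (fun b => ∑ i, X (i, b))
    (fun v hv => ⟨v, hv, by funext b; simp [sumv]⟩)
    (by rintro _ ⟨A, hA, rfl⟩; exact ⟨A, hA, by funext b; simp [sumv]⟩)
  simpa using this

theorem gen_init {F : Type*} [Field F] [Algebra K F] {k : ℕ} {S : Set (ι → K)} (hS : S.Nonempty)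
    {x : Fin (k + 1) × ι → F} (hx : Gen (CK (k + 1) S) x) :
    Gen (CK k S) (fun p : Fin k × ι => x (p.1.castSucc, p.2)) := by
  obtain ⟨v0, hv0⟩ := hS
  have := hx.push (S' := CK k S) (fun p => X (p.1.castSucc, p.2))
    (fun v hv i => by simpa using hv i.castSucc)
    (fun A hA => ⟨fun p => Fin.lastCases (motive := fun _ => K) (v0 p.2) (fun i => A (i, p.2)) p.1, by
      intro i
      refine Fin.lastCases ?_ (fun i => ?_) i
      · simpa using hv0
      · simpa using hA i, by simp⟩)
  simpa using this

theorem isAlgebraic_adjoin_mono {F : Type*} [Field F] [Algebra K F] {s t : Set F} (h : s ⊆ t) {a : F}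
    (ha : IsAlgebraic (Algebra.adjoin K s) a) : IsAlgebraic (Algebra.adjoin K t) a := by
  have hle := Algebra.adjoin_mono (R := K) h
  obtain ⟨p, hp, h2⟩ := ha
  refine ⟨p.map (Subalgebra.inclusion hle).toRingHom, ?_, ?_⟩
  · exact (Polynomial.map_ne_zero_iff (Subalgebra.inclusion_injective hle)).2 hp
  · rw [← h2, Polynomial.aeval_def, Polynomial.eval₂_map, Polynomial.aeval_def]
    rfl

theorem exists_small {F : Type*} [Field F] [Algebra K F] {S : Set (ι → K)} (hS : S.Nonempty)
    {z : ι → F} (hz : Gen S z) : ∃ B : Finset F, B.card ≤ rho S ∧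
      ∀ j, IsAlgebraic (Algebra.adjoin K (B : Set F)) (z j) := by
  classical
  obtain ⟨s, hs, hc⟩ := exists_rho hS
  refine ⟨s.image z, hc ▸ Finset.card_image_le, fun j => ?_⟩
  rw [Finset.coe_image]
  exact rho_alg hz hs hc j

theorem alg_sum {R F : Type*} [Field F] [CommRing R] [IsDomain R] [Algebra R F]
    {α : Type*} (s : Finset α) (f : α → F) (h : ∀ a ∈ s, IsAlgebraic R (f a)) :
    IsAlgebraic R (∑ a ∈ s, f a) :=
  sum_mem (S := Subalgebra.algebraicClosure R F) h

theorem rho_le_card {F : Type*} [Field F] [Algebra K F] {S : Set (ι → K)} (hS : S.Nonempty)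
    {z : ι → F} (hz : Gen S z) (B : Finset F)
    (hB : ∀ j, IsAlgebraic (Algebra.adjoin K (B : Set F)) (z j)) : rho S ≤ B.card := by
  obtain ⟨s, hs, hc⟩ := exists_rho hS
  rw [← hc]
  have := rank_le (L := s) ((hz.indep_iff _).2 hs) B (fun l => hB l)
  simpa using this

theorem SumSet_nonempty {k : ℕ} {S : Set (ι → K)} (hS : S.Nonempty) : (SumSet k S).Nonempty := by
  obtain ⟨v, hv⟩ := hS
  exact ⟨_, fun p => v p.2, fun _ => hv, rfl⟩

theorem rho_step {k : ℕ} {S : Set (ι → K)} (hS : GIrr S) :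
    rho (SumSet (k + 1) S) ≤ rho (SumSet k S) + rho S := by
  classical
  obtain ⟨F, _, _, x, hx, -⟩ := exists_gen (girr_CK (k := k + 1) hS)
  have h1 := gen_sum (gen_init hS.1 hx)
  have h2 := gen_row hx (Fin.last k)
  obtain ⟨B1, hc1, hB1⟩ := exists_small (SumSet_nonempty hS.1) h1
  obtain ⟨B2, hc2, hB2⟩ := exists_small hS.1 h2
  refine (rho_le_card (SumSet_nonempty hS.1) (gen_sum hx) (B1 ∪ B2) ?_).trans
    ((Finset.card_union_le _ _).trans (by omega))
  intro j
  rw [Fin.sum_univ_castSucc]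
  exact (isAlgebraic_adjoin_mono (by simp) (hB1 j)).add (isAlgebraic_adjoin_mono (by simp) (hB2 j))

theorem rho_down {k d : ℕ} {S : Set (ι → K)} (hS : GIrr S) :
    rho (SumSet (k + d) S) ≤ rho (SumSet k S) + d * rho S := by
  induction d with
  | zero => simp
  | succ d ih =>
    have := rho_step (k := k + d) hS
    rw [← add_assoc]
    nlinarith

theorem nondef {k m : ℕ} (hkm : k ≤ m) {S : Set (ι → K)} (hS : GIrr S) (h : m * rho S ≤ rho (SumSet m S)) :
    k * rho S ≤ rho (SumSet k S) := by
  obtain ⟨d, rfl⟩ := Nat.exists_eq_add_of_le hkm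
  have := rho_down (k := k) (d := d) hS
  nlinarith

theorem setup {K : Type u} [Field K] {ι : Type w} [Fintype ι] {k : ℕ} {S : Set (ι → K)} (hS : GIrr S)
    (h : k * rho S ≤ rho (SumSet k S)) :
    ∃ (F : Type (max u w)) (_ : Field F) (_ : Algebra K F) (x : Fin k × ι → F), Gen (CK k S) x ∧
      (∀ φ : F, ∃ f g : MvPolynomial (Fin k × ι) K, aeval x g ≠ 0 ∧ φ * aeval x g = aeval x f) ∧
      ∃ J : Finset ι, J.card = k * rho S ∧ AlgebraicIndependent K (fun j : J => ∑ i, x (i, j)) ∧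
      ∀ φ : F, IsAlgebraic (Algebra.adjoin K (Set.range (fun j : J => ∑ i, x (i, (j : ι))))) φ := by
  classical
  obtain ⟨F, _, _, x, hx, hfrac⟩ := exists_gen (girr_CK (k := k) hS)
  refine ⟨F, _, _, x, hx, hfrac, ?_⟩
  obtain ⟨s, hs, hc⟩ := exists_rho (SumSet_nonempty (k := k) hS.1)
  obtain ⟨J, hJs, hJ⟩ := Finset.exists_subset_card_eq (hc.symm ▸ h)
  have hind : AlgebraicIndepOn K (fun b => ∑ i, x (i, b)) (J : Set ι) :=
    ((gen_sum hx).indep_iff _).2 (hs.mono_right (by exact_mod_cast hJs))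
  have hi2 : AlgebraicIndependent K (fun j : J => ∑ i, x (i, (j : ι))) := hind
  refine ⟨J, hJ, hi2, ?_⟩
  -- rows
  have hrow : ∀ i : Fin k, ∃ B : Finset F, B.card ≤ rho S ∧
      ∀ j, IsAlgebraic (Algebra.adjoin K (B : Set F)) (x (i, j)) :=
    fun i => exists_small hS.1 (gen_row hx i)
  choose B hBc hB using hrow
  have hxalg : ∀ p, IsAlgebraic (Algebra.adjoin K ((Finset.univ.biUnion B : Finset F) : Set F)) (x p) := by
    intro p
    refine isAlgebraic_adjoin_mono ?_ (hB p.1 p.2)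
    intro a ha
    simp only [Finset.coe_biUnion, Set.mem_iUnion]
    exact ⟨p.1, by simp, ha⟩
  have hcard : (Finset.univ.biUnion B).card ≤ k * rho S := by
    refine (Finset.card_biUnion_le).trans ?_
    refine (Finset.sum_le_card_nsmul _ _ _ fun i _ => hBc i).trans ?_
    simp
  have hxq : ∀ p, IsAlgebraic (Algebra.adjoin K (Set.range (fun j : J => ∑ i, x (i, (j : ι))))) (x p) := by
    intro p
    by_contra hc
    have htr : Transcendental (Algebra.adjoin K (Set.range (fun j : J => ∑ i, x (i, (j : ι))))) (x p) := hc
    have h3 := (hi2.option_iff_transcendental (x p)).2 htr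
    have h4 := rank_le h3 (Finset.univ.biUnion B) (by
      intro l
      cases l with
      | none => exact hxalg p
      | some j => exact alg_sum _ _ fun i _ => hxalg _)
    rw [Fintype.card_option, Fintype.card_coe, hJ] at h4
    omega
  intro φ
  obtain ⟨f, g, hg, he⟩ := hfrac φ
  have : φ = aeval x f * (aeval x g)⁻¹ := by field_simp; exact he
  rw [this]
  exact (alg_aeval hxq f).mul (alg_aeval hxq g).inv

theorem coneOf_irr_n [Infinite K] {X : Set (PP K ι)} (hX : IsIntegralVariety X)
    (hnd : Nondegenerate X) (hι : 1 < Fintype.card ι) : 2 ≤ rho (coneOf X) := by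
  classical
  obtain ⟨p, hp⟩ := hX.2.1
  have hcone : coneOf ({p} : Set (PP K ι)) = p.submodule := by
    ext v; simp [mem_coneOf]
  have hpt : PT p.submodule = {p} := by
    ext y
    rw [mem_PT]
    constructor
    · intro h
      have h1 := eq_mk_of_mem y.rep_nonzero h
      rw [Projectivization.mk_rep] at h1
      exact h1.symm
    · rintro rfl; exact rep_mem _
  have hpc : IsZClosed ({p} : Set (PP K ι)) := hpt ▸ PT_closed _
  have hpi : IsZIrreducible ({p} : Set (PP K ι)) :=
    irr_of_girr (by rw [hcone]; exact GIrr_submodule _)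
  by_cases h : X = {p}
  · exfalso
    have h1 : vspan X = p.submodule := by
      unfold vspan; rw [h, hcone, Submodule.span_eq]
    have h2 : Module.finrank K p.submodule = 1 := Projectivization.finrank_submodule p
    rw [← h1, hnd, finrank_top, Module.finrank_fintype_fun_eq_card] at h2
    omega
  · have := rho_strict hpc hpi hX.2 ⟨by simpa using hp, fun hc => h (Set.Subset.antisymm hc (by simpa using hp))⟩
    have h3 := rho_pos (S := ({p} : Set (PP K ι))) ⟨p, rfl⟩
    omega

theorem rho_sum_of_zdim [Infinite K] {m : ℕ} {X : Set (PP K ι)} {d : ℕ} (hXne : X.Nonempty)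
    (h : zdim (secant m X) = ((d : ℕ∞) : WithBot ℕ∞)) : d + 1 ≤ rho (SumSet m (coneOf X)) := by
  have h1 : d + 1 ≤ rho (coneOf (secant m X)) := zdim_upper (zclosure_closed _) h.ge
  have hne : (coneOf (secant m X)).Nonempty := by
    by_contra hc
    rw [Set.not_nonempty_iff_eq_empty] at hc
    have h3 : secant m X = ∅ := by
      by_contra h4
      obtain ⟨q, hq⟩ := Set.nonempty_iff_ne_empty.2 h4
      have : q.rep ∈ coneOf (secant m X) := mem_coneOf.2 ⟨q, hq, rep_mem q⟩
      rw [hc] at this; exact this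
    have h5 : zdim (secant m X) = ⊥ := by
      unfold zdim
      rw [Order.krullDim_eq_bot_iff]
      constructor
      rintro ⟨Y, -, hY, hs⟩
      unfold secant at h3 hs
      rw [zclosure_eq (zclosure_closed _), h3] at hs
      obtain ⟨y, hy⟩ := hY.1
      exact hs hy
    rw [h5] at h
    exact absurd h (by simp)
  obtain ⟨s, hs, hc⟩ := exists_rho hne
  rw [← hc] at h1
  refine h1.trans (card_le_rho ?_)
  intro f hf
  apply hs
  intro v hv
  have := vanish_secant (k := m) (X := X) (f := rename Subtype.val f) (by
    intro A hA
    rw [eval_rename]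
    exact hf _ ⟨A, hA, rfl⟩) v hv
  rw [eval_rename] at this
  exact this

end

section
open MvPolynomial
universe u w
set_option linter.unusedSectionVars false
set_option linter.style.haveILetI false
variable {K : Type*} [Field K] {ι : Type*} [Fintype ι]

section Deriv
variable {F : Type*} [Field F] [Algebra K F]

theorem nil_aux {R : Type*} [CommRing R] (I : Ideal R) (h : ∀ r ∈ I, ∀ s ∈ I, r * s = 0) :
    IsNilpotent I := by
  refine ⟨2, ?_⟩
  rw [pow_two, Ideal.zero_eq_bot, eq_bot_iff, Ideal.mul_le]
  exact h

theorem ext_der {A : Type*} [CommRing A] [Algebra K A] [Algebra A F] [IsScalarTower K A F]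
    [Algebra.FormallySmooth A F] (g : A →ₐ[K] TrivSqZeroExt F F)
    (hg : ∀ a, (g a).fst = algebraMap A F a) :
    ∃ D : Derivation K F F, ∀ a, D (algebraMap A F a) = (g a).snd := by
  letI : Algebra A (TrivSqZeroExt F F) := g.toRingHom.toAlgebra
  have hmap : ∀ a, algebraMap A (TrivSqZeroExt F F) a = g a := fun a => rfl
  let p : TrivSqZeroExt F F →ₐ[A] F :=
    { (TrivSqZeroExt.fstHom K F F).toRingHom with commutes' := fun a => hg a }
  have hp : ∀ z, p z = z.fst := fun z => rfl
  have hps : Function.Surjective p := fun z => ⟨TrivSqZeroExt.inl z, rfl⟩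
  have hnil : IsNilpotent (RingHom.ker (p : TrivSqZeroExt F F →+* F)) := by
    refine nil_aux _ ?_
    intro r hr s hs
    have hr' : r.fst = 0 := hr
    have hs' : s.fst = 0 := hs
    show r * s = 0
    ext
    · simp [hr']
    · simp [hr', hs']
  let L : F →ₐ[A] TrivSqZeroExt F F := Algebra.FormallySmooth.liftOfSurjective (AlgHom.id A F) p hps hnil
  have hL : ∀ z, (L z).fst = z := fun z =>
    Algebra.FormallySmooth.liftOfSurjective_apply (AlgHom.id A F) p hps hnil z
  have hLK : ∀ c : K, L (algebraMap K F c) = algebraMap K (TrivSqZeroExt F F) c := by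
    intro c
    rw [IsScalarTower.algebraMap_apply K A F, AlgHom.commutes, hmap, AlgHom.commutes]
  refine ⟨Derivation.mk'
    { toFun := fun z => (L z).snd
      map_add' := fun a b => by simp
      map_smul' := fun c z => by
        rw [Algebra.smul_def, map_mul, hLK, TrivSqZeroExt.snd_mul, TrivSqZeroExt.algebraMap_eq_inl']
        simp [Algebra.smul_def] } ?_, ?_⟩
  · intro a b
    simp [hL, mul_comm]
  · intro a
    show (L (algebraMap A F a)).snd = _
    rw [AlgHom.commutes]; rfl

theorem smooth_char0 {E : Type*} [Field E] [Algebra E F] [CharZero E] : Algebra.FormallySmooth E F := by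
  obtain ⟨ι', v, hv⟩ := exists_isTranscendenceBasis' E F
  haveI := hv.isAlgebraic_field
  haveI : CharZero (IntermediateField.adjoin E (Set.range v)) :=
    charZero_of_injective_algebraMap (algebraMap E _).injective
  exact .of_algebraicIndependent_of_isSeparable hv.1

/-- extension of derivations in characteristic zero -/
theorem ext_field (E : IntermediateField K F) [CharZero K] (d : Derivation K E F) :
    ∃ D : Derivation K F F, ∀ a : E, D a = d a := by
  haveI : CharZero E := charZero_of_injective_algebraMap (algebraMap K _).injective
  haveI : Algebra.FormallySmooth E F := smooth_char0
  let g : E →ₐ[K] TrivSqZeroExt F F :=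
    { toFun := fun a => TrivSqZeroExt.inl (a : F) + TrivSqZeroExt.inr (d a)
      map_one' := by simp
      map_mul' := by
        intro a b
        ext
        · simp
        · simp only [TrivSqZeroExt.snd_add, TrivSqZeroExt.snd_inl, TrivSqZeroExt.snd_inr, TrivSqZeroExt.snd_mul,
            Derivation.leibniz, TrivSqZeroExt.fst_add, TrivSqZeroExt.fst_inl, TrivSqZeroExt.fst_inr, add_zero, zero_add]
          simp [Algebra.smul_def, mul_comm]
      map_zero' := by simp
      map_add' := by
        intro a b
        ext <;> simp
      commutes' := by
        intro r
        ext
        · simp [TrivSqZeroExt.algebraMap_eq_inl']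
        · simp [TrivSqZeroExt.algebraMap_eq_inl'] }
  obtain ⟨D, hD⟩ := ext_der g (fun a => by simp [g])
  exact ⟨D, fun a => by simpa [g] using hD a⟩

variable {J : Type*} {y : J → F}

theorem etale_adjoin [CharZero K] (halg : ∀ φ : F, IsAlgebraic (Algebra.adjoin K (Set.range y)) φ) :
    Algebra.FormallyEtale (Algebra.adjoin K (Set.range y)) F := by
  open scoped IntermediateField.algebraAdjoinAdjoin in
  letI E := IntermediateField.adjoin K (Set.range y)
  haveI : CharZero E := charZero_of_injective_algebraMap (algebraMap K _).injective
  haveI : Algebra.FormallyEtale (Algebra.adjoin K (Set.range y)) E :=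
    .of_isLocalization (nonZeroDivisors _)
  haveI : Algebra.IsAlgebraic E F := by
    constructor
    intro φ
    exact (halg φ).extendScalars (FaithfulSMul.algebraMap_injective (Algebra.adjoin K (Set.range y)) E)
  haveI : Algebra.FormallyEtale E F := Algebra.FormallyEtale.of_isSeparable _ _
  exact .comp _ E _

theorem der_exists [CharZero K] [DecidableEq J] (hy : AlgebraicIndependent K y)
    (halg : ∀ φ : F, IsAlgebraic (Algebra.adjoin K (Set.range y)) φ) (l : J) :
    ∃ D : Derivation K F F, ∀ j, D (y j) = if j = l then 1 else 0 := by
  haveI := etale_adjoin halg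
  let g0 : MvPolynomial J K →ₐ[K] TrivSqZeroExt F F :=
    aeval (fun j => TrivSqZeroExt.inl (y j) + TrivSqZeroExt.inr (if j = l then 1 else 0))
  have hg0 : ∀ f, (g0 f).fst = aeval y f := by
    intro f
    have : (TrivSqZeroExt.fstHom K F F).comp g0 = aeval y := by
      apply MvPolynomial.algHom_ext
      intro j; by_cases hj : j = l <;> simp [g0, hj]
    rw [← this]; rfl
  obtain ⟨D, hD⟩ := ext_der (g0.comp hy.aevalEquiv.symm.toAlgHom) (by
    intro a
    obtain ⟨f, rfl⟩ := hy.aevalEquiv.surjective a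
    simp [hg0])
  refine ⟨D, fun j => ?_⟩
  have := hD (hy.aevalEquiv (X j))
  by_cases hj : j = l
  · simpa [g0, hj] using this
  · simpa [g0, hj] using this

theorem der_unique [CharZero K] 
    (halg : ∀ φ : F, IsAlgebraic (Algebra.adjoin K (Set.range y)) φ) (D : Derivation K F F)
    (h : ∀ j, D (y j) = 0) : D = 0 := by
  haveI := etale_adjoin halg
  have h1 : ∀ a ∈ Algebra.adjoin K (Set.range y), D a = 0 := by
    intro a ha
    induction ha using Algebra.adjoin_induction with
    | mem a ha => obtain ⟨j, rfl⟩ := ha; exact h j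
    | algebraMap r => simp
    | add a b _ _ ha hb => simp [ha, hb]
    | mul a b _ _ ha hb => simp [ha, hb]
  let D' : Derivation (Algebra.adjoin K (Set.range y)) F F :=
    { toFun := D
      map_add' := map_add D
      map_smul' := by
        intro a b
        simp only [Algebra.smul_def, Derivation.leibniz, RingHom.id_apply]
        rw [show D (algebraMap (Algebra.adjoin K (Set.range y)) F a) = 0 from h1 a a.2]
        simp
      map_one_eq_zero' := by simp
      leibniz' := fun a b => D.leibniz a b }
  haveI : Subsingleton (Ω[F⁄(Algebra.adjoin K (Set.range y))]) := inferInstance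
  have h2 : D' = 0 := by
    have := Derivation.liftKaehlerDifferential_comp D'
    rw [← this]
    ext z
    have h3 : (KaehlerDifferential.D (Algebra.adjoin K (Set.range y)) F) z = 0 := Subsingleton.elim _ _
    simp [h3]
  ext z
  exact Derivation.congr_fun h2 z

end Deriv

end

section
open MvPolynomial
universe u w
set_option linter.unusedSectionVars false
set_option linter.style.haveILetI false
variable {K : Type*} [Field K] {ι : Type*} [Fintype ι]

section Loc
variable {F : Type*} [Field F] [Algebra K F] {I : Type*}

/-- specialization -/
def Sp (z : I → F) (v : I → K) : Prop := ∀ f : MvPolynomial I K, aeval z f = 0 → eval v f = 0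

theorem Sp.ne {z : I → F} {v : I → K} (hv : Sp z v) {f : MvPolynomial I K} (h : eval v f ≠ 0) :
    aeval z f ≠ 0 := fun h0 => h (hv f h0)

theorem Sp.eq {z : I → F} {v : I → K} (hv : Sp z v) {f g : MvPolynomial I K}
    (h : aeval z f = aeval z g) : eval v f = eval v g := by
  have := hv (f - g) (by rw [map_sub, h, sub_self])
  rwa [map_sub, sub_eq_zero] at this

/-- local ring at a point -/
def loc (z : I → F) (v : I → K) : Subalgebra K F where
  carrier := {φ | ∃ f g : MvPolynomial I K, eval v g ≠ 0 ∧ φ * aeval z g = aeval z f}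
  mul_mem' := by
    rintro a b ⟨f, g, h, e⟩ ⟨f', g', h', e'⟩
    refine ⟨f * f', g * g', by rw [map_mul]; exact mul_ne_zero h h', ?_⟩
    rw [map_mul, map_mul, ← e, ← e']; ring
  add_mem' := by
    rintro a b ⟨f, g, h, e⟩ ⟨f', g', h', e'⟩
    refine ⟨f * g' + f' * g, g * g', by rw [map_mul]; exact mul_ne_zero h h', ?_⟩
    rw [map_mul, map_add, map_mul, map_mul, ← e, ← e']; ring
  algebraMap_mem' := fun r => ⟨C r, 1, by simp, by simp⟩

theorem aeval_mem_loc (z : I → F) (v : I → K) (f : MvPolynomial I K) : aeval z f ∈ loc z v :=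
  ⟨f, 1, by simp, by simp⟩

theorem var_mem_loc (z : I → F) (v : I → K) (i : I) : z i ∈ loc z v := by
  simpa using aeval_mem_loc z v (X i)

theorem Sp.wd {z : I → F} {v : I → K} (hv : Sp z v) {φ : F} {f g f' g' : MvPolynomial I K}
    (h : eval v g ≠ 0) (e : φ * aeval z g = aeval z f)
    (h' : eval v g' ≠ 0) (e' : φ * aeval z g' = aeval z f') :
    eval v f / eval v g = eval v f' / eval v g' := by
  rw [div_eq_div_iff h h', ← map_mul, ← map_mul]
  apply hv.eq
  rw [map_mul, map_mul, ← e, ← e']; ring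

/-- value of an element of the local ring (total) -/
def val (z : I → F) (v : I → K) (φ : F) : K := by
  classical
  exact if h : φ ∈ loc z v then
    eval v (Classical.choose h) / eval v (Classical.choose (Classical.choose_spec h)) else 0

theorem Sp.val_eq {z : I → F} {v : I → K} (hv : Sp z v) {φ : F} {f g : MvPolynomial I K}
    (h : eval v g ≠ 0) (e : φ * aeval z g = aeval z f) : val z v φ = eval v f / eval v g := by
  have hm : φ ∈ loc z v := ⟨f, g, h, e⟩
  unfold val
  rw [dif_pos hm]
  have hs := Classical.choose_spec (Classical.choose_spec hm)
  exact hv.wd hs.1 hs.2 h e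

theorem Sp.val_add {z : I → F} {v : I → K} (hv : Sp z v) {a b : F} (ha : a ∈ loc z v)
    (hb : b ∈ loc z v) : val z v (a + b) = val z v a + val z v b := by
  obtain ⟨f, g, h, e⟩ := ha
  obtain ⟨f', g', h', e'⟩ := hb
  rw [hv.val_eq h e, hv.val_eq h' e', hv.val_eq (f := f * g' + f' * g) (g := g * g')]
  · simp only [map_mul, map_add]; field_simp
  · rw [map_mul]; exact mul_ne_zero h h'
  · rw [map_mul, map_add, map_mul, map_mul, ← e, ← e']; ring

theorem Sp.val_mul {z : I → F} {v : I → K} (hv : Sp z v) {a b : F} (ha : a ∈ loc z v)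
    (hb : b ∈ loc z v) : val z v (a * b) = val z v a * val z v b := by
  obtain ⟨f, g, h, e⟩ := ha
  obtain ⟨f', g', h', e'⟩ := hb
  rw [hv.val_eq h e, hv.val_eq h' e', hv.val_eq (f := f * f') (g := g * g')]
  · simp only [map_mul]; field_simp
  · rw [map_mul]; exact mul_ne_zero h h'
  · rw [map_mul, map_mul, ← e, ← e']; ring

theorem Sp.val_aeval {z : I → F} {v : I → K} (hv : Sp z v) (f : MvPolynomial I K) :
    val z v (aeval z f) = eval v f := by
  rw [hv.val_eq (f := f) (g := 1)] <;> simp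

theorem Sp.val_algebraMap {z : I → F} {v : I → K} (hv : Sp z v) (c : K) :
    val z v (algebraMap K F c) = c := by
  have := hv.val_aeval (C c)
  simpa using this

theorem Sp.val_var {z : I → F} {v : I → K} (hv : Sp z v) (i : I) : val z v (z i) = v i := by
  have := hv.val_aeval (X i)
  simpa using this

/-- evaluation homomorphism -/
def ev {z : I → F} {v : I → K} (hv : Sp z v) : loc z v →ₐ[K] K where
  toFun φ := val z v φ
  map_one' := by simpa using hv.val_algebraMap 1
  map_zero' := by simpa using hv.val_algebraMap 0
  map_add' a b := hv.val_add a.2 b.2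
  map_mul' a b := hv.val_mul a.2 b.2
  commutes' c := hv.val_algebraMap c

theorem ev_apply {z : I → F} {v : I → K} (hv : Sp z v) (φ : loc z v) : ev hv φ = val z v φ := rfl

theorem Sp.val_sum {z : I → F} {v : I → K} (hv : Sp z v) {α : Type*} (s : Finset α) (f : α → F)
    (h : ∀ a ∈ s, f a ∈ loc z v) : val z v (∑ a ∈ s, f a) = ∑ a ∈ s, val z v (f a) := by
  classical
  induction s using Finset.induction_on with
  | empty => simpa using hv.val_algebraMap 0
  | insert a s ha ih =>
    rw [Finset.sum_insert ha, Finset.sum_insert ha, hv.val_add (h a (by simp))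
      (sum_mem fun b hb => h b (by simp [hb])), ih fun b hb => h b (by simp [hb])]

theorem Sp.val_neg {z : I → F} {v : I → K} (hv : Sp z v) {a : F} (ha : a ∈ loc z v) :
    val z v (-a) = - val z v a := map_neg (ev hv) ⟨a, ha⟩

theorem Sp.val_ne {z : I → F} {v : I → K} (hv : Sp z v) {a : F} (h0 : a ≠ 0) (ha : a ∈ loc z v)
    (hi : a⁻¹ ∈ loc z v) : val z v a ≠ 0 := by
  intro h
  have h1 := hv.val_mul ha hi
  rw [h, zero_mul, mul_inv_cancel₀ h0] at h1
  have h2 := hv.val_algebraMap (F := F) (1 : K)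
  rw [map_one] at h2
  exact one_ne_zero (h2.symm.trans h1)

theorem Sp.val_map {z : I → F} {v : I → K} (hv : Sp z v) {L : Type*} (p : MvPolynomial L K)
    (w : L → F) (hw : ∀ l, w l ∈ loc z v) :
    aeval w p ∈ loc z v ∧ val z v (aeval w p) = eval (fun l => val z v (w l)) p := by
  have e : aeval w p = (loc z v).val (aeval (fun l => (⟨w l, hw l⟩ : loc z v)) p) := by
    rw [← AlgHom.comp_apply, comp_aeval]; rfl
  rw [e]
  refine ⟨Subtype.property _, ?_⟩
  show ev hv _ = _
  rw [← AlgHom.comp_apply, comp_aeval, ← aeval_eq_eval]; rfl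

end Loc

section Chain

theorem chain {B M : Type*} [CommRing B] [Algebra K B] [AddCommGroup M] [Module B M] [Module K M]
    [IsScalarTower K B M] {σ : Type*} [Fintype σ] (D : Derivation K B M) (z : σ → B)
    (p : MvPolynomial σ K) : D (aeval z p) = ∑ s, aeval z (pderiv s p) • D (z s) := by
  classical
  induction p using MvPolynomial.induction_on with
  | C a => simp
  | add p q hp hq => simp [hp, hq, add_smul, Finset.sum_add_distrib]
  | mul_X p i hp =>
    simp only [map_mul, aeval_X, Derivation.leibniz, hp, pderiv_X, smul_eq_mul, map_add]
    rw [Finset.smul_sum]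
    simp only [add_smul, Finset.sum_add_distrib, smul_smul]
    congr 1
    rw [Finset.sum_eq_single i]
    · simp
    · intro b _ hb; simp [Ne.symm hb]
    · simp

theorem pderiv_deg {σ : Type*} {p : MvPolynomial σ K} {i : σ} (h : pderiv i p ≠ 0) :
    (pderiv i p).totalDegree < p.totalDegree := by
  classical
  obtain ⟨m, hm, hd⟩ : ∃ m ∈ (pderiv i p).support, (pderiv i p).totalDegree = m.sum fun _ e => e := by
    have := Finset.exists_mem_eq_sup (pderiv i p).support (by simpa using h) (fun m => m.sum fun _ e => e)
    simpa [totalDegree] using this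
  rw [hd]
  have h1 : m + Finsupp.single i 1 ∈ p.support := by
    rw [mem_support_iff] at hm ⊢
    intro h0
    rw [coeff_pderiv, h0] at hm
    simp at hm
  have h2 := le_totalDegree h1
  rw [Finsupp.sum_add_index' (by simp) (by simp)] at h2
  simp at h2
  omega

theorem pderiv_zero [CharZero K] {σ : Type*} {p : MvPolynomial σ K} {i : σ} (h : pderiv i p = 0) :
    i ∉ p.vars := by
  classical
  intro hi
  obtain ⟨m, hm, hmi⟩ := (mem_vars_iff_mem_support i).1 hi
  rw [Finsupp.mem_support_iff] at hmi
  have h1 := coeff_pderiv (i := i) p (m - Finsupp.single i 1)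
  rw [h, coeff_zero] at h1
  have h2 : m - Finsupp.single i 1 + Finsupp.single i 1 = m := by
    apply tsub_add_cancel_of_le
    rw [Finsupp.single_le_iff]; omega
  rw [h2] at h1
  rcases mul_eq_zero.1 h1.symm with h3 | h3
  · exact (mem_support_iff.1 hm) h3
  · exact Nat.cast_add_one_ne_zero _ h3

theorem sep_rel [CharZero K] {F : Type*} [Field F] [Algebra K F] {J : Type*} {y : J → F}
    (hy : AlgebraicIndependent K y) {φ : F} (hφ : IsAlgebraic (Algebra.adjoin K (Set.range y)) φ) :
    ∃ p : MvPolynomial (Option J) K, aeval (fun o : Option J => o.elim φ y) p = 0 ∧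
      aeval (fun o : Option J => o.elim φ y) (pderiv none p) ≠ 0 := by
  classical
  have hnot : ¬ AlgebraicIndependent K (fun o : Option J => o.elim φ y) := by
    intro h
    exact (hy.option_iff_transcendental φ).1 h hφ
  rw [algebraicIndependent_iff] at hnot
  push Not at hnot
  have hex : ∃ n, ∃ p : MvPolynomial (Option J) K, p.totalDegree = n ∧
      aeval (fun o : Option J => o.elim φ y) p = 0 ∧ p ≠ 0 := by
    obtain ⟨p, h1, h2⟩ := hnot
    exact ⟨_, p, rfl, h1, h2⟩
  obtain ⟨p, hp, h1, h2⟩ := Nat.find_spec hex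
  refine ⟨p, h1, fun h3 => ?_⟩
  by_cases h4 : pderiv none p = 0
  · have hv := pderiv_zero h4
    obtain ⟨p', rfl⟩ := exists_rename_eq_of_vars_subset_range p (some : J → Option J)
      (Option.some_injective J) (by
        intro o ho
        cases o with
        | none => exact absurd ho hv
        | some j => exact ⟨j, rfl⟩)
    rw [aeval_rename] at h1
    have : p' = 0 := (algebraicIndependent_iff.1 hy) p' h1
    rw [this, map_zero] at h2
    exact h2 rfl
  · exact Nat.find_min hex (hp ▸ pderiv_deg h4) ⟨_, rfl, h3, h4⟩

end Chain

end

section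
open MvPolynomial
universe u w
set_option linter.unusedSectionVars false
set_option linter.style.haveILetI false
variable {K : Type*} [Field K] {ι : Type*} [Fintype ι]

theorem der_dual {F : Type*} [Field F] [Algebra K F] [CharZero K] {J : Type*} {y : J → F}
    (hy : AlgebraicIndependent K y) [DecidableEq J] (l : J) :
    ∃ D : Derivation K F F, ∀ j, D (y j) = if j = l then 1 else 0 := by
  haveI : Algebra.FormallySmooth (Algebra.adjoin K (Set.range y)) F := by
    open scoped IntermediateField.algebraAdjoinAdjoin in
    letI E := IntermediateField.adjoin K (Set.range y)
    haveI : CharZero E := charZero_of_injective_algebraMap (algebraMap K _).injective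
    haveI : Algebra.FormallySmooth (Algebra.adjoin K (Set.range y)) E :=
      .of_isLocalization (nonZeroDivisors _)
    haveI : Algebra.FormallySmooth E F := smooth_char0
    exact .comp _ E _
  let g0 : MvPolynomial J K →ₐ[K] TrivSqZeroExt F F :=
    aeval (fun j => TrivSqZeroExt.inl (y j) + TrivSqZeroExt.inr (if j = l then 1 else 0))
  have hg0 : ∀ f, (g0 f).fst = aeval y f := by
    intro f
    have : (TrivSqZeroExt.fstHom K F F).comp g0 = aeval y := by
      apply MvPolynomial.algHom_ext
      intro j; by_cases hj : j = l <;> simp [g0, hj]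
    rw [← this]; rfl
  obtain ⟨D, hD⟩ := ext_der (g0.comp hy.aevalEquiv.symm.toAlgHom) (by
    intro a
    obtain ⟨f, rfl⟩ := hy.aevalEquiv.surjective a
    simp [hg0])
  refine ⟨D, fun j => ?_⟩
  have := hD (hy.aevalEquiv (X j))
  by_cases hj : j = l
  · simpa [g0, hj] using this
  · simpa [g0, hj] using this

section Tangent

/-- Zariski tangent space of the cone -/
def Tan (S : Set (ι → K)) (a : ι → K) : Submodule K (ι → K) where
  carrier := {w | ∀ f : MvPolynomial ι K, (∀ v ∈ S, eval v f = 0) → ∑ i, w i * eval a (pderiv i f) = 0}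
  add_mem' := by
    intro w w' h h' f hf
    simp only [Pi.add_apply, add_mul, Finset.sum_add_distrib]
    rw [h f hf, h' f hf, add_zero]
  zero_mem' := by intro f hf; simp
  smul_mem' := by
    intro c w h f hf
    simp only [Pi.smul_apply, smul_eq_mul, mul_assoc]
    rw [← Finset.mul_sum, h f hf, mul_zero]

theorem self_mem_Tan [Infinite K] {S : Set (ι → K)} (hS : ∀ v ∈ S, ∀ t : K, t • v ∈ S) {a : ι → K} (ha : a ∈ S) :
    a ∈ Tan S a := by
  intro f hf
  have h0 : linePoly f a a = 0 := by
    apply Polynomial.funext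
    intro t
    rw [linePoly_eval, Polynomial.eval_zero]
    have : a + t • a = (1 + t) • a := by rw [add_smul, one_smul]
    rw [this]; exact hf _ (hS a ha _)
  have h1 := chain (Polynomial.derivative' : Derivation K (Polynomial K) (Polynomial K))
    (fun j => Polynomial.C (a j) + Polynomial.C (a j) * Polynomial.X) f
  rw [show aeval (fun j => Polynomial.C (a j) + Polynomial.C (a j) * Polynomial.X) f = linePoly f a a from rfl,
    h0, map_zero] at h1
  have h2 := congrArg (Polynomial.eval 0) h1
  rw [Polynomial.eval_zero, Polynomial.eval_finsetSum] at h2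
  rw [h2]
  refine Finset.sum_congr rfl fun i _ => ?_
  have h3 := linePoly_eval (pderiv i f) a a 0
  rw [zero_smul, add_zero] at h3
  rw [smul_eq_mul, Polynomial.eval_mul, ← h3]
  have h4 : Polynomial.eval 0 (Polynomial.derivative' (Polynomial.C (a i) + Polynomial.C (a i) * Polynomial.X)) = a i := by
    simp [Polynomial.derivative'_apply]
  rw [h4, mul_comm]
  rfl

theorem pderiv_slice {k : ℕ} (f : MvPolynomial (Fin k × ι) K) (A : Fin k × ι → K) (i : Fin k) (b : ι) :
    pderiv b (slice f A i) = slice (pderiv (i, b) f) A i := by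
  classical
  unfold slice
  induction f using MvPolynomial.induction_on with
  | C a => simp
  | add p q hp hq => simp only [map_add, hp, hq]
  | mul_X p j hp =>
    simp only [map_mul, pderiv_mul, map_add, hp, aeval_X]
    congr 2
    by_cases hj : j.1 = i
    · by_cases hb : j.2 = b
      · have : j = (i, b) := Prod.ext hj hb
        subst this; simp
      · have h1 : j ≠ (i, b) := fun h => hb (by rw [h])
        rw [if_pos hj, pderiv_X_of_ne hb, pderiv_X_of_ne h1, map_zero]
    · have h1 : j ≠ (i, b) := fun h => hj (by rw [h])
      rw [if_neg hj, pderiv_X_of_ne h1, map_zero, pderiv_C]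

theorem tan_prod {k : ℕ} {S : Set (ι → K)} {A W : Fin k × ι → K} (hA : A ∈ CK k S)
    (hW : ∀ i, (fun b => W (i, b)) ∈ Tan S (fun b => A (i, b))) {f : MvPolynomial (Fin k × ι) K}
    (hf : ∀ A ∈ CK k S, eval A f = 0) : ∑ p, W p * eval A (pderiv p f) = 0 := by
  rw [Fintype.sum_prod_type]
  refine Finset.sum_eq_zero fun i _ => ?_
  have := hW i (slice f A i) (fun v hv => by rw [slice_eval]; exact hf _ (upd_mem hA i hv))
  simp only [pderiv_slice, slice_eval, upd_self] at this
  exact this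

end Tangent

/-- generic data -/
structure Dat (k : ℕ) (S : Set (ι → K)) (F : Type*) [Field F] [Algebra K F] where
  x : Fin k × ι → F
  gen : Gen (CK k S) x
  frac : ∀ φ : F, ∃ f g : MvPolynomial (Fin k × ι) K, aeval x g ≠ 0 ∧ φ * aeval x g = aeval x f
  J : Finset ι
  cardJ : J.card = k * rho S
  ind : AlgebraicIndependent K (fun j : J => ∑ i, x (i, (j : ι)))
  alg : ∀ φ : F, IsAlgebraic (Algebra.adjoin K (Set.range (fun j : J => ∑ i, x (i, (j : ι))))) φ
  cone : ∀ v ∈ S, ∀ t : K, t • v ∈ S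
  closed : ∀ v, (∀ f : MvPolynomial ι K, (∀ w ∈ S, eval w f = 0) → eval v f = 0) → v ∈ S
  ne : S.Nonempty

namespace Dat
variable {k : ℕ} {S : Set (ι → K)} {F : Type*} [Field F] [Algebra K F] (d : Dat k S F)

/-- generic sum -/
def q (b : ι) : F := ∑ i, d.x (i, b)

/-- generic sum as a polynomial -/
def qp (k : ℕ) (K : Type*) [Field K] {ι : Type*} (b : ι) : MvPolynomial (Fin k × ι) K := ∑ i, X (i, b)

theorem aeval_qp (b : ι) : aeval d.x (qp k K b) = d.q b := by simp [qp, q]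

theorem eval_qp (A : Fin k × ι → K) (b : ι) : eval A (qp k K b) = sumv A b := by simp [qp, sumv]

theorem sp_iff {A : Fin k × ι → K} : Sp d.x A ↔ A ∈ CK k S := by
  constructor
  · intro h i
    apply d.closed
    intro f hf
    have := h (rename (fun b => (i, b)) f) (by
      rw [d.gen]
      intro B hB
      rw [eval_rename]; exact hf _ (hB i))
    rwa [eval_rename] at this
  · intro h f hf
    exact (d.gen f).1 hf A h

/-- value of a polynomial at the J-coordinates -/
def dv (δ : MvPolynomial d.J K) (v : ι → K) : K := eval (fun j : d.J => v j) δ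

theorem nice1 (φ : F) : ∃ δ : MvPolynomial d.J K, δ ≠ 0 ∧ ∀ A : Fin k × ι → K,
    d.dv δ (sumv A) ≠ 0 → φ ∈ loc d.x A := by
  obtain ⟨f, g, hg, he⟩ := d.frac φ
  obtain ⟨c, hc, h, hh, e⟩ := norm0 (K := K) (F := F) (y := fun j : d.J => ∑ i, d.x (i, (j : ι)))
    (aeval d.x).range
    (fun j => ⟨qp k K (j : ι), d.aeval_qp j⟩) ⟨g, rfl⟩ hg (d.alg _)
  obtain ⟨h', rfl⟩ := hh
  refine ⟨c, hc, fun A hA => ⟨f * h', aeval (fun j : d.J => qp k K (j : ι)) c, ?_, ?_⟩⟩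
  · have : eval A (aeval (fun j : d.J => qp k K (j : ι)) c) = d.dv c (sumv A) := by
      unfold dv
      rw [← aeval_eq_eval, ← aeval_eq_eval]
      show aeval A (aeval _ c) = aeval _ c
      rw [← AlgHom.comp_apply, comp_aeval]
      congr 2
      funext j
      exact eval_qp A j
    rwa [this]
  · rw [← AlgHom.comp_apply, comp_aeval]
    have : (fun j : d.J => aeval d.x (qp k K (j : ι))) = fun j : d.J => ∑ i, d.x (i, (j : ι)) := by
      funext j; exact d.aeval_qp j
    rw [this, e, map_mul, ← he]
    simp only [AlgHom.toRingHom_eq_coe, RingHom.coe_coe]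
    ring

theorem nice (Φ : Set F) (hΦ : Φ.Finite) : ∃ δ : MvPolynomial d.J K, δ ≠ 0 ∧ ∀ A : Fin k × ι → K,
    d.dv δ (sumv A) ≠ 0 → ∀ φ ∈ Φ, φ ∈ loc d.x A := by
  induction Φ, hΦ using Set.Finite.induction_on with
  | empty => exact ⟨1, one_ne_zero, by simp⟩
  | @insert a s _ _ ih =>
    obtain ⟨δ, h1, h2⟩ := ih
    obtain ⟨δ', h1', h2'⟩ := d.nice1 a
    refine ⟨δ * δ', mul_ne_zero h1 h1', fun A hA => ?_⟩
    unfold dv at hA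
    rw [map_mul] at hA
    rintro φ (rfl | hφ)
    · exact h2' A (right_ne_zero_of_mul hA)
    · exact h2 A (left_ne_zero_of_mul hA) φ hφ

theorem exists_nice {δ : MvPolynomial d.J K} (h : δ ≠ 0) : ∃ A ∈ CK k S, d.dv δ (sumv A) ≠ 0 := by
  by_contra hc
  push Not at hc
  apply h
  refine (algebraicIndependent_iff.1 d.ind) δ ?_
  have h1 : aeval d.x (aeval (fun j : d.J => qp k K (j : ι)) δ) = 0 := by
    rw [d.gen]
    intro A hA
    rw [← hc A hA]
    unfold dv
    rw [← aeval_eq_eval, ← aeval_eq_eval]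
    show aeval A (aeval _ δ) = aeval _ δ
    rw [← AlgHom.comp_apply, comp_aeval]
    congr 2
    funext j
    exact eval_qp A j
  rw [← AlgHom.comp_apply, comp_aeval] at h1
  rw [← h1]
  congr 2
  funext j; exact (d.aeval_qp j).symm

/-- every derivation evaluated at a point is tangent -/
theorem tan_mem {A : Fin k × ι → K} (hA : A ∈ CK k S) (E : Derivation K F F) (i : Fin k)
    (hE : ∀ b, E (d.x (i, b)) ∈ loc d.x A) :
    (fun b => val d.x A (E (d.x (i, b)))) ∈ Tan S (fun b => A (i, b)) := by
  intro f hf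
  have hsp := d.sp_iff.2 hA
  have h1 : aeval (fun b => d.x (i, b)) f = 0 := (gen_row d.gen i f).2 hf
  have h2 := chain E (fun b => d.x (i, b)) f
  simp only [h1, map_zero, smul_eq_mul] at h2
  have h3 : ∀ p : MvPolynomial ι K, aeval (fun b => d.x (i, b)) p ∈ loc d.x A ∧
    val d.x A (aeval (fun b => d.x (i, b)) p) = eval (fun b => A (i, b)) p := by
    intro p
    have := hsp.val_map p (fun b => d.x (i, b)) (fun b => var_mem_loc _ _ _)
    simpa only [hsp.val_var] using this
  have h4 := congrArg (val d.x A) h2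
  rw [hsp.val_sum _ _ (fun b _ => mul_mem (h3 _).1 (hE b))] at h4
  have h5 : val d.x A 0 = 0 := by simpa using hsp.val_algebraMap (0 : K)
  rw [h5] at h4
  rw [h4]
  refine Finset.sum_congr rfl fun b _ => ?_
  rw [hsp.val_mul (h3 _).1 (hE b), (h3 _).2, mul_comm]

end Dat

end

section
open MvPolynomial
universe u w
set_option linter.unusedSectionVars false
set_option linter.style.haveILetI false
variable {K : Type*} [Field K] {ι : Type*} [Fintype ι]

theorem der_sum_apply {F : Type*} [Field F] [Algebra K F] {α : Type*} (s : Finset α) (c : α → F)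
    (D : α → Derivation K F F) (φ : F) : (∑ l ∈ s, c l • D l) φ = ∑ l ∈ s, c l * D l φ := by
  classical
  induction s using Finset.induction_on with
  | empty => simp
  | insert a s ha ih => rw [Finset.sum_insert ha, Finset.sum_insert ha, Derivation.add_apply, ih]; rfl

namespace Dat
variable {k : ℕ} {S : Set (ι → K)} {F : Type*} [Field F] [Algebra K F] (d : Dat k S F)

/-- the filter of generic tuples -/
def fil : Filter (Fin k × ι → K) where
  sets := {s | ∃ δ : MvPolynomial d.J K, δ ≠ 0 ∧ ∀ A ∈ CK k S, d.dv δ (sumv A) ≠ 0 → A ∈ s}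
  univ_sets := ⟨1, one_ne_zero, by simp⟩
  sets_of_superset := by
    rintro s t ⟨δ, h, h'⟩ hst
    exact ⟨δ, h, fun A hA h1 => hst (h' A hA h1)⟩
  inter_sets := by
    rintro s t ⟨δ, h, h'⟩ ⟨ε, g, g'⟩
    refine ⟨δ * ε, mul_ne_zero h g, fun A hA h1 => ?_⟩
    unfold dv at h1
    rw [map_mul] at h1
    exact ⟨h' A hA (left_ne_zero_of_mul h1), g' A hA (right_ne_zero_of_mul h1)⟩

theorem ev_loc (φ : F) : ∀ᶠ A in d.fil, φ ∈ loc d.x A := by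
  obtain ⟨δ, h, h'⟩ := d.nice1 φ
  exact ⟨δ, h, fun _ _ h1 => h' _ h1⟩

theorem ev_mem : ∀ᶠ A in d.fil, A ∈ CK k S := ⟨1, one_ne_zero, fun A hA _ => hA⟩

theorem ev_sp : ∀ᶠ A in d.fil, Sp d.x A := d.ev_mem.mono fun _ h => d.sp_iff.2 h

instance fil_neBot : d.fil.NeBot := by
  rw [Filter.neBot_iff]
  intro h
  have : ∀ᶠ A in d.fil, False := by rw [h]; exact Filter.eventually_bot
  obtain ⟨δ, h1, h2⟩ := this
  obtain ⟨A, hA, h3⟩ := d.exists_nice h1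
  exact h2 A hA h3

theorem ev_ne {φ : F} (h : φ ≠ 0) : ∀ᶠ A in d.fil, val d.x A φ ≠ 0 := by
  filter_upwards [d.ev_loc φ, d.ev_loc φ⁻¹, d.ev_sp] with A h1 h2 h3
  exact h3.val_ne h h1 h2

theorem zero_of_ev {φ : F} (h : ∀ᶠ A in d.fil, val d.x A φ = 0) : φ = 0 := by
  by_contra h0
  obtain ⟨A, h1, h2⟩ := (h.and (d.ev_ne h0)).exists
  exact h2 h1

variable [CharZero K]

/-- coordinate derivations -/
def D (l : d.J) : Derivation K F F := by
  classical
  exact Classical.choose (der_exists d.ind d.alg l)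

theorem D_q [DecidableEq d.J] (l j : d.J) : d.D l (d.q j) = if j = l then 1 else 0 := by
  classical
  have := Classical.choose_spec (der_exists d.ind d.alg l) j
  unfold D q
  convert! this

theorem D_comm (l m : d.J) (φ : F) : d.D l (d.D m φ) = d.D m (d.D l φ) := by
  classical
  have : ⁅d.D l, d.D m⁆ = 0 := by
    apply der_unique d.alg
    intro j
    have h : ∀ l, d.D l (∑ i, d.x (i, (j : ι))) = if j = l then 1 else 0 := fun l => d.D_q l j
    rw [Derivation.commutator_apply, h, h]
    split_ifs <;> simp
  have h2 := congrArg (fun D' : Derivation K F F => D' φ) this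
  simp only [Derivation.commutator_apply, Derivation.zero_apply] at h2
  exact sub_eq_zero.1 h2

/-- Gauss map coordinates -/
def G (b : ι) (l : d.J) : F := d.D l (d.q b)

theorem G_J [DecidableEq d.J] (j l : d.J) : d.G j l = if j = l then 1 else 0 := d.D_q l j

theorem G_symm (b : ι) (l j : d.J) : d.D l (d.G b j) = d.D j (d.G b l) := d.D_comm l j _

theorem G_sum (b : ι) (l : d.J) : d.G b l = ∑ i, d.D l (d.x (i, b)) := by simp [G, q]

/-- the tangent lemma -/
theorem tan_lemma : ∀ᶠ A in d.fil, ∀ W : Fin k × ι → K,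
    (∀ i, (fun b => W (i, b)) ∈ Tan S (fun b => A (i, b))) →
    ∀ p, W p = ∑ l : d.J, val d.x A (d.D l (d.x p)) * ∑ i, W (i, (l : ι)) := by
  have h : ∀ p : Fin k × ι, ∀ᶠ A in d.fil, ∀ W : Fin k × ι → K,
    (∀ i, (fun b => W (i, b)) ∈ Tan S (fun b => A (i, b))) →
      W p = ∑ l : d.J, val d.x A (d.D l (d.x p)) * ∑ i, W (i, (l : ι)) := by
    intro p
    obtain ⟨r, hr, hr'⟩ := sep_rel d.ind (d.alg (d.x p))
    set z : Option d.J → F := fun o => o.elim (d.x p) (fun j : d.J => ∑ i, d.x (i, (j : ι))) with hz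
    have hD : ∀ᶠ A in d.fil, ∀ l, d.D l (d.x p) ∈ loc d.x A :=
      Filter.eventually_all.2 fun l => d.ev_loc _
    filter_upwards [hD, d.ev_ne hr', d.ev_mem] with A h1 h2 hA W hW
    have hsp := d.sp_iff.2 hA
    set zp : Option d.J → MvPolynomial (Fin k × ι) K := fun o => o.elim (X p) (fun j => qp k K (j : ι)) with hzp
    have hzz : ∀ o, aeval d.x (zp o) = z o := by
      rintro (_ | j)
      · simp [z, zp]
      · exact d.aeval_qp j
    have hze : ∀ f : MvPolynomial (Option d.J) K, aeval d.x (aeval zp f) = aeval z f := by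
      intro f
      rw [← AlgHom.comp_apply, comp_aeval]
      congr 2
      funext o; exact hzz o
    have hP : ∀ B ∈ CK k S, eval B (aeval zp r) = 0 := by
      rw [← d.gen, hze, hr]
    have h3 := tan_prod hA hW hP
    have h4 : ∀ f : MvPolynomial (Option d.J) K, aeval z f ∈ loc d.x A ∧
        val d.x A (aeval z f) = eval A (aeval zp f) := by
      intro f
      rw [← hze]
      exact ⟨aeval_mem_loc _ _ _, hsp.val_aeval _⟩
    -- directional derivative
    have h5 : ∀ f : MvPolynomial (Fin k × ι) K, ∀ p, pderiv p (aeval zp r) =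
        ∑ o, aeval zp (pderiv o r) * pderiv p (zp o) := by
      intro f p
      rw [chain]; rfl
    have h6 : ∑ o, eval A (aeval zp (pderiv o r)) * ∑ p, W p * eval A (pderiv p (zp o)) = 0 := by
      rw [← h3]
      simp_rw [h5 0, map_sum, map_mul, Finset.mul_sum]
      rw [Finset.sum_comm]
      refine Finset.sum_congr rfl fun p _ => Finset.sum_congr rfl fun o _ => ?_
      ring
    have h7 : ∑ p', W p' * eval A (pderiv p' (zp none)) = W p := by
      classical
      rw [Finset.sum_eq_single p]
      · simp [zp]
      · intro b _ hb
        simp only [zp, Option.elim]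
        rw [pderiv_X_of_ne hb.symm]; simp
      · simp
    have h8 : ∀ j : d.J, ∑ p', W p' * eval A (pderiv p' (zp (some j))) = ∑ i, W (i, (j : ι)) := by
      classical
      intro j
      simp only [zp, Option.elim, qp, map_sum, Finset.mul_sum]
      rw [Finset.sum_comm]
      refine Finset.sum_congr rfl fun i _ => ?_
      rw [Finset.sum_eq_single (i, (j : ι))]
      · simp
      · intro b _ hb
        rw [pderiv_X_of_ne hb.symm]; simp
      · simp
    rw [Fintype.sum_option, h7] at h6
    simp_rw [h8, ← (h4 _).2] at h6
    -- derivation relation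
    have h9 : ∀ l : d.J, val d.x A (aeval z (pderiv (some l) r)) =
        - (val d.x A (aeval z (pderiv none r)) * val d.x A (d.D l (d.x p))) := by
      classical
      intro l
      have e := chain (d.D l) z r
      rw [hr, map_zero, Fintype.sum_option] at e
      have e2 : ∀ j : d.J, d.D l (z (some j)) = if j = l then 1 else 0 := fun j => d.D_q l j
      simp only [e2, smul_eq_mul, mul_ite, mul_one, mul_zero, Finset.sum_ite_eq', Finset.mem_univ, if_true] at e
      have e3 : aeval z (pderiv (some l) r) = -(aeval z (pderiv none r) * d.D l (d.x p)) :=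
        eq_neg_of_add_eq_zero_right e.symm
      rw [e3, hsp.val_neg (mul_mem (h4 _).1 (h1 l)), hsp.val_mul (h4 _).1 (h1 l)]
    simp_rw [h9] at h6
    apply mul_left_cancel₀ h2
    rw [Finset.mul_sum, eq_comm, ← sub_eq_zero, ← neg_eq_zero, ← h6, neg_sub, sub_eq_add_neg, ← Finset.sum_neg_distrib]
    congr 1
    refine Finset.sum_congr rfl fun l _ => ?_
    ring
  filter_upwards [Filter.eventually_all.2 h] with A h W hW p using h p W hW

end Dat

end

section
open MvPolynomial
universe u w
set_option linter.unusedSectionVars false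
set_option linter.style.haveILetI false
variable {K : Type*} [Field K] {ι : Type*} [Fintype ι]

/-- graph of a linear map -/
def gr {J : Finset ι} (g : ι → J → K) : Submodule K (ι → K) where
  carrier := {w | ∀ b, w b = ∑ l : J, g b l * w l}
  add_mem' := by
    intro w w' h h' b
    simp only [Pi.add_apply, mul_add, Finset.sum_add_distrib]
    rw [← h b, ← h' b]
  zero_mem' := by intro b; simp
  smul_mem' := by
    intro c w h b
    simp only [Pi.smul_apply, smul_eq_mul]
    rw [h b, Finset.mul_sum]
    refine Finset.sum_congr rfl fun l _ => ?_
    ring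

theorem col_mem_gr {J : Finset ι} [DecidableEq J] {g : ι → J → K} (hg : ∀ j l : J, g j l = if j = l then 1 else 0) (l : J) :
    (fun b => g b l) ∈ gr g := by
  intro b
  simp [hg]

theorem gr_inj {J : Finset ι} [DecidableEq J] {g g' : ι → J → K} (hg : ∀ j l : J, g j l = if j = l then 1 else 0)
    (h : gr g ≤ gr g') : g = g' := by
  funext b l
  have := h (col_mem_gr hg l) b
  rw [this]
  simp [hg]

namespace Dat
variable {k : ℕ} {S : Set (ι → K)} {F : Type*} [Field F] [Algebra K F] (d : Dat k S F) [CharZero K]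

/-- value of the Gauss map -/
def gA (A : Fin k × ι → K) (b : ι) (l : d.J) : K := val d.x A (d.G b l)

theorem ev_G : ∀ᶠ A in d.fil, ∀ b l, d.G b l ∈ loc d.x A :=
  Filter.eventually_all.2 fun _ => Filter.eventually_all.2 fun _ => d.ev_loc _

theorem gA_J [DecidableEq d.J] {A : Fin k × ι → K} (hA : A ∈ CK k S) (j l : d.J) :
    d.gA A j l = if j = l then 1 else 0 := by
  unfold gA
  rw [d.G_J]
  have hsp := d.sp_iff.2 hA
  split_ifs
  · simpa using hsp.val_algebraMap (1 : K)
  · simpa using hsp.val_algebraMap (0 : K)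

theorem tan_le : ∀ᶠ A in d.fil, ∀ i, Tan S (fun b => A (i, b)) ≤ gr (d.gA A) := by
  have hD : ∀ᶠ A in d.fil, ∀ l p, d.D l (d.x p) ∈ loc d.x A :=
      Filter.eventually_all.2 fun l => Filter.eventually_all.2 fun _ => d.ev_loc _
  filter_upwards [d.tan_lemma, hD, d.ev_sp] with A h hD hsp i w hw b
  have h1 := h (fun p => if p.1 = i then w p.2 else 0) (by
    intro i'
    by_cases hi : i' = i
    · subst hi; simpa using hw
    · simp only [hi, if_false]; exact zero_mem _)
  have h2 : ∀ b, ∑ i', (if i' = i then w b else 0) = w b := by intro b; simp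
  simp only [h2] at h1
  rw [← h2 b]
  rw [Finset.sum_congr rfl fun i' _ => h1 (i', b), Finset.sum_comm]
  refine Finset.sum_congr rfl fun l _ => ?_
  rw [← Finset.sum_mul]
  congr 1
  unfold gA
  rw [G_sum, hsp.val_sum _ _ (fun i _ => hD _ _)]

theorem tan_sup : ∀ᶠ A in d.fil, (⨆ i, Tan S (fun b => A (i, b))) = gr (d.gA A) := by
  have hD : ∀ᶠ A in d.fil, ∀ l p, d.D l (d.x p) ∈ loc d.x A :=
      Filter.eventually_all.2 fun l => Filter.eventually_all.2 fun _ => d.ev_loc _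
  filter_upwards [d.tan_le, hD, d.ev_mem] with A h hD hA
  apply le_antisymm (iSup_le h)
  intro w hw
  have : w = ∑ i, fun b => ∑ l : d.J, val d.x A (d.D l (d.x (i, b))) * w l := by
    funext b
    rw [Finset.sum_apply, Finset.sum_comm, hw b]
    refine Finset.sum_congr rfl fun l _ => ?_
    rw [← Finset.sum_mul]
    congr 1
    unfold gA
    rw [G_sum, (d.sp_iff.2 hA).val_sum _ _ (fun i _ => hD _ _)]
  rw [this]
  refine Submodule.sum_mem _ fun i _ => ?_
  refine Submodule.mem_iSup_of_mem i ?_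
  have h2 : (fun b => ∑ l : d.J, val d.x A (d.D l (d.x (i, b))) * w l) =
    ∑ l : d.J, w l • fun b => val d.x A (d.D l (d.x (i, b))) := by
    funext b; rw [Finset.sum_apply]
    refine Finset.sum_congr rfl fun l _ => ?_
    rw [Pi.smul_apply, smul_eq_mul, mul_comm]
  rw [h2]
  exact Submodule.sum_mem _ fun l _ => Submodule.smul_mem _ _ (d.tan_mem hA _ _ fun b => hD _ _)

theorem tan_finrank_ge (i : Fin k) : ∀ᶠ A in d.fil, rho S ≤ Module.finrank K (Tan S (fun b => A (i, b))) := by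
  classical
  obtain ⟨s, hs, hc⟩ := exists_rho d.ne
  have hi := ((gen_row d.gen i).indep_iff (s : Set ι)).2 hs
  choose E hE using fun l => der_dual (K := K) (F := F) (J := (s : Set ι)) hi l
  have hD : ∀ᶠ A in d.fil, ∀ l b, E l (d.x (i, b)) ∈ loc d.x A :=
      Filter.eventually_all.2 fun l => Filter.eventually_all.2 fun _ => d.ev_loc _
  filter_upwards [hD, d.ev_mem] with A hD hA
  have hsp := d.sp_iff.2 hA
  let v : ↥(s : Set ι) → Tan S (fun b => A (i, b)) := fun l =>
    ⟨fun b => val d.x A (E l (d.x (i, b))), d.tan_mem hA _ _ fun b => hD _ _⟩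
  have hv : LinearIndependent K v := by
    let f : Tan S (fun b => A (i, b)) →ₗ[K] (↥(s : Set ι) → K) :=
      { toFun := fun w j => w.1 j
        map_add' := fun _ _ => rfl
        map_smul' := fun _ _ => rfl }
    apply LinearIndependent.of_comp f
    have : f ∘ v = fun l => Pi.basisFun K (s : Set ι) l := by
      funext l j
      have h0 : f (v l) j = val d.x A (E l (d.x (i, j))) := rfl
      rw [Function.comp_apply, h0, hE l j, Pi.basisFun_apply, Pi.single_apply]
      split_ifs
      · simpa using hsp.val_algebraMap (1 : K)
      · simpa using hsp.val_algebraMap (0 : K)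
    rw [this]
    exact (Pi.basisFun K (s : Set ι)).linearIndependent
  have := hv.fintype_card_le_finrank
  rw [← hc]
  simpa using this

theorem tan_finrank : ∀ᶠ A in d.fil, ∀ i, Module.finrank K (Tan S (fun b => A (i, b))) = rho S := by
  filter_upwards [Filter.eventually_all.2 d.tan_finrank_ge, d.tan_lemma] with A h1 h2
  let f : ((i : Fin k) → Tan S (fun b => A (i, b))) →ₗ[K] (d.J → K) :=
    { toFun := fun W l => ∑ i, (W i).1 l
      map_add' := by intro a b; funext l; simp [Finset.sum_add_distrib]
      map_smul' := by intro a b; funext l; simp [Finset.mul_sum] }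
  have hf : Function.Injective f := by
    rw [injective_iff_map_eq_zero]
    intro W hW
    have := h2 (fun p => (W p.1).1 p.2) (fun i => (W i).2)
    have h3 : ∀ l : d.J, ∑ i, (W i).1 l = 0 := fun l => congrFun hW l
    simp only [h3, mul_zero, Finset.sum_const_zero] at this
    funext i
    apply Subtype.ext
    funext b
    exact this (i, b)
  have h3 := LinearMap.finrank_le_finrank_of_injective hf
  rw [Module.finrank_pi_fintype, Module.finrank_fintype_fun_eq_card, Fintype.card_coe, d.cardJ] at h3
  have h4 : ∑ i : Fin k, rho S = ∑ i, Module.finrank K (Tan S (fun b => A (i, b))) := by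
    apply le_antisymm (Finset.sum_le_sum fun i _ => h1 i)
    simpa using h3
  intro i
  exact ((Finset.sum_eq_sum_iff_of_le fun i _ => h1 i).1 h4 i (Finset.mem_univ _)).symm

theorem x_rel [Infinite K] (i : Fin k) (b : ι) : d.x (i, b) = ∑ l : d.J, d.G b l * d.x (i, (l : ι)) := by
  rw [← sub_eq_zero]
  apply d.zero_of_ev
  filter_upwards [d.tan_le, d.ev_mem, d.ev_G] with A h hA hG
  have hsp := d.sp_iff.2 hA
  have h1 := h i (self_mem_Tan d.cone (hA i)) b
  have h2 : ∀ l, d.G b l * d.x (i, (l : ι)) ∈ loc d.x A := fun l => mul_mem (hG _ _) (var_mem_loc _ _ _)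
  rw [sub_eq_add_neg, hsp.val_add (var_mem_loc _ _ _) (neg_mem (sum_mem fun l _ => h2 l)),
    hsp.val_neg (sum_mem fun l _ => h2 l), hsp.val_sum _ _ (fun l _ => h2 l), hsp.val_var, ← sub_eq_add_neg, sub_eq_zero, h1]
  refine Finset.sum_congr rfl fun l _ => ?_
  rw [hsp.val_mul (hG _ _) (var_mem_loc _ _ _), hsp.val_var]; rfl

theorem Ex_rel (E : Derivation K F F) (i : Fin k) (b : ι) :
    E (d.x (i, b)) = ∑ l : d.J, d.G b l * E (d.x (i, (l : ι))) := by
  rw [← sub_eq_zero]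
  apply d.zero_of_ev
  have hE : ∀ᶠ A in d.fil, ∀ p, E (d.x p) ∈ loc d.x A := Filter.eventually_all.2 fun _ => d.ev_loc _
  filter_upwards [d.tan_le, d.ev_mem, d.ev_G, hE] with A h hA hG hE
  have hsp := d.sp_iff.2 hA
  have h1 := h i (d.tan_mem hA E i (fun b => hE _)) b
  have h2 : ∀ l : d.J, d.G b l * E (d.x (i, (l : ι))) ∈ loc d.x A := fun l => mul_mem (hG _ _) (hE _)
  rw [sub_eq_add_neg, hsp.val_add (hE _) (neg_mem (sum_mem fun l _ => h2 l)),
    hsp.val_neg (sum_mem fun l _ => h2 l), hsp.val_sum _ _ (fun l _ => h2 l), ← sub_eq_add_neg, sub_eq_zero]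
  rw [h1]
  refine Finset.sum_congr rfl fun l _ => ?_
  rw [hsp.val_mul (hG _ _) (hE _)]; rfl

theorem G_rel [Infinite K] (E : Derivation K F F) (i : Fin k) (b : ι) :
    ∑ l : d.J, d.x (i, (l : ι)) * E (d.G b l) = 0 := by
  have h1 := congrArg E (d.x_rel i b)
  rw [map_sum, d.Ex_rel E i b] at h1
  simp only [Derivation.leibniz, smul_eq_mul, Finset.sum_add_distrib] at h1
  exact (left_eq_add.1 h1)

end Dat

end

section
open MvPolynomial
universe u w
set_option linter.unusedSectionVars false
set_option linter.style.haveILetI false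
variable {K : Type*} [Field K] {ι : Type*} [Fintype ι]

namespace Dat
variable {k : ℕ} {S : Set (ι → K)} {F : Type*} [Field F] [Algebra K F] (d : Dat k S F) [CharZero K]

theorem G_frac (b : ι) (l : d.J) : ∃ num den : MvPolynomial ι K, aeval d.q den ≠ 0 ∧
    d.G b l * aeval d.q den = aeval d.q num := by
  classical
  obtain ⟨r, hr, hr'⟩ := sep_rel d.ind (d.alg (d.q b))
  set z : Option d.J → F := fun o => o.elim (d.q b) (fun j : d.J => ∑ i, d.x (i, (j : ι))) with hz
  let g : Option d.J → ι := fun o => o.elim b (fun j => (j : ι))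
  have hg : ∀ f : MvPolynomial (Option d.J) K, aeval d.q (rename g f) = aeval z f := by
    intro f
    rw [aeval_rename]
    congr 2
    funext o
    rcases o with _ | j <;> rfl
  refine ⟨- rename g (pderiv (some l) r), rename g (pderiv none r), by rwa [hg], ?_⟩
  rw [map_neg, hg, hg]
  have e := chain (d.D l) z r
  rw [hr, map_zero, Fintype.sum_option] at e
  have e2 : ∀ j : d.J, d.D l (z (some j)) = if j = l then 1 else 0 := fun j => d.D_q l j
  simp only [e2, smul_eq_mul, mul_ite, mul_one, mul_zero, Finset.sum_ite_eq', Finset.mem_univ, if_true] at e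
  have e4 : d.G b l = d.D l (z none) := rfl
  rw [e4]
  linear_combination -e

/-- numerator -/
def Gn (b : ι) (l : d.J) : MvPolynomial ι K := Classical.choose (d.G_frac b l)
/-- denominator -/
def Gd (b : ι) (l : d.J) : MvPolynomial ι K := Classical.choose (Classical.choose_spec (d.G_frac b l))
theorem Gd_ne (b : ι) (l : d.J) : aeval d.q (d.Gd b l) ≠ 0 :=
  (Classical.choose_spec (Classical.choose_spec (d.G_frac b l))).1
theorem G_eq (b : ι) (l : d.J) : d.G b l * aeval d.q (d.Gd b l) = aeval d.q (d.Gn b l) :=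
  (Classical.choose_spec (Classical.choose_spec (d.G_frac b l))).2

theorem q_loc (A : Fin k × ι → K) (b : ι) : d.q b ∈ loc d.x A := by
  rw [← aeval_qp]; exact aeval_mem_loc _ _ _

theorem val_q {A : Fin k × ι → K} (hA : Sp d.x A) (b : ι) : val d.x A (d.q b) = sumv A b := by
  rw [← aeval_qp, hA.val_aeval, eval_qp]

theorem val_aq {A : Fin k × ι → K} (hA : Sp d.x A) (f : MvPolynomial ι K) : aeval d.q f ∈ loc d.x A ∧
    val d.x A (aeval d.q f) = eval (sumv A) f := by
  have := hA.val_map f d.q (fun b => d.q_loc A b)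
  rw [show (fun b => val d.x A (d.q b)) = sumv A from funext fun b => d.val_q hA b] at this
  exact this

theorem ev_Gd : ∀ᶠ A in d.fil, ∀ b l, eval (sumv A) (d.Gd b l) ≠ 0 ∧
    d.gA A b l * eval (sumv A) (d.Gd b l) = eval (sumv A) (d.Gn b l) := by
  refine Filter.eventually_all.2 fun b => Filter.eventually_all.2 fun l => ?_
  filter_upwards [d.ev_ne (d.Gd_ne b l), d.ev_sp, d.ev_G] with A h hsp hG
  rw [(d.val_aq hsp _).2] at h
  refine ⟨h, ?_⟩
  have := congrArg (val d.x A) (d.G_eq b l)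
  rwa [hsp.val_mul (hG b l) (d.val_aq hsp _).1, (d.val_aq hsp _).2, (d.val_aq hsp _).2] at this

/-- the field generated by the Gauss map -/
def EG : IntermediateField K F := IntermediateField.adjoin K (Set.range fun p : ι × d.J => d.G p.1 p.2)

theorem G_mem (b : ι) (l : d.J) : d.G b l ∈ d.EG := IntermediateField.subset_adjoin _ _ ⟨(b, l), rfl⟩

theorem exists_vs [Infinite K] : ∃ (N : ℕ) (v : Fin N → d.J → F) (c : Fin k → Fin N → F),
    (∀ s l, v s l ∈ d.EG) ∧ (∀ i (l : d.J), d.x (i, (l : ι)) = ∑ s, c i s * v s l) ∧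
    ∀ (E : Derivation K F F) s b, ∑ l : d.J, v s l * E (d.G b l) = 0 := by
  classical
  let B := Module.Basis.ofVectorSpace d.EG F
  let κ := Module.Basis.ofVectorSpaceIndex d.EG F
  let T : Finset κ := Finset.univ.biUnion fun p : Fin k × d.J => (B.repr (d.x (p.1, (p.2 : ι)))).support
  let v0 : Fin k × T → d.J → d.EG := fun s l => B.repr (d.x (s.1, (l : ι))) s.2.1
  let G' : ι → d.J → d.EG := fun b l => ⟨d.G b l, d.G_mem b l⟩
  have hA : ∀ (d0 : Derivation K d.EG d.EG) s b, ∑ l : d.J, v0 s l * d0 (G' b l) = 0 := by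
    intro d0 s b
    obtain ⟨D, hD⟩ := ext_field d.EG ((Algebra.linearMap d.EG F).compDer d0)
    have h1 := d.G_rel D s.1 b
    have h2 : ∀ l, D (d.G b l) = algebraMap d.EG F (d0 (G' b l)) := fun l => hD (G' b l)
    have h3 : ∑ l : d.J, d0 (G' b l) • d.x (s.1, (l : ι)) = 0 := by
      rw [← h1]
      refine Finset.sum_congr rfl fun l _ => ?_
      rw [h2, Algebra.smul_def, mul_comm]
    have h4 := congrArg (fun φ => B.repr φ s.2.1) h3
    simp only [map_sum, map_smul, Finsupp.coe_finsetSum, Finset.sum_apply, Finsupp.smul_apply, smul_eq_mul, map_zero, Finsupp.zero_apply] at h4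
    rw [← h4]
    refine Finset.sum_congr rfl fun l _ => ?_
    rw [mul_comm]
  have hB : ∀ (E : Derivation K F F) s b, ∑ l : d.J, (v0 s l : F) * E (d.G b l) = 0 := by
    intro E s b
    apply B.ext_elem
    intro κ'
    have := hA ((B.coord κ').compDer (E.compAlgebraMap d.EG)) s b
    have h5 : ∑ l : d.J, (v0 s l : F) * E (d.G b l) = ∑ l : d.J, v0 s l • E (d.G b l) := rfl
    rw [h5]
    simp only [map_sum, map_smul, Finsupp.coe_finsetSum, Finset.sum_apply, Finsupp.smul_apply, smul_eq_mul, map_zero, Finsupp.zero_apply]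
    exact this
  let e := Fintype.equivFin (Fin k × T)
  refine ⟨_, fun s l => v0 (e.symm s) l, fun i s => if (e.symm s).1 = i then B (e.symm s).2.1 else 0,
    fun s l => (v0 _ l).2, ?_, fun E s b => hB E _ b⟩
  intro i l
  rw [Equiv.sum_comp e.symm (fun s => (if s.1 = i then B s.2.1 else 0) * (v0 s l : F)), Fintype.sum_prod_type]
  rw [Finset.sum_eq_single i]
  · simp only [if_true]
    have h6 : (B.repr (d.x (i, (l : ι)))).support ⊆ T := Finset.subset_biUnion_of_mem (fun p : Fin k × d.J => (B.repr (d.x (p.1, (p.2 : ι)))).support) (Finset.mem_univ (i, l))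
    conv_lhs => rw [← B.linearCombination_repr (d.x (i, (l : ι)))]
    rw [Finsupp.linearCombination_apply, Finsupp.sum_of_support_subset _ h6 _ (by simp), ← Finset.sum_coe_sort]
    refine Finset.sum_congr rfl fun t _ => ?_
    rw [mul_comm]; rfl
  · intro i' _ hi'
    simp [hi']
  · simp

end Dat

end

section
open MvPolynomial
universe u w
set_option linter.unusedSectionVars false
set_option linter.style.haveILetI false
variable {K : Type*} [Field K] {ι : Type*} [Fintype ι]

section Exp
variable [CharZero K] {R : Type*} [CommRing R] [Algebra K R] (δ : Derivation K R R) (e : R →ₐ[K] K)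

/-- exponential series -/
def expS (φ : R) : PowerSeries K := PowerSeries.mk fun n => e (δ^[n] φ) / (n.factorial : K)

theorem expS_deriv (φ : R) : PowerSeries.derivative K (expS δ e φ) = expS δ e (δ φ) := by
  ext n
  rw [PowerSeries.coeff_derivative]
  simp only [expS, PowerSeries.coeff_mk]
  rw [Function.iterate_succ_apply, Nat.factorial_succ]
  have h1 : ((n : K) + 1) ≠ 0 := by exact_mod_cast Nat.succ_ne_zero n
  have h2 : (n.factorial : K) ≠ 0 := by exact_mod_cast Nat.factorial_ne_zero n
  push_cast
  field_simp

theorem expS_zero_coeff (φ : R) : PowerSeries.coeff 0 (expS δ e φ) = e φ := by simp [expS]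

theorem expS_add (φ χ : R) : expS δ e (φ + χ) = expS δ e φ + expS δ e χ := by
  ext n
  simp only [expS, PowerSeries.coeff_mk, map_add]
  rw [iterate_map_add, map_add, add_div]

theorem coeff_of_deriv (f g : PowerSeries K) (n : ℕ)
    (h : PowerSeries.coeff n (PowerSeries.derivative K f) = PowerSeries.coeff n (PowerSeries.derivative K g)) :
    PowerSeries.coeff (n+1) f = PowerSeries.coeff (n+1) g := by
  rw [PowerSeries.coeff_derivative, PowerSeries.coeff_derivative] at h
  exact mul_right_cancel₀ (by exact_mod_cast Nat.succ_ne_zero n) h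

theorem expS_mul (φ χ : R) : expS δ e (φ * χ) = expS δ e φ * expS δ e χ := by
  ext n
  induction n generalizing φ χ with
  | zero =>
    have h0 : ∀ f : PowerSeries K, PowerSeries.coeff 0 f = PowerSeries.constantCoeff f := fun f => by simp
    rw [expS_zero_coeff, h0, map_mul PowerSeries.constantCoeff, ← h0, ← h0, expS_zero_coeff, expS_zero_coeff, map_mul]
  | succ n ih =>
    apply coeff_of_deriv
    rw [expS_deriv, Derivation.leibniz, Derivation.leibniz, expS_deriv, expS_deriv, expS_add, map_add, map_add]
    simp only [smul_eq_mul]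
    rw [ih, ih]

theorem expS_of_zero {φ : R} (h : δ φ = 0) : expS δ e φ = PowerSeries.C (e φ) := by
  ext n
  cases n with
  | zero => rw [expS_zero_coeff]; simp
  | succ n => 
    simp only [expS, PowerSeries.coeff_mk]
    rw [Function.iterate_succ_apply, h, iterate_map_zero]
    simp

theorem expS_of_zero2 {φ : R} (h : δ (δ φ) = 0) :
    expS δ e φ = PowerSeries.C (e φ) + PowerSeries.X * PowerSeries.C (e (δ φ)) := by
  ext n
  cases n with
  | zero => rw [expS_zero_coeff]; simp
  | succ n => 
    apply coeff_of_deriv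
    rw [expS_deriv, expS_of_zero δ e h]
    simp

/-- exponential as an algebra morphism -/
def expA : R →ₐ[K] PowerSeries K where
  toFun := expS δ e
  map_one' := by rw [expS_of_zero δ e (by simp)]; simp
  map_mul' := expS_mul δ e
  map_zero' := by rw [expS_of_zero δ e (by simp)]; simp
  map_add' := expS_add δ e
  commutes' := by intro r; rw [expS_of_zero δ e (by simp)]; simp

end Exp

section LocDer
variable {F : Type*} [Field F] [Algebra K F] {I : Type*}

theorem loc_stable [Fintype I] {z : I → F} {v : I → K} (E : Derivation K F F) (hE : ∀ i, E (z i) ∈ loc z v) {φ : F}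
    (h : φ ∈ loc z v) : E φ ∈ loc z v := by
  obtain ⟨f, g, hg, e⟩ := h
  have h1 : ∀ p : MvPolynomial I K, E (aeval z p) ∈ loc z v := by
    intro p
    rw [chain]
    exact sum_mem fun i _ => mul_mem (aeval_mem_loc _ _ _) (hE i)
  have h2 : E φ * aeval z g = E (aeval z f) - φ * E (aeval z g) := by
    rw [← e, Derivation.leibniz]; simp only [smul_eq_mul]; ring
  have h3 : E φ * aeval z g ∈ loc z v := by
    rw [h2]; exact sub_mem (h1 _) (mul_mem ⟨f, g, hg, e⟩ (h1 _))
  obtain ⟨f', g', hg', e'⟩ := h3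
  exact ⟨f', g * g', by rw [map_mul]; exact mul_ne_zero hg hg', by rw [map_mul, ← mul_assoc, e']⟩

/-- restriction of a derivation to the local ring -/
def locDer {z : I → F} {v : I → K} (E : Derivation K F F) (h : ∀ φ ∈ loc z v, E φ ∈ loc z v) :
    Derivation K (loc z v) (loc z v) :=
  Derivation.mk' ((E : F →ₗ[K] F).restrict (p := Subalgebra.toSubmodule (loc z v)) (q := Subalgebra.toSubmodule (loc z v)) h) (by
    intro a b
    apply Subtype.ext
    exact E.leibniz a.1 b.1)

theorem locDer_apply {z : I → F} {v : I → K} (E : Derivation K F F) (h : ∀ φ ∈ loc z v, E φ ∈ loc z v) (φ : loc z v) :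
    (locDer E h φ : F) = E φ := rfl

end LocDer

namespace Dat
variable {k : ℕ} {S : Set (ι → K)} {F : Type*} [Field F] [Algebra K F] (d : Dat k S F) [CharZero K]

/-- linear data attached to the Gauss map -/
structure LamD where
  N : ℕ
  v : Fin N → d.J → F
  c : Fin k → Fin N → F
  memE : ∀ s l, v s l ∈ d.EG
  xeq : ∀ i (l : d.J), d.x (i, (l : ι)) = ∑ s, c i s * v s l
  orth : ∀ (E : Derivation K F F) s b, ∑ l : d.J, v s l * E (d.G b l) = 0

theorem exists_LamD [Infinite K] : Nonempty d.LamD := by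
  obtain ⟨N, v, c, h1, h2, h3⟩ := d.exists_vs
  exact ⟨⟨N, v, c, h1, h2, h3⟩⟩

variable {d} (L : d.LamD)

/-- full vectors -/
def vt (s : Fin L.N) (b : ι) : F := ∑ l : d.J, d.G b l * L.v s l

theorem vt_mem (s : Fin L.N) (b : ι) : vt L s b ∈ d.EG :=
  sum_mem fun l _ => mul_mem (d.G_mem b l) (L.memE s l)

theorem x_vt [Infinite K] (i : Fin k) (b : ι) : d.x (i, b) = ∑ s, L.c i s * vt L s b := by
  rw [d.x_rel i b]
  simp only [vt, Finset.mul_sum, L.xeq]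
  rw [Finset.sum_comm]
  refine Finset.sum_congr rfl fun s _ => Finset.sum_congr rfl fun l _ => ?_
  ring

/-- derivation along a constant combination -/
def Dw (lam : Fin L.N → K) : Derivation K F F :=
  ∑ l : d.J, (∑ s, algebraMap K F (lam s) * L.v s l) • d.D l

theorem Dw_apply (lam : Fin L.N → K) (φ : F) :
    Dw L lam φ = ∑ l : d.J, (∑ s, algebraMap K F (lam s) * L.v s l) * d.D l φ := der_sum_apply _ _ _ _

theorem Dw_q (lam : Fin L.N → K) (b : ι) : Dw L lam (d.q b) = ∑ s, algebraMap K F (lam s) * vt L s b := by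
  rw [Dw_apply]
  simp only [vt, Finset.mul_sum, Finset.sum_mul]
  rw [Finset.sum_comm]
  refine Finset.sum_congr rfl fun s _ => Finset.sum_congr rfl fun l _ => ?_
  rw [G]; ring

theorem Dw_G (lam : Fin L.N → K) (b : ι) (j : d.J) : Dw L lam (d.G b j) = 0 := by
  rw [Dw_apply]
  simp only [Finset.sum_mul]
  rw [Finset.sum_comm]
  refine Finset.sum_eq_zero fun s _ => ?_
  have := L.orth (d.D j) s b
  have h2 : ∑ l : d.J, algebraMap K F (lam s) * L.v s l * d.D l (d.G b j) =
    algebraMap K F (lam s) * ∑ l : d.J, L.v s l * d.D j (d.G b l) := by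
    rw [Finset.mul_sum]
    refine Finset.sum_congr rfl fun l _ => ?_
    rw [d.G_symm b l j, mul_assoc]
  rw [h2, this, mul_zero]

theorem Dw_EG (lam : Fin L.N → K) {φ : F} (h : φ ∈ d.EG) : Dw L lam φ = 0 := by
  induction h using IntermediateField.adjoin_induction with
  | mem x hx => obtain ⟨p, rfl⟩ := hx; exact Dw_G L lam _ _
  | algebraMap x => simp
  | add x y _ _ h1 h2 => rw [map_add, h1, h2, add_zero]
  | inv x _ h => rw [Derivation.leibniz_inv, h, smul_zero]
  | mul x y _ _ h1 h2 => rw [Derivation.leibniz, h1, h2, smul_zero, smul_zero, add_zero]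

/-- the linear space -/
def Lam (A : Fin k × ι → K) : Submodule K (ι → K) :=
  Submodule.span K (Set.range fun s => fun b => val d.x A (vt L s b))

theorem EG_det {φ : F} (h : φ ∈ d.EG) : ∃ H : (ι → d.J → K) → K, ∀ᶠ A in d.fil, val d.x A φ = H (d.gA A) := by
  unfold EG at h
  rw [IntermediateField.mem_adjoin_range_iff] at h
  obtain ⟨r, s, rfl⟩ := h
  by_cases hs : aeval (fun p : ι × d.J => d.G p.1 p.2) s = 0
  · refine ⟨fun _ => 0, d.ev_sp.mono fun A h => ?_⟩
    rw [hs, div_zero]; simpa using h.val_algebraMap (0 : K)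
  · refine ⟨fun g => eval (fun p : ι × d.J => g p.1 p.2) r / eval (fun p : ι × d.J => g p.1 p.2) s, ?_⟩
    filter_upwards [d.ev_sp, d.ev_G, d.ev_ne hs, 
      d.ev_loc (aeval (fun p : ι × d.J => d.G p.1 p.2) r / aeval (fun p : ι × d.J => d.G p.1 p.2) s)] with A hsp hG h1 h2
    have h3 := fun p => hsp.val_map p (fun p : ι × d.J => d.G p.1 p.2) (fun p => hG _ _)
    rw [(h3 _).2] at h1
    have h4 := hsp.val_mul h2 (h3 s).1
    rw [div_mul_cancel₀ _ hs, (h3 _).2, (h3 _).2] at h4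
    exact (eq_div_iff h1).2 h4.symm

theorem Lam_det : ∃ H : (ι → d.J → K) → Submodule K (ι → K), ∀ᶠ A in d.fil, Lam L A = H (d.gA A) := by
  choose H hH using fun s b => EG_det (vt_mem L s b)
  refine ⟨fun g => Submodule.span K (Set.range fun s => fun b => H s b g), ?_⟩
  filter_upwards [Filter.eventually_all.2 fun s => Filter.eventually_all.2 fun b => hH s b] with A h
  unfold Lam
  simp only [h]

theorem row_mem_Lam [Infinite K] : ∀ᶠ A in d.fil, ∀ i, (fun b => A (i, b)) ∈ Lam L A := by
  have h1 : ∀ᶠ A in d.fil, ∀ i s, L.c i s ∈ loc d.x A :=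
    Filter.eventually_all.2 fun _ => Filter.eventually_all.2 fun _ => d.ev_loc _
  have h2 : ∀ᶠ A in d.fil, ∀ s b, vt L s b ∈ loc d.x A :=
    Filter.eventually_all.2 fun _ => Filter.eventually_all.2 fun _ => d.ev_loc _
  filter_upwards [h1, h2, d.ev_sp] with A h1 h2 hsp i
  have : (fun b => A (i, b)) = ∑ s, val d.x A (L.c i s) • fun b => val d.x A (vt L s b) := by
    funext b
    rw [← hsp.val_var (i, b), x_vt L i b, hsp.val_sum _ _ (fun s _ => mul_mem (h1 _ _) (h2 _ _)), Finset.sum_apply]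
    refine Finset.sum_congr rfl fun s _ => ?_
    rw [hsp.val_mul (h1 _ _) (h2 _ _)]; rfl
  rw [this]
  exact Submodule.sum_mem _ fun s _ => Submodule.smul_mem _ _ (Submodule.subset_span ⟨s, rfl⟩)

theorem exp_lemma [Infinite K] : ∀ᶠ A in d.fil, ∀ μ ∈ Lam L A, ∃ ψ : loc d.x A →ₐ[K] PowerSeries K,
    (∀ φ, PowerSeries.constantCoeff (ψ φ) = val d.x A φ) ∧
    (∀ b, ψ ⟨d.q b, d.q_loc A b⟩ = PowerSeries.C (sumv A b) + PowerSeries.X * PowerSeries.C (μ b)) ∧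
    ∀ b l (h : d.G b l ∈ loc d.x A), ψ ⟨d.G b l, h⟩ = PowerSeries.C (d.gA A b l) := by
  have hD : ∀ᶠ A in d.fil, ∀ l p, d.D l (d.x p) ∈ loc d.x A :=
      Filter.eventually_all.2 fun l => Filter.eventually_all.2 fun _ => d.ev_loc _
  have hv : ∀ᶠ A in d.fil, ∀ s l, L.v s l ∈ loc d.x A :=
      Filter.eventually_all.2 fun l => Filter.eventually_all.2 fun _ => d.ev_loc _
  filter_upwards [hD, hv, d.ev_sp, d.ev_G] with A hD hv hsp hG μ hμ
  have hvt : ∀ s b, vt L s b ∈ loc d.x A := fun s b => sum_mem fun l _ => mul_mem (hG _ _) (hv _ _)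
  obtain ⟨lam, hlam⟩ := (Submodule.mem_span_range_iff_exists_fun K).1 hμ
  have hst : ∀ φ ∈ loc d.x A, Dw L lam φ ∈ loc d.x A := by
    intro φ hφ
    refine loc_stable _ (fun p => ?_) hφ
    rw [Dw_apply]
    exact sum_mem fun l _ => mul_mem (sum_mem fun s _ => mul_mem (Subalgebra.algebraMap_mem _ _) (hv _ _)) (hD _ _)
  refine ⟨expA (locDer (Dw L lam) hst) (ev hsp), ?_, ?_, ?_⟩
  · intro φ
    have := expS_zero_coeff (locDer (Dw L lam) hst) (ev hsp) φ
    rw [ev_apply] at this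
    rw [← this]
    simp [expA]
  · intro b
    have h1 : locDer (Dw L lam) hst (locDer (Dw L lam) hst ⟨d.q b, d.q_loc A b⟩) = 0 := by
      apply Subtype.ext
      rw [locDer_apply, locDer_apply, Dw_q]
      apply Dw_EG
      exact sum_mem fun s _ => mul_mem (IntermediateField.algebraMap_mem _ _) (vt_mem L s b)
    have h2 := expS_of_zero2 (locDer (Dw L lam) hst) (ev hsp) h1
    have h3 : ev hsp (locDer (Dw L lam) hst ⟨d.q b, d.q_loc A b⟩) = μ b := by
      rw [ev_apply, locDer_apply, Dw_q, hsp.val_sum _ _ (fun s _ => mul_mem (Subalgebra.algebraMap_mem _ _) (hvt _ _)),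
        ← hlam, Finset.sum_apply]
      refine Finset.sum_congr rfl fun s _ => ?_
      rw [hsp.val_mul (Subalgebra.algebraMap_mem _ _) (hvt _ _), hsp.val_algebraMap]; rfl
    rw [h3, ev_apply, d.val_q hsp] at h2
    exact h2
  · intro b l h
    exact expS_of_zero (locDer (Dw L lam) hst) (ev hsp) (φ := ⟨d.G b l, h⟩) (Subtype.ext (Dw_G L lam b l))

end Dat

end

section
open MvPolynomial
universe u w
set_option linter.unusedSectionVars false
set_option linter.style.haveILetI false
variable {K : Type*} [Field K] {ι : Type*} [Fintype ι]

namespace Dat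
variable {k : ℕ} {S : Set (ι → K)} {F : Type*} [Field F] [Algebra K F] {d : Dat k S F} [CharZero K]

theorem psi_q {A : Fin k × ι → K} {μ : ι → K} {ψ : loc d.x A →ₐ[K] PowerSeries K}
    (h : ∀ b, ψ ⟨d.q b, d.q_loc A b⟩ = PowerSeries.C (sumv A b) + PowerSeries.X * PowerSeries.C (μ b))
    (f : MvPolynomial ι K) : ψ (aeval (fun b => (⟨d.q b, d.q_loc A b⟩ : loc d.x A)) f) =
      ((linePoly f (sumv A) μ : Polynomial K) : PowerSeries K) := by
  have h1 : (Polynomial.coeToPowerSeries.algHom (R := K) K).comp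
      (aeval (fun j => Polynomial.C (sumv A j) + Polynomial.C (μ j) * Polynomial.X)) =
      ψ.comp (aeval (fun b => (⟨d.q b, d.q_loc A b⟩ : loc d.x A))) := by
    apply MvPolynomial.algHom_ext
    intro b
    simp only [AlgHom.comp_apply, aeval_X, h b]
    simp only [Polynomial.coeToPowerSeries.algHom_apply]
    simp
    rw [mul_comm]
  have h2 := congrArg (fun g => g f) h1
  simp only [AlgHom.comp_apply] at h2
  rw [← h2, Polynomial.coeToPowerSeries.algHom_apply]
  simp [linePoly]

theorem coe_aeval_q (A : Fin k × ι → K) (f : MvPolynomial ι K) :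
    ((aeval (fun b => (⟨d.q b, d.q_loc A b⟩ : loc d.x A)) f : loc d.x A) : F) = aeval d.q f := by
  have := (loc d.x A).val.comp_apply (aeval (fun b => (⟨d.q b, d.q_loc A b⟩ : loc d.x A))) f
  rw [comp_aeval] at this
  exact this.symm

variable (L : d.LamD)

theorem sumv_mem {A : Fin k × ι → K} {M : Submodule K (ι → K)} (h : ∀ i, (fun b => A (i, b)) ∈ M) : sumv A ∈ M := by
  have : sumv A = ∑ i, fun b => A (i, b) := by funext b; simp [sumv]
  rw [this]
  exact sum_mem fun i _ => h i

theorem line_lemma [Infinite K] : ∀ᶠ A in d.fil, ∀ μ ∈ Lam L A, (∀ f : MvPolynomial ι K, aeval d.q f = 0 → eval μ f = 0) ∧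
    ∀ b l, d.gA A b l * eval μ (d.Gd b l) = eval μ (d.Gn b l) := by
  filter_upwards [exp_lemma L, row_mem_Lam L, d.ev_G] with A h hrow hG μ hμ
  obtain ⟨ψ, -, h2, h3⟩ := h (μ - sumv A) (sub_mem hμ (sumv_mem hrow))
  have hq := psi_q h2
  have hl : ∀ f, Polynomial.eval 1 (linePoly f (sumv A) (μ - sumv A)) = eval μ f := by
    intro f
    rw [linePoly_eval, one_smul, add_sub_cancel]
  constructor
  · intro f hf
    have h4 : aeval (fun b => (⟨d.q b, d.q_loc A b⟩ : loc d.x A)) f = 0 :=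
      Subtype.ext ((coe_aeval_q A f).trans hf)
    have h5 := hq f
    rw [h4, map_zero, eq_comm, Polynomial.coe_eq_zero_iff] at h5
    rw [← hl, h5, Polynomial.eval_zero]
  · intro b l
    have h4 : (⟨d.G b l, hG b l⟩ : loc d.x A) * aeval (fun b => (⟨d.q b, d.q_loc A b⟩ : loc d.x A)) (d.Gd b l) =
        aeval (fun b => (⟨d.q b, d.q_loc A b⟩ : loc d.x A)) (d.Gn b l) := by
      apply Subtype.ext
      rw [coe_aeval_q, ← d.G_eq b l, ← coe_aeval_q A]; rfl
    have h5 := congrArg ψ h4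
    rw [map_mul, h3, hq, hq, ← Polynomial.coe_C, ← Polynomial.coe_mul, Polynomial.coe_inj] at h5
    have h6 := congrArg (Polynomial.eval 1) h5
    rwa [Polynomial.eval_mul, Polynomial.eval_C, hl, hl] at h6

/-- the properties of nice points -/
structure Good (H : (ι → d.J → K) → Submodule K (ι → K)) (A : Fin k × ι → K) : Prop where
  mem : A ∈ CK k S
  sup : (⨆ i, Tan S (fun b => A (i, b))) = gr (d.gA A)
  fin : ∀ i, Module.finrank K (Tan S (fun b => A (i, b))) = rho S
  gd : ∀ b l, eval (sumv A) (d.Gd b l) ≠ 0 ∧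
    d.gA A b l * eval (sumv A) (d.Gd b l) = eval (sumv A) (d.Gn b l)
  det : Lam L A = H (d.gA A)
  row : ∀ i, (fun b => A (i, b)) ∈ Lam L A
  ex : ∀ μ ∈ Lam L A, ∃ ψ : loc d.x A →ₐ[K] PowerSeries K,
    (∀ φ, PowerSeries.constantCoeff (ψ φ) = val d.x A φ) ∧
    (∀ b, ψ ⟨d.q b, d.q_loc A b⟩ = PowerSeries.C (sumv A b) + PowerSeries.X * PowerSeries.C (μ b)) ∧
    ∀ b l (h : d.G b l ∈ loc d.x A), ψ ⟨d.G b l, h⟩ = PowerSeries.C (d.gA A b l)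
  gl : ∀ b l, d.G b l ∈ loc d.x A
  line : ∀ μ ∈ Lam L A, (∀ f : MvPolynomial ι K, aeval d.q f = 0 → eval μ f = 0) ∧
    ∀ b l, d.gA A b l * eval μ (d.Gd b l) = eval μ (d.Gn b l)
  rne : ∀ i, (fun b => A (i, b)) ≠ 0

theorem exists_good [Infinite K] (hS : ∃ v ∈ S, v ≠ 0) : ∃ H, ∀ᶠ A in d.fil, Good L H A := by
  obtain ⟨H, hH⟩ := Lam_det L
  refine ⟨H, ?_⟩
  have hr : ∀ᶠ A in d.fil, ∀ i, (fun b => A (i, b)) ≠ 0 := by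
    refine Filter.eventually_all.2 fun i => ?_
    have : ∃ b, d.x (i, b) ≠ 0 := by
      by_contra hc
      push Not at hc
      obtain ⟨v, hv, hv0⟩ := hS
      apply hv0
      funext b
      have := (gen_row d.gen i (X b)).1 (by simp [hc]) v hv
      simpa using this
    obtain ⟨b, hb⟩ := this
    filter_upwards [d.ev_ne hb, d.ev_sp] with A h hsp h0
    rw [hsp.val_var] at h
    exact h (congrFun h0 b)
  filter_upwards [d.ev_mem, d.tan_sup, d.tan_finrank, d.ev_Gd, hH, row_mem_Lam L, exp_lemma L, d.ev_G, line_lemma L, hr] with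
    A h1 h2 h3 h4 h5 h6 h7 h8 h9 h10
  exact ⟨h1, h2, h3, h4, h5, h6, h7, h8, h9, h10⟩

theorem Good.congr {L : d.LamD} {H} {A A' : Fin k × ι → K} (h : Good L H A) (h' : Good L H A') (hs : sumv A' ∈ Lam L A) :
    d.gA A' = d.gA A := by
  funext b l
  have h1 := (h.line _ hs).2 b l
  have h2 := h'.gd b l
  exact mul_right_cancel₀ h2.1 (h2.2.trans h1.symm)

theorem Good.lam_eq {L : d.LamD} {H} {A A' : Fin k × ι → K} (h : Good L H A) (h' : Good L H A') (hs : d.gA A' = d.gA A) :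
    Lam L A' = Lam L A := by rw [h.det, h'.det, hs]

end Dat

end

section
open MvPolynomial
universe u w
set_option linter.unusedSectionVars false
set_option linter.style.haveILetI false
variable {K : Type*} [Field K] {ι : Type*} [Fintype ι]

theorem homog_pderiv_eval {f : MvPolynomial ι K} {n : ℕ} (hf : f.IsHomogeneous n) (i : ι) (v : ι → K) {t : K} :
    eval (t • v) (pderiv i f) = t ^ (n - 1) * eval v (pderiv i f) :=
  homog_eval_smul hf.pderiv v t

/-- it suffices to test on homogeneous elements of the ideal -/
theorem mem_Tan_homog [Infinite K] {X : Set (PP K ι)} {a w : ι → K}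
    (h : ∀ f ∈ homogVanishingIdeal X, ∑ i, w i * eval a (pderiv i f) = 0) : w ∈ Tan (coneOf X) a := by
  intro f hf
  have h1 : ∀ n, homogeneousComponent n f ∈ homogVanishingIdeal X := by
    intro n
    refine ⟨⟨n, homogeneousComponent_isHomogeneous n f⟩, fun x hx v hv => ?_⟩
    apply homog_vanish
    intro t
    exact hf _ (mem_coneOf.2 ⟨x, hx, Submodule.smul_mem _ _ hv⟩)
  rw [← sum_homogeneousComponent f]
  simp only [map_sum, Finset.mul_sum]
  rw [Finset.sum_comm]
  exact Finset.sum_eq_zero fun n _ => h _ (h1 n)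

theorem Tan_homog {X : Set (PP K ι)} {a w : ι → K} (h : w ∈ Tan (coneOf X) a) :
    ∀ f ∈ homogVanishingIdeal X, ∑ i, w i * eval a (pderiv i f) = 0 := by
  intro f hf
  refine h f fun v hv => ?_
  obtain ⟨x, hx, hvx⟩ := mem_coneOf.1 hv
  exact hf.2 x hx v hvx

theorem embT_eq [Infinite K] (X : Set (PP K ι)) (x : PP K ι) :
    embTangentSpace X x = PT (Tan (coneOf X) x.rep) := by
  ext y
  rw [mem_PT]
  exact ⟨fun h => mem_Tan_homog h, fun h => Tan_homog h⟩

theorem Tan_smul_le [Infinite K] (X : Set (PP K ι)) (a : ι → K) {t : K} (ht : t ≠ 0) :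
    Tan (coneOf X) (t • a) ≤ Tan (coneOf X) a := by
  intro w hw
  apply mem_Tan_homog
  intro f hf
  obtain ⟨⟨n, hn⟩, -⟩ := id hf
  have := Tan_homog hw f hf
  simp only [homog_pderiv_eval hn] at this
  have h2 : ∑ i, w i * (t ^ (n - 1) * eval a (pderiv i f)) = t ^ (n-1) * ∑ i, w i * eval a (pderiv i f) := by
    rw [Finset.mul_sum]
    refine Finset.sum_congr rfl fun i _ => ?_
    ring
  rw [h2] at this
  exact (mul_eq_zero.1 this).resolve_left (pow_ne_zero _ ht)

theorem Tan_smul [Infinite K] (X : Set (PP K ι)) (a : ι → K) {t : K} (ht : t ≠ 0) :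
    Tan (coneOf X) (t • a) = Tan (coneOf X) a := by
  apply le_antisymm (Tan_smul_le X a ht)
  have := Tan_smul_le X (t • a) (inv_ne_zero ht)
  rwa [smul_smul, inv_mul_cancel₀ ht, one_smul] at this

theorem Tan_rep [Infinite K] (X : Set (PP K ι)) {x : PP K ι} {a : ι → K} (ha : a ≠ 0) (h : a ∈ x.submodule) :
    Tan (coneOf X) x.rep = Tan (coneOf X) a := by
  obtain ⟨t, rfl⟩ := mem_line_iff.1 h
  have ht : t ≠ 0 := by rintro rfl; simp at ha
  rw [Tan_smul X _ ht]

theorem PT_mono_iff {T T' : Submodule K (ι → K)} : PT T ⊆ PT T' ↔ T ≤ T' := by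
  constructor
  · intro h v hv
    by_cases h0 : v = 0
    · rw [h0]; exact zero_mem _
    · have : Projectivization.mk K v h0 ∈ PT T := by
        intro w hw
        rw [Projectivization.submodule_mk, Submodule.mem_span_singleton] at hw
        obtain ⟨t, rfl⟩ := hw
        exact Submodule.smul_mem _ _ hv
      exact h this (mem_mk_submodule h0)
  · intro h x hx
    exact le_trans hx h

theorem tangentSpan_eq [Infinite K] {k : ℕ} (X : Set (PP K ι)) (u : Fin k → PP K ι) :
    tangentSpan X (Set.range u) = PT (⨆ i, Tan (coneOf X) (u i).rep) := by
  have : vspan (⋃ a ∈ Set.range u, embTangentSpace X a) = ⨆ i, Tan (coneOf X) (u i).rep := by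
    apply le_antisymm
    · refine Submodule.span_le.2 fun v hv => ?_
      obtain ⟨x, hx, hvx⟩ := mem_coneOf.1 hv
      simp only [Set.mem_iUnion, Set.mem_range, exists_prop, exists_exists_eq_and] at hx
      obtain ⟨i, hi⟩ := hx
      rw [embT_eq] at hi
      exact Submodule.mem_iSup_of_mem i (hi hvx)
    · refine iSup_le fun i v hv => ?_
      by_cases h0 : v = 0
      · rw [h0]; exact zero_mem _
      apply Submodule.subset_span
      refine mem_coneOf.2 ⟨Projectivization.mk K v h0, ?_, mem_mk_submodule h0⟩
      simp only [Set.mem_iUnion, Set.mem_range, exists_prop, exists_exists_eq_and]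
      refine ⟨i, ?_⟩
      rw [embT_eq]
      intro w hw
      rw [Projectivization.submodule_mk, Submodule.mem_span_singleton] at hw
      obtain ⟨t, rfl⟩ := hw
      exact Submodule.smul_mem _ _ hv
  unfold tangentSpan projSpan PT
  rw [this]

theorem exists_component {T C : Set (PP K ι)} (hC : IsZIrreducible C) (hCT : C ⊆ T) :
    ∃ C', IsZIrredComponent T C' ∧ C ⊆ C' := by
  obtain ⟨M, hM1, hM2⟩ := zorn_subset_nonempty {D : Set (PP K ι) | IsZIrreducible D ∧ D ⊆ T} (by
    intro c hc hchain hne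
    refine ⟨⋃₀ c, ⟨⟨?_, ?_⟩, ?_⟩, fun s hs => Set.subset_sUnion_of_mem hs⟩
    · obtain ⟨s, hs⟩ := hne
      obtain ⟨x, hx⟩ := (hc hs).1.1
      exact ⟨x, s, hs, hx⟩
    · intro Y Z hY hZ h
      by_contra hcon
      push Not at hcon
      obtain ⟨h1, h2⟩ := hcon
      rw [Set.not_subset] at h1 h2
      obtain ⟨x, ⟨s, hs, hxs⟩, hx⟩ := h1
      obtain ⟨y, ⟨t, ht, hyt⟩, hy⟩ := h2
      have : ∃ r ∈ c, x ∈ r ∧ y ∈ r := by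
        rcases hchain.total hs ht with h' | h'
        · exact ⟨t, ht, h' hxs, hyt⟩
        · exact ⟨s, hs, hxs, h' hyt⟩
      obtain ⟨r, hr, hxr, hyr⟩ := this
      rcases (hc hr).1.2 Y Z hY hZ ((Set.subset_sUnion_of_mem hr).trans h) with h' | h'
      · exact hx (h' hxr)
      · exact hy (h' hyr)
    · exact Set.sUnion_subset fun s hs => (hc hs).2) C ⟨hC, hCT⟩
  refine ⟨M, ⟨hM2.prop.1, hM2.prop.2, fun D hD hDT hMD => ?_⟩, hM1⟩
  exact Set.Subset.antisymm hMD (hM2.le_of_ge ⟨hD, hDT⟩ hMD)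

end

section
open MvPolynomial
universe u w
set_option linter.unusedSectionVars false
set_option linter.style.haveILetI false
variable {K : Type*} [Field K] {ι : Type*} [Fintype ι]

namespace Dat
variable {k : ℕ} {S : Set (ι → K)} {F : Type*} [Field F] [Algebra K F] (d : Dat k S F)

/-- pullback of a polynomial in the J-coordinates -/
def dp (δ : MvPolynomial d.J K) : MvPolynomial (Fin k × ι) K := aeval (fun j : d.J => qp k K (j : ι)) δ

theorem eval_dp (δ : MvPolynomial d.J K) (A : Fin k × ι → K) : eval A (d.dp δ) = d.dv δ (sumv A) := by
  unfold dv dp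
  rw [← aeval_eq_eval, ← aeval_eq_eval]
  show aeval A (aeval _ δ) = aeval _ δ
  rw [← AlgHom.comp_apply, comp_aeval]
  congr 2
  funext j
  exact eval_qp A j

theorem eval_aqp (f : MvPolynomial ι K) (A : Fin k × ι → K) :
    eval A (aeval (qp k K) f) = eval (sumv A) f := by
  rw [← aeval_eq_eval, ← aeval_eq_eval]
  show aeval A (aeval _ f) = aeval _ f
  rw [← AlgHom.comp_apply, comp_aeval]
  congr 2
  funext j
  exact eval_qp A j

theorem aeval_aqp (f : MvPolynomial ι K) : aeval d.x (aeval (qp k K) f) = aeval d.q f := by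
  rw [← AlgHom.comp_apply, comp_aeval]
  congr 2
  funext j
  exact d.aeval_qp j

/-- row polynomial -/
def rowP (f : MvPolynomial ι K) (i : Fin k) (t : K) : MvPolynomial (Fin k × ι) K :=
  aeval (fun b => C t * X (i, b)) f

theorem eval_rowP (f : MvPolynomial ι K) (i : Fin k) (t : K) (B : Fin k × ι → K) :
    eval B (rowP f i t) = eval (t • fun b => B (i, b)) f := by
  unfold rowP
  rw [← aeval_eq_eval, ← aeval_eq_eval]
  show aeval B (aeval _ f) = aeval _ f
  rw [← AlgHom.comp_apply, comp_aeval]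
  congr 2
  funext j
  simp
end Dat

namespace Dat
variable {k : ℕ} {X : Set (PP K ι)} {F : Type*} [Field F] [Algebra K F] {d : Dat k (coneOf X) F} [CharZero K]
  [IsAlgClosed K] {L : d.LamD} {H : (ι → d.J → K) → Submodule K (ι → K)} {n : ℕ}

theorem Good.tspan [Infinite K] {A : Fin k × ι → K} (h : Good L H A) {u : Fin k → PP K ι}
    (hu : ∀ i, (fun b => A (i, b)) ∈ (u i).submodule) : tangentSpan X (Set.range u) = PT (gr (d.gA A)) := by
  rw [tangentSpan_eq, ← h.sup]
  congr 1
  exact iSup_congr fun i => Tan_rep X (h.rne i) (hu i)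

theorem Good.tangency (hn : zdim X = ((n : ℕ∞) : WithBot ℕ∞)) (hr : rho (coneOf X) = n + 1)
    {A A' : Fin k × ι → K} (h : Good L H A) {u : Fin k → PP K ι}
    (hu : ∀ i, (fun b => A (i, b)) ∈ (u i).submodule) (h' : Good L H A') (hg : d.gA A' = d.gA A) (i : Fin k) :
    Projectivization.mk K _ (h'.rne i) ∈ tangencyLocus X (Set.range u) := by
  haveI : Infinite K := IsAlgClosed.instInfinite
  refine ⟨⟨(mem_coneOf_iff _).1 (h'.mem i), ?_⟩, ?_⟩
  · rw [embT_eq, Tan_rep X (h'.rne i) (mem_mk_submodule _), hn]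
    exact zdim_PT (by rw [h'.fin i, hr])
  · rw [h.tspan hu, embT_eq, Tan_rep X (h'.rne i) (mem_mk_submodule _), PT_mono_iff, ← hg, ← h'.sup]
    exact le_iSup (fun i => Tan (coneOf X) (fun b => A' (i, b))) i

theorem contact_le (δ : MvPolynomial d.J K) (hδ : ∀ A ∈ CK k (coneOf X), d.dv δ (sumv A) ≠ 0 → Good L H A)
    {A : Fin k × ι → K} (hA : A ∈ CK k (coneOf X)) (hne : d.dv δ (sumv A) ≠ 0) {u : Fin k → PP K ι}
    (hu : ∀ i, (fun b => A (i, b)) ∈ (u i).submodule) :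
    vspan (contactLocus X (Set.range u)) ≤ Lam L A := by
  classical
  haveI : Infinite K := IsAlgClosed.instInfinite
  have hG := hδ A hA hne
  have key : contactLocus X (Set.range u) ⊆ PT (Lam L A) := by
    apply zclosure_subset (PT_closed _)
    refine Set.iUnion₂_subset fun C hC => ?_
    obtain ⟨⟨hirr, hsub, -⟩, ⟨_, hxC, ⟨i, rfl⟩⟩⟩ := hC
    obtain ⟨f, hf⟩ : ∃ f : MvPolynomial ι K, ∀ w, eval w f = d.dv δ (sumv (upd A i w)) :=
      ⟨slice (d.dp δ) A i, fun w => by rw [slice_eval, eval_dp]⟩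
    have hcov : C ⊆ zeroLocus {f} ∪ PT (Lam L A) := by
      intro x hx
      by_cases hb : x ∈ zeroLocus {f}
      · exact Or.inl hb
      right
      obtain ⟨⟨hxX, -⟩, hxt⟩ := hsub hx
      have : ∃ w ∈ x.submodule, eval w f ≠ 0 := by
        by_contra hc
        push Not at hc
        exact hb (by rintro g rfl v hv; exact hc v hv)
      obtain ⟨w, hw, hwf⟩ := this
      rw [hf] at hwf
      have hG' := hδ _ (upd_mem hA i (mem_coneOf.2 ⟨x, hxX, hw⟩)) hwf
      have hrow : (fun b => upd A i w (i, b)) = w := by funext b; simp [upd]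
      have hw0 : w ≠ 0 := by rw [← hrow]; exact hG'.rne i
      rw [hG.tspan hu, embT_eq, PT_mono_iff, Tan_rep X hw0 hw] at hxt
      have hle : gr (d.gA (upd A i w)) ≤ gr (d.gA A) := by
        rw [← hG'.sup]
        refine iSup_le fun i' => ?_
        by_cases hi : i' = i
        · subst hi; rw [hrow]; exact hxt
        · have : (fun b => upd A i w (i', b)) = fun b => A (i', b) := by funext b; simp [upd, hi]
          rw [this, ← hG.sup]
          exact le_iSup (fun i => Tan (coneOf X) (fun b => A (i, b))) i'
      have hgg := gr_inj (d.gA_J hG'.mem) hle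
      have := hG'.row i
      rw [hG.lam_eq hG' hgg, hrow] at this
      rw [eq_mk_of_mem hw0 hw]
      intro w' hw'
      rw [Projectivization.submodule_mk, Submodule.mem_span_singleton] at hw'
      obtain ⟨t, rfl⟩ := hw'
      exact Submodule.smul_mem _ _ this
    rcases hirr.2 _ _ (zeroLocus_closed _) (PT_closed _) hcov with h | h
    · exfalso
      have := h hxC f rfl _ (hu i)
      rw [hf, upd_self] at this
      exact hne this
    · exact h
  refine Submodule.span_le.2 fun v hv => ?_
  obtain ⟨x, hx, hvx⟩ := mem_coneOf.1 hv
  exact key hx hvx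

theorem le_contact (hn : zdim X = ((n : ℕ∞) : WithBot ℕ∞)) (hr : rho (coneOf X) = n + 1)
    (δ : MvPolynomial d.J K) (hδ : ∀ A ∈ CK k (coneOf X), d.dv δ (sumv A) ≠ 0 → Good L H A)
    {A : Fin k × ι → K} (hA : A ∈ CK k (coneOf X)) (hne : d.dv δ (sumv A) ≠ 0) {u : Fin k → PP K ι}
    (hu : ∀ i, (fun b => A (i, b)) ∈ (u i).submodule) :
    Lam L A ≤ vspan (contactLocus X (Set.range u)) := by
  classical
  haveI : Infinite K := IsAlgClosed.instInfinite
  have hG := hδ A hA hne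
  have hsp := d.sp_iff.2 hA
  intro μ hμ
  by_contra hnot
  obtain ⟨ℓ, hℓ2, hℓ1⟩ := Submodule.exists_le_ker_of_notMem hnot
  obtain ⟨ψ, h1, h2, h3⟩ := hG.ex μ hμ
  let xL : Fin k × ι → loc d.x A := fun p => ⟨d.x p, var_mem_loc _ _ _⟩
  let Θ : MvPolynomial (Fin k × ι) K →ₐ[K] PowerSeries K := ψ.comp (aeval xL)
  have hxL : ∀ f : MvPolynomial (Fin k × ι) K, ((aeval xL f : loc d.x A) : F) = aeval d.x f := by
    intro f
    have := (loc d.x A).val.comp_apply (aeval xL) f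
    rw [comp_aeval] at this
    exact this.symm
  have hconst : ∀ f, PowerSeries.constantCoeff (Θ f) = eval A f := by
    intro f
    show PowerSeries.constantCoeff (ψ (aeval xL f)) = _
    rw [h1, hxL, hsp.val_aeval]
  let P := RingHom.ker Θ
  haveI : P.IsPrime := RingHom.ker_isPrime _
  let Z : Set (Fin k × ι → K) := {B | ∀ f ∈ P, eval B f = 0}
  have hvan : ∀ f, (∀ B ∈ Z, eval B f = 0) → Θ f = 0 := by
    intro f hf
    have h4 := MvPolynomial.IsPrime.vanishingIdeal_zeroLocus (K := K) P
    have h5 : f ∈ MvPolynomial.vanishingIdeal K (MvPolynomial.zeroLocus K P) := by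
      rw [MvPolynomial.mem_vanishingIdeal_iff]
      intro B hB
      rw [MvPolynomial.aeval_eq_eval]
      refine hf B fun g hg => ?_
      have := (MvPolynomial.mem_zeroLocus_iff.1 hB) g hg
      rwa [MvPolynomial.aeval_eq_eval] at this
    rw [h4] at h5
    exact h5
  have hAZ : A ∈ Z := by
    intro f hf
    rw [← hconst, show Θ f = 0 from hf, map_zero]
  have hZC : ∀ B ∈ Z, B ∈ CK k (coneOf X) := by
    intro B hB
    rw [← d.sp_iff]
    intro f hf
    apply hB
    show ψ (aeval xL f) = 0
    rw [show aeval xL f = 0 from Subtype.ext ((hxL f).trans hf), map_zero]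
  obtain ⟨δp, hδp⟩ : ∃ δp, ∀ B, eval B δp = d.dv δ (sumv B) := ⟨d.dp δ, d.eval_dp δ⟩
  have hΘδ : Θ δp ≠ 0 := by
    intro h
    apply hne
    rw [← hδp, ← hconst, h, map_zero]
  -- polynomials in q
  have hqp : ∀ f : MvPolynomial ι K, (∀ B, eval B (aeval (qp k K) f) = eval (sumv B) f) ∧
      Θ (aeval (qp k K) f) = ((linePoly f (sumv A) μ : Polynomial K) : PowerSeries K) := by
    intro f
    constructor
    · exact eval_aqp f
    · rw [← psi_q h2]
      show ψ (aeval xL (aeval _ f)) = _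
      congr 1
      apply Subtype.ext
      rw [hxL, coe_aeval_q, aeval_aqp]
  have hgZ : ∀ B ∈ Z, ∀ hB : Good L H B, d.gA B = d.gA A := by
    intro B hBZ hB
    funext b l
    have h4 : C (d.gA A b l) * aeval (qp k K) (d.Gd b l) - aeval (qp k K) (d.Gn b l) ∈ P := by
      show Θ _ = 0
      rw [map_sub, map_mul, (hqp _).2, (hqp _).2, sub_eq_zero, ← algebraMap_eq, AlgHom.commutes]
      have h5 := h3 b l (hG.gl b l)
      have h6 : (⟨d.G b l, hG.gl b l⟩ : loc d.x A) * aeval (fun b => (⟨d.q b, d.q_loc A b⟩ : loc d.x A)) (d.Gd b l) =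
        aeval (fun b => (⟨d.q b, d.q_loc A b⟩ : loc d.x A)) (d.Gn b l) := by
        apply Subtype.ext
        rw [coe_aeval_q, ← d.G_eq b l, ← coe_aeval_q A]; rfl
      have h7 := congrArg ψ h6
      rw [map_mul, h5, psi_q h2, psi_q h2] at h7
      exact h7
    have h8 := hBZ _ h4
    rw [map_sub, map_mul, eval_C, (hqp _).1, (hqp _).1, sub_eq_zero] at h8
    have h9 := hB.gd b l
    exact mul_right_cancel₀ h9.1 (h9.2.trans h8.symm)
  -- rows
  have hrow : ∀ i, ∀ B ∈ Z, d.dv δ (sumv B) ≠ 0 → ℓ (fun b => B (i, b)) = 0 := by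
    intro i
    let Ci : Set (PP K ι) := {x | ∃ B ∈ Z, d.dv δ (sumv B) ≠ 0 ∧ (fun b => B (i, b)) ∈ x.submodule}
    have hCi : Ci ⊆ tangencyLocus X (Set.range u) := by
      rintro x ⟨B, hB, hBδ, hx⟩
      have hBG := hδ B (hZC B hB) hBδ
      rw [eq_mk_of_mem (hBG.rne i) hx]
      exact hG.tangency hn hr hu hBG (hgZ B hB hBG) i
    have hui : u i ∈ Ci := ⟨A, hAZ, hne, hu i⟩
    have hirr : IsZIrreducible Ci := by
      refine ⟨⟨_, hui⟩, ?_⟩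
      rintro Y Y' ⟨s, -, rfl⟩ ⟨s', -, rfl⟩ hcov
      by_contra hcon
      push Not at hcon
      obtain ⟨h4, h5⟩ := hcon
      have aux : ∀ s : Set (MvPolynomial ι K), ¬ Ci ⊆ zeroLocus s → ∃ f ∈ s, ∃ B ∈ Z, d.dv δ (sumv B) ≠ 0 ∧ ∃ t : K,
          eval (t • fun b => B (i, b)) f ≠ 0 := by
        intro s hs
        rw [Set.not_subset] at hs
        obtain ⟨x, ⟨B, hB, hBδ, hx⟩, hxs⟩ := hs
        by_contra hc
        push Not at hc
        apply hxs
        intro f hf v hv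
        have hBG := hδ B (hZC B hB) hBδ
        rw [eq_mk_of_mem (hBG.rne i) hx, Projectivization.submodule_mk, Submodule.mem_span_singleton] at hv
        obtain ⟨t, rfl⟩ := hv
        exact hc f hf B hB hBδ t
      obtain ⟨f, hf, B, hB, hBδ, t, ht⟩ := aux s h4
      obtain ⟨f', hf', B', hB', hBδ', t', ht'⟩ := aux s' h5
      have h6 : Θ (rowP f i t) ≠ 0 := by
        intro h
        exact ht (by rw [← eval_rowP]; exact hB _ h)
      have h7 : Θ (rowP f' i t') ≠ 0 := by
        intro h
        exact ht' (by rw [← eval_rowP]; exact hB' _ h)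
      apply mul_ne_zero (mul_ne_zero h6 h7) hΘδ
      rw [← map_mul, ← map_mul]
      apply hvan
      intro B hB
      rw [map_mul, map_mul, eval_rowP, eval_rowP, hδp]
      by_cases hBδ : d.dv δ (sumv B) = 0
      · rw [hBδ, mul_zero]
      have hBG := hδ B (hZC B hB) hBδ
      have hmk := mem_mk_submodule (hBG.rne i)
      rcases hcov ⟨B, hB, hBδ, hmk⟩ with h | h
      · rw [h f hf _ (Submodule.smul_mem _ _ hmk), zero_mul, zero_mul]
      · rw [h f' hf' _ (Submodule.smul_mem _ _ hmk), mul_zero, zero_mul]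
    obtain ⟨C', hC', hsub⟩ := exists_component hirr hCi
    intro B hB hBδ
    have hBG := hδ B (hZC B hB) hBδ
    have hmk := mem_mk_submodule (hBG.rne i)
    apply hℓ1
    apply Submodule.subset_span
    refine mem_coneOf.2 ⟨_, ?_, hmk⟩
    apply subset_zclosure
    exact Set.mem_biUnion (show C' ∈ {C | IsZIrredComponent (tangencyLocus X (Set.range u)) C ∧ (C ∩ Set.range u).Nonempty} from
      ⟨hC', ⟨u i, hsub hui, ⟨i, rfl⟩⟩⟩) (hsub ⟨B, hB, hBδ, hmk⟩)
  have hfin : Θ (aeval (qp k K) (linP ℓ) * δp) = 0 := by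
    apply hvan
    intro B hB
    rw [map_mul, hδp, (hqp _).1, linP_eval]
    by_cases hBδ : d.dv δ (sumv B) = 0
    · rw [hBδ, mul_zero]
    have : sumv B ∈ LinearMap.ker ℓ := sumv_mem fun i => hrow i B hB hBδ
    rw [LinearMap.mem_ker.1 this, zero_mul]
  rw [map_mul, (hqp _).2] at hfin
  have h10 := (mul_eq_zero.1 hfin).resolve_right hΘδ
  rw [Polynomial.coe_eq_zero_iff] at h10
  have e0 := congrArg (Polynomial.eval 0) h10
  have e1 := congrArg (Polynomial.eval 1) h10
  rw [linePoly_eval, linP_eval, Polynomial.eval_zero] at e0 e1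
  rw [zero_smul, add_zero] at e0
  rw [one_smul, map_add, e0, zero_add] at e1
  exact hℓ2 e1

end Dat

end

section
open MvPolynomial
universe u w
set_option linter.unusedSectionVars false
set_option linter.style.haveILetI false
variable {K : Type*} [Field K] {ι : Type*} [Fintype ι]

namespace Dat
variable {k : ℕ} {S : Set (ι → K)} {F : Type*} [Field F] [Algebra K F] (d : Dat k S F)

/-- the field generated by the generic sum -/
def QF : IntermediateField K F := IntermediateField.adjoin K (Set.range d.q)

theorem q_mem_QF (b : ι) : d.q b ∈ d.QF := IntermediateField.subset_adjoin _ _ ⟨b, rfl⟩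

theorem aeval_q_mem_QF (f : MvPolynomial ι K) : aeval d.q f ∈ d.QF := by
  have : aeval d.q f ∈ Algebra.adjoin K (Set.range d.q) := by
    rw [Algebra.adjoin_range_eq_range_aeval]; exact ⟨f, rfl⟩
  exact IntermediateField.algebra_adjoin_le_adjoin K _ this

theorem loc_le_QF {v : ι → K} (hv : Sp d.q v) {φ : F} (h : φ ∈ loc d.q v) : φ ∈ d.QF := by
  obtain ⟨f, g, hg, e⟩ := h
  have h0 := hv.ne hg
  rw [← eq_div_iff h0] at e
  rw [e]
  exact div_mem (d.aeval_q_mem_QF f) (d.aeval_q_mem_QF g)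

/-- the filter of generic sums -/
def filQ : Filter (ι → K) where
  sets := {s | ∃ δ : MvPolynomial d.J K, δ ≠ 0 ∧ ∀ v, Sp d.q v → d.dv δ v ≠ 0 → v ∈ s}
  univ_sets := ⟨1, one_ne_zero, by simp⟩
  sets_of_superset := by
    rintro s t ⟨δ, h, h'⟩ hst
    exact ⟨δ, h, fun A hA h1 => hst (h' A hA h1)⟩
  inter_sets := by
    rintro s t ⟨δ, h, h'⟩ ⟨ε, g, g'⟩
    refine ⟨δ * ε, mul_ne_zero h g, fun A hA h1 => ?_⟩
    unfold dv at h1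
    rw [map_mul] at h1
    exact ⟨h' A hA (left_ne_zero_of_mul h1), g' A hA (right_ne_zero_of_mul h1)⟩

theorem evQ_sp : ∀ᶠ v in d.filQ, Sp d.q v := ⟨1, one_ne_zero, fun _ h _ => h⟩

theorem evQ_dv {δ : MvPolynomial d.J K} (h : δ ≠ 0) : ∀ᶠ v in d.filQ, d.dv δ v ≠ 0 := ⟨δ, h, fun _ _ h => h⟩

theorem evQ_loc {φ : F} (hφ : φ ∈ d.QF) : ∀ᶠ v in d.filQ, φ ∈ loc d.q v := by
  obtain ⟨r, s, e⟩ := (IntermediateField.mem_adjoin_range_iff K d.q φ).1 hφ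
  by_cases hs : aeval d.q s = 0
  · rw [hs, div_zero] at e
    rw [e]
    exact Filter.Eventually.of_forall fun v => zero_mem _
  obtain ⟨c, hc, h, hh, e'⟩ := norm0 (K := K) (F := F) (y := fun j : d.J => ∑ i, d.x (i, (j : ι)))
    (aeval d.q).range
    (fun j => ⟨X (j : ι), by simp [q]⟩) ⟨s, rfl⟩ hs (d.alg _)
  obtain ⟨h', rfl⟩ := hh
  refine ⟨c, hc, fun v hv hcv => ⟨r, s, ?_, ?_⟩⟩
  · intro h0
    apply hcv
    have h1 : aeval d.q (rename (fun j : d.J => (j : ι)) c) = aeval d.q (s * h') := by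
      rw [aeval_rename, map_mul]; exact e'
    have h2 := hv.eq h1
    rw [map_mul, h0, zero_mul, eval_rename] at h2
    exact h2
  · rw [e, div_mul_cancel₀ _ hs]

theorem sp_q_of {A : Fin k × ι → K} (h : Sp d.x A) : Sp d.q (sumv A) := by
  intro f hf
  rw [← aeval_aqp] at hf
  rw [← eval_aqp]
  exact h _ hf

theorem loc_q_x {A : Fin k × ι → K} (h : Sp d.x A) {φ : F} (hφ : φ ∈ loc d.q (sumv A)) :
    φ ∈ loc d.x A ∧ val d.x A φ = val d.q (sumv A) φ := by
  obtain ⟨f, g, hg, e⟩ := hφ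
  have hg' : eval A (aeval (qp k K) g) ≠ 0 := by rwa [eval_aqp]
  have e' : φ * aeval d.x (aeval (qp k K) g) = aeval d.x (aeval (qp k K) f) := by
    rw [aeval_aqp, aeval_aqp, e]
  refine ⟨⟨_, _, hg', e'⟩, ?_⟩
  rw [h.val_eq hg' e', (d.sp_q_of h).val_eq hg e, eval_aqp, eval_aqp]

theorem exists_theta [CharZero K] : ∃ (θ : F) (μ : Polynomial F), μ.Monic ∧ 0 < μ.natDegree ∧ (∀ m, μ.coeff m ∈ d.QF) ∧
    μ.eval θ = 0 ∧ μ.derivative.eval θ ≠ 0 ∧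
    (∀ r : Polynomial F, (∀ m, r.coeff m ∈ d.QF) → r.degree < μ.degree → r.eval θ = 0 → r = 0) ∧
    ∀ φ, ∃ p : Polynomial F, (∀ m, p.coeff m ∈ d.QF) ∧ p.eval θ = φ := by
  haveI : CharZero F := charZero_of_injective_algebraMap (algebraMap K F).injective
  haveI : CharZero d.QF := charZero_of_injective_algebraMap (algebraMap K d.QF).injective
  have hint : ∀ φ : F, IsIntegral d.QF φ := by
    intro φ
    rw [← isAlgebraic_iff_isIntegral]
    obtain ⟨p, hp, h⟩ := d.alg φ
    have hle : Algebra.adjoin K (Set.range fun j : d.J => ∑ i, d.x (i, (j : ι))) ≤ d.QF.toSubalgebra := by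
      rw [Algebra.adjoin_le_iff]
      rintro _ ⟨j, rfl⟩
      exact d.q_mem_QF j
    refine ⟨p.map (Subalgebra.inclusion hle).toRingHom, ?_, ?_⟩
    · rwa [Ne, Polynomial.map_eq_zero_iff (Subalgebra.inclusion_injective hle)]
    · rw [Polynomial.aeval_def, Polynomial.eval₂_map]
      exact h
  haveI : FiniteDimensional d.QF F := by
    have h1 := IntermediateField.finiteDimensional_adjoin (K := d.QF) (S := Set.range d.x) (fun x _ => hint x)
    have h2 : IntermediateField.adjoin d.QF (Set.range d.x) = ⊤ := by
      rw [eq_top_iff]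
      intro φ _
      obtain ⟨f, g, hg, e⟩ := d.frac φ
      rw [← eq_div_iff hg] at e
      rw [e]
      have : ∀ f : MvPolynomial (Fin k × ι) K, aeval d.x f ∈ IntermediateField.adjoin d.QF (Set.range d.x) := by
        intro f
        induction f using MvPolynomial.induction_on with
        | C a =>
          rw [aeval_C]
          exact IntermediateField.algebraMap_mem (IntermediateField.adjoin d.QF (Set.range d.x)) (algebraMap K d.QF a)
        | add p q hp hq => rw [map_add]; exact add_mem hp hq
        | mul_X p i hp =>
          rw [map_mul, aeval_X]
          exact mul_mem hp (IntermediateField.subset_adjoin _ _ ⟨i, rfl⟩)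
      exact div_mem (this f) (this g)
    rw [h2] at h1
    exact IntermediateField.topEquiv.toLinearEquiv.finiteDimensional
  obtain ⟨θ, hθ⟩ := Field.exists_primitive_element d.QF F
  have hi := hint θ
  have hco : ∀ p : Polynomial d.QF, ∀ m, (p.map (algebraMap d.QF F)).coeff m ∈ d.QF := by
    intro p m
    rw [Polynomial.coeff_map]; exact (p.coeff m).2
  refine ⟨θ, (minpoly d.QF θ).map (algebraMap d.QF F), (minpoly.monic hi).map _, ?_, hco _, ?_, ?_, ?_, ?_⟩
  · rw [Polynomial.natDegree_map]; exact minpoly.natDegree_pos hi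
  · rw [Polynomial.eval_map, ← Polynomial.aeval_def, minpoly.aeval]
  · rw [Polynomial.derivative_map, Polynomial.eval_map, ← Polynomial.aeval_def]
    exact (minpoly.irreducible hi).separable.aeval_derivative_ne_zero (minpoly.aeval _ _)
  · intro r hr hdeg h0
    obtain ⟨r', rfl⟩ : ∃ r' : Polynomial d.QF, r'.map (algebraMap d.QF F) = r := by
      have := (Polynomial.lifts_iff_coeff_lifts (f := algebraMap d.QF F) r).2 (fun m => ⟨⟨_, hr m⟩, rfl⟩)
      rwa [Polynomial.mem_lifts] at this
    rw [Polynomial.degree_map, Polynomial.degree_map] at hdeg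
    by_contra hne
    have h1 : r' ≠ 0 := by rintro rfl; simp at hne
    rw [Polynomial.eval_map, ← Polynomial.aeval_def] at h0
    exact absurd hdeg (not_lt.2 (minpoly.degree_le_of_ne_zero d.QF θ h1 h0))
  · intro φ
    have : φ ∈ IntermediateField.adjoin d.QF {θ} := by rw [hθ]; trivial
    rw [← IntermediateField.mem_toSubalgebra, IntermediateField.adjoin_simple_toSubalgebra_of_isAlgebraic hi.isAlgebraic,
      Algebra.adjoin_singleton_eq_range_aeval] at this
    obtain ⟨p, hp⟩ := this
    refine ⟨p.map (algebraMap d.QF F), hco _, ?_⟩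
    rw [Polynomial.eval_map, ← Polynomial.aeval_def]; exact hp

end Dat

end

section
open MvPolynomial
universe u w
set_option linter.unusedSectionVars false
set_option linter.style.haveILetI false
variable {K : Type*} [Field K] {ι : Type*} [Fintype ι]

namespace Dat
variable {k : ℕ} {S : Set (ι → K)} {F : Type*} [Field F] [Algebra K F] (d : Dat k S F)

theorem evQ_lift (p : Polynomial F) (hp : ∀ m, p.coeff m ∈ d.QF) :
    ∀ᶠ v in d.filQ, p ∈ Polynomial.lifts (algebraMap (loc d.q v) F) := by
  have : ∀ᶠ v in d.filQ, ∀ m ∈ p.support, p.coeff m ∈ loc d.q v :=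
    (Filter.eventually_all_finset _).2 fun m _ => d.evQ_loc (hp m)
  filter_upwards [this] with v hv
  rw [Polynomial.lifts_iff_coeff_lifts]
  intro m
  by_cases hm : m ∈ p.support
  · exact ⟨⟨_, hv m hm⟩, rfl⟩
  · rw [Polynomial.notMem_support_iff.1 hm]; exact ⟨0, map_zero _⟩

theorem count [CharZero K] [IsAlgClosed K] : ∃ N : ℕ, 0 < N ∧
    ∀ᶠ v in d.filQ, {A | A ∈ CK k S ∧ sumv A = v}.ncard = N := by
  classical
  obtain ⟨θ, μ, hmon, hpos, hμQ, hμθ, hμ', hmin, hall⟩ := d.exists_theta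
  choose P hPQ hP using hall
  obtain ⟨δ, hδ, hδl⟩ := d.nice1 θ
  refine ⟨μ.natDegree, hpos, ?_⟩
  filter_upwards [d.evQ_sp, d.evQ_dv hδ, d.evQ_lift μ hμQ, d.evQ_lift (P (μ.derivative.eval θ)⁻¹) (hPQ _),
    Filter.eventually_all.2 fun p : Fin k × ι => d.evQ_lift (P (d.x p)) (hPQ _)] with v hv hvδ hl1 hl2 hl3
  obtain ⟨μ', hmap, hnd, hmon'⟩ := Polynomial.lifts_and_natDegree_eq_and_monic hl1 hmon
  obtain ⟨w, hw⟩ := (Polynomial.mem_lifts _).1 hl2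
  choose px hpx using fun p => (Polynomial.mem_lifts _).1 (hl3 p)
  have hinj : Function.Injective (algebraMap (loc d.q v) F) := Subtype.val_injective
  let ε : loc d.q v →+* K := (ev hv).toRingHom
  have hε : ∀ φ, ε φ = val d.q v φ := fun φ => rfl
  let Ev : Polynomial (loc d.q v) →ₐ[K] F := (Polynomial.aeval θ).restrictScalars K
  have hEv : ∀ p, Ev p = (p.map (algebraMap (loc d.q v) F)).eval θ := fun p => by
    rw [Polynomial.eval_map]; rfl
  let χ : K → Polynomial (loc d.q v) →+* K := fun τ => Polynomial.eval₂RingHom ε τ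
  have hχ : ∀ τ p, χ τ p = (p.map ε).eval τ := fun τ p => by rw [Polynomial.eval_map]; rfl
  have principle : ∀ τ, (μ'.map ε).eval τ = 0 → ∀ h, Ev h = 0 → χ τ h = 0 := by
    intro τ hτ h hh
    have h1 := Polynomial.modByMonic_add_div h μ'
    have hE : Ev μ' = 0 := by rw [hEv, hmap, hμθ]
    have h2 : Ev (h %ₘ μ') = 0 := by
      have := congrArg Ev h1
      rwa [map_add, map_mul, hE, zero_mul, add_zero, hh] at this
    have h3 : (h %ₘ μ').map (algebraMap (loc d.q v) F) = 0 := by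
      apply hmin
      · intro m
        rw [Polynomial.coeff_map]
        exact d.loc_le_QF hv (Subtype.property _)
      · rw [← hmap, Polynomial.degree_map_eq_of_injective hinj, Polynomial.degree_map_eq_of_injective hinj]
        exact Polynomial.degree_modByMonic_lt _ hmon'
      · rw [← hEv, h2]
    rw [Polynomial.map_eq_zero_iff hinj] at h3
    rw [h3, zero_add] at h1
    rw [← h1, map_mul, hχ, hτ, zero_mul]
  -- the points attached to the roots
  let pt : K → Fin k × ι → K := fun τ p => χ τ (px p)
  have hEpx : ∀ p, Ev (px p) = d.x p := fun p => by rw [hEv, hpx, hP]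
  have hEC : ∀ φ : loc d.q v, Ev (Polynomial.C φ) = φ := fun φ => by
    rw [hEv, Polynomial.map_C, Polynomial.eval_C]; rfl
  have hχC : ∀ τ φ, χ τ (Polynomial.C φ) = val d.q v φ := fun τ φ => by
    rw [hχ, Polynomial.map_C, Polynomial.eval_C]; rfl
  have hχK : ∀ τ (c : K), χ τ (algebraMap K _ c) = c := fun τ c => by
    rw [Polynomial.algebraMap_apply, hχC]
    exact hv.val_algebraMap c
  have hχa : ∀ τ (f : MvPolynomial (Fin k × ι) K), χ τ (aeval px f) = eval (pt τ) f := by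
    intro τ f
    induction f using MvPolynomial.induction_on with
    | C a => rw [aeval_C, hχK, eval_C]
    | add p q hp hq => rw [map_add, map_add, map_add, hp, hq]
    | mul_X p i hp => rw [map_mul, map_mul, map_mul, hp, aeval_X, eval_X]
  have hEa : ∀ f : MvPolynomial (Fin k × ι) K, Ev (aeval px f) = aeval d.x f := by
    intro f
    rw [← AlgHom.comp_apply, comp_aeval]
    congr 2
    funext p
    exact hEpx p
  have hpt : ∀ τ, (μ'.map ε).eval τ = 0 → Sp d.x (pt τ) ∧ sumv (pt τ) = v := by
    intro τ hτ
    constructor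
    · intro f hf
      rw [← hχa]
      exact principle τ hτ _ (by rw [hEa, hf])
    · funext b
      have h1 : Ev (∑ i, px (i, b) - Polynomial.C ⟨d.q b, var_mem_loc _ _ _⟩) = 0 := by
        rw [map_sub, map_sum, hEC, sub_eq_zero]
        exact Finset.sum_congr rfl fun i _ => hEpx _
      have h2 := principle τ hτ _ h1
      rw [map_sub, map_sum, hχC, sub_eq_zero] at h2
      rw [hv.val_var] at h2
      exact h2
  have hval : ∀ A, Sp d.x A → sumv A = v → θ ∈ loc d.x A ∧ ∀ h, Ev h ∈ loc d.x A ∧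
      val d.x A (Ev h) = χ (val d.x A θ) h := by
    rintro A hA rfl
    have hθ := hδl A hvδ
    refine ⟨hθ, fun h => ?_⟩
    have hEX : Ev Polynomial.X = θ := by rw [hEv, Polynomial.map_X, Polynomial.eval_X]
    induction h using Polynomial.induction_on with
    | C a =>
      rw [hEC, hχC]
      exact d.loc_q_x hA a.2
    | add p q hp hq =>
      rw [map_add, map_add, hA.val_add hp.1 hq.1, hp.2, hq.2]
      exact ⟨add_mem hp.1 hq.1, rfl⟩
    | monomial n a h =>
      rw [pow_succ, ← mul_assoc]
      generalize Polynomial.C a * Polynomial.X ^ n = p at h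
      rw [map_mul, map_mul, hEX, hA.val_mul h.1 hθ, h.2, hχ _ Polynomial.X, Polynomial.map_X,
        Polynomial.eval_X]
      exact ⟨mul_mem h.1 hθ, rfl⟩
  have hset : {A | A ∈ CK k S ∧ sumv A = v} = pt '' ↑((μ'.map ε).roots.toFinset) := by
    have hm0 : μ'.map ε ≠ 0 := (hmon'.map ε).ne_zero
    ext A
    constructor
    · rintro ⟨hA, hs⟩
      have hA' := d.sp_iff.2 hA
      obtain ⟨h1, h2⟩ := hval A hA' hs
      refine ⟨val d.x A θ, ?_, ?_⟩
      · rw [Finset.mem_coe, Multiset.mem_toFinset, Polynomial.mem_roots hm0, Polynomial.IsRoot, ← hχ, ← (h2 _).2, hEv, hmap, hμθ]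
        simpa using hA'.val_algebraMap 0
      · funext p
        show χ _ (px p) = _
        rw [← (h2 _).2, hEpx, hA'.val_var]
    · rintro ⟨τ, hτ, rfl⟩
      rw [Finset.mem_coe, Multiset.mem_toFinset, Polynomial.mem_roots hm0, Polynomial.IsRoot] at hτ
      obtain ⟨h1, h2⟩ := hpt τ hτ
      exact ⟨d.sp_iff.1 h1, h2⟩
  have hinjO : Set.InjOn pt ↑((μ'.map ε).roots.toFinset) := by
    have hm0 : μ'.map ε ≠ 0 := (hmon'.map ε).ne_zero
    have key : ∀ τ, (μ'.map ε).eval τ = 0 → val d.x (pt τ) θ = τ := by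
      intro τ hτ
      obtain ⟨h1, h2⟩ := hpt τ hτ
      obtain ⟨f, g, hg, e⟩ := (hval _ h1 h2).1
      rw [h1.val_eq hg e, div_eq_iff hg, ← hχa, ← hχa, eq_comm]
      have hX : χ τ Polynomial.X = τ := by rw [hχ, Polynomial.map_X, Polynomial.eval_X]
      have h3 : Ev (Polynomial.X * aeval px g - aeval px f) = 0 := by
        rw [map_sub, map_mul, hEa, hEa, hEv, Polynomial.map_X, Polynomial.eval_X, e, sub_self]
      have := principle τ hτ _ h3
      rwa [map_sub, map_mul, hX, sub_eq_zero] at this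
    intro τ hτ τ' hτ' he
    rw [Finset.mem_coe, Multiset.mem_toFinset, Polynomial.mem_roots hm0, Polynomial.IsRoot] at hτ hτ'
    rw [← key τ hτ, ← key τ' hτ', he]
  have hnodup : (μ'.map ε).roots.Nodup := by
    have hm0 : μ'.map ε ≠ 0 := (hmon'.map ε).ne_zero
    rw [Multiset.nodup_iff_count_le_one]
    intro τ
    rw [Polynomial.count_roots]
    by_contra hc
    rw [not_le, Polynomial.one_lt_rootMultiplicity_iff_isRoot hm0] at hc
    obtain ⟨h1, h2⟩ := hc
    have h3 : Ev (μ'.derivative * w - 1) = 0 := by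
      rw [map_sub, map_mul, map_one, hEv, hEv, hw, hP, ← Polynomial.derivative_map, hmap, mul_inv_cancel₀ hμ', sub_self]
    have h4 := principle τ h1 _ h3
    rw [map_sub, map_mul, map_one, hχ, ← Polynomial.derivative_map, h2, zero_mul] at h4
    simp at h4
  rw [hset, hinjO.ncard_image, Set.ncard_coe_finset, Multiset.toFinset_card_of_nodup hnodup,
    ← (IsAlgClosed.splits _).natDegree_eq_card_roots, hmon'.natDegree_map, hnd]

end Dat

end

section
open MvPolynomial
universe u w
set_option linter.unusedSectionVars false
set_option linter.style.haveILetI false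
variable {K : Type*} [Field K] {ι : Type*} [Fintype ι] {k : ℕ}

/-- the tuples with given sum -/
def Fib (k : ℕ) (X : Set (PP K ι)) (v : ι → K) : Set (Fin k × ι → K) :=
  {A | A ∈ CK k (coneOf X) ∧ sumv A = v}

theorem sumv_mem0 {M : Submodule K (ι → K)} {A : Fin k × ι → K} (h : ∀ i, (fun b => A (i, b)) ∈ M) : sumv A ∈ M := by
  have : sumv A = ∑ i, fun b => A (i, b) := by funext b; simp [sumv]
  rw [this]
  exact Submodule.sum_mem _ fun i _ => h i

theorem Fib_indep [Infinite K] {X : Set (PP K ι)} {v : ι → K} (hf : (Fib k X v).Finite)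
    (hr : ∀ A ∈ Fib k X v, ∀ i, (fun b => A (i, b)) ≠ 0) {A : Fin k × ι → K} (hA : A ∈ Fib k X v)
    {c : Fin k → K} (hc : ∑ i, c i • (fun b => A (i, b)) = 0) : c = 0 := by
  by_contra h
  obtain ⟨i, hi⟩ := Function.ne_iff.1 h
  let Φ : K → Fin k × ι → K := fun t p => (1 + t * c p.1) * A p
  have hΦ : ∀ t, Φ t ∈ Fib k X v := by
    intro t
    refine ⟨fun j => coneOf_smul (hA.1 j) (1 + t * c j), ?_⟩
    rw [← hA.2]
    funext b
    have h1 := congrFun hc b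
    simp only [Finset.sum_apply, Pi.smul_apply, smul_eq_mul, Pi.zero_apply] at h1
    show ∑ j, (1 + t * c j) * A (j, b) = ∑ j, A (j, b)
    have : ∀ j, (1 + t * c j) * A (j, b) = A (j, b) + t * (c j * A (j, b)) := fun j => by ring
    simp only [this, Finset.sum_add_distrib, ← Finset.mul_sum, h1, mul_zero, add_zero]
  have hinj : Function.Injective Φ := by
    intro t t' ht
    obtain ⟨b, hb⟩ := Function.ne_iff.1 (hr A hA i)
    have h1 := congrFun ht (i, b)
    simp only [Φ] at h1
    have h2 := mul_right_cancel₀ hb h1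
    exact mul_right_cancel₀ hi (add_left_cancel h2)
  exact Set.infinite_range_of_injective hinj (hf.subset (by rintro _ ⟨t, rfl⟩; exact hΦ t))

theorem Fib_ne [Infinite K] {X : Set (PP K ι)} {v : ι → K} (hk : 1 ≤ k) (hf : (Fib k X v).Finite)
    (hr : ∀ A ∈ Fib k X v, ∀ i, (fun b => A (i, b)) ≠ 0) (hne : (Fib k X v).Nonempty) : v ≠ 0 := by
  rintro rfl
  obtain ⟨A, hA⟩ := hne
  have := Fib_indep hf hr hA (c := fun _ => 1) (by
    rw [← hA.2]; funext b; simp [sumv])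
  exact one_ne_zero (congrFun this ⟨0, hk⟩)

theorem pad {X : Set (PP K ι)} (hX : X.Nonempty) {m : ℕ} (hm : m < k) {A : Fin m × ι → K}
    (hA : A ∈ CK m (coneOf X)) : ∃ B ∈ CK k (coneOf X), sumv B = sumv A ∧ ∃ i, (fun b => B (i, b)) = 0 := by
  obtain ⟨e, rfl⟩ := Nat.exists_eq_add_of_lt hm
  rw [add_assoc]
  let B : Fin (m + (e + 1)) × ι → K := fun p => Fin.addCases (fun i => A (i, p.2)) (fun _ => 0) p.1
  refine ⟨B, ?_, ?_, Fin.natAdd m 0, ?_⟩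
  · intro i
    refine Fin.addCases (fun j => ?_) (fun j => ?_) i
    · simpa [B] using hA j
    · obtain ⟨x, hx⟩ := hX
      have : (fun b => B (Fin.natAdd m j, b)) = 0 := by funext b; simp [B]
      rw [this]
      exact mem_coneOf.2 ⟨x, hx, Submodule.zero_mem _⟩
  · funext b
    simp [sumv, B, Fin.sum_univ_add]
  · funext b; simp only [B, Fin.addCases_right]; rfl

theorem decs_count [Infinite K] {X : Set (PP K ι)} {v : ι → K} (hv : v ≠ 0) (hf : (Fib k X v).Finite)
    (hr : ∀ A ∈ Fib k X v, ∀ i, (fun b => A (i, b)) ≠ 0) (hne : (Fib k X v).Nonempty) :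
    Projectivization.mk K v hv ∈ secant k X ∧
    (Fib k X v).ncard = (decompositions X (Projectivization.mk K v hv)).ncard * k.factorial := by
  classical
  set q := Projectivization.mk K v hv with hq
  have hqs : ∀ {S : Finset (PP K ι)}, q ∈ projSpan (S : Set (PP K ι)) ↔ v ∈ vspan (S : Set (PP K ι)) := by
    intro S
    show q.submodule ≤ _ ↔ _
    rw [hq, Projectivization.submodule_mk, Submodule.span_singleton_le_iff_mem]
  -- the set of lines of a tuple
  have hln : ∀ A (hA : A ∈ Fib k X v), Function.Injective fun i => Projectivization.mk K _ (hr A hA i) := by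
    intro A hA i j hij
    by_contra hne'
    simp only [Projectivization.mk_eq_mk_iff'] at hij
    obtain ⟨t, ht⟩ := hij
    have := Fib_indep hf hr hA (c := fun l => if l = i then 1 else if l = j then -t else 0) (by
      rw [Finset.sum_eq_add i j hne']
      · rw [if_pos rfl, if_neg (Ne.symm hne'), if_pos rfl, ← ht]; simp
      · rintro l - ⟨h1, h2⟩; simp [h1, h2]
      · simp
      · simp)
    have := congrFun this i
    simp at this
  have hlS : ∀ A (hA : A ∈ Fib k X v), ∃ S : Finset (PP K ι), ↑S ⊆ X ∧ S.card = k ∧ q ∈ projSpan (S : Set (PP K ι)) ∧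
      ∃ e : Fin k ≃ S, ∀ i, (fun b => A (i, b)) ∈ (e i).1.submodule := by
    intro A hA
    let f : Fin k → PP K ι := fun i => Projectivization.mk K _ (hr A hA i)
    refine ⟨Finset.univ.image f, ?_, ?_, ?_, ?_⟩
    · intro x hx
      simp only [Finset.coe_image, Finset.coe_univ, Set.image_univ] at hx
      obtain ⟨i, rfl⟩ := hx
      exact (mem_coneOf_iff _).1 (hA.1 i)
    · rw [Finset.card_image_of_injective _ (hln A hA), Finset.card_univ, Fintype.card_fin]
    · rw [hqs, ← hA.2]
      refine sumv_mem0 fun i => Submodule.subset_span (mem_coneOf.2 ⟨f i, ?_, mem_mk_submodule _⟩)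
      simp
    · refine ⟨Equiv.ofBijective (fun i => ⟨f i, by simp⟩) ⟨fun i j h => hln A hA (Subtype.ext_iff.1 h), ?_⟩, fun i => mem_mk_submodule _⟩
      rintro ⟨x, hx⟩
      obtain ⟨i, -, hi⟩ := Finset.mem_image.1 hx
      exact ⟨i, Subtype.ext hi⟩
  have hXne : 0 < k → X.Nonempty := fun h0 => by
    obtain ⟨A, hA⟩ := hne
    obtain ⟨x, hx, -⟩ := mem_coneOf.1 (hA.1 ⟨0, h0⟩)
    exact ⟨x, hx⟩
  have hrank : xrank X q = k := by
    obtain ⟨A, hA⟩ := hne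
    obtain ⟨S, h1, h2, h3, -⟩ := hlS A hA
    apply le_antisymm
    · unfold xrank
      exact Nat.sInf_le ⟨S, h1, h2, h3⟩
    · unfold xrank
      refine le_csInf (s := {m | ∃ S : Finset (PP K ι), ↑S ⊆ X ∧ S.card = m ∧ q ∈ projSpan (S : Set (PP K ι))}) ⟨k, S, h1, h2, h3⟩ ?_
      rintro m ⟨S', h1', h2', h3'⟩
      by_contra hlt
      push Not at hlt
      obtain ⟨B, hB, hBs, -⟩ := sum_of_mem_projSpan h1' h2' (hqs.1 h3')
      obtain ⟨B', hB', hBs', i, hi⟩ := pad (hXne (by omega)) hlt hB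
      exact hr B' ⟨hB', hBs'.trans hBs⟩ i hi
  have hdec : ∀ S ∈ decompositions X q, ∃ A ∈ Fib k X v, ∃ e : Fin k ≃ S, ∀ i, (fun b => A (i, b)) ∈ (e i).1.submodule := by
    rintro S ⟨h1, h2, h3⟩
    obtain ⟨A, hA, hs, e, he⟩ := sum_of_mem_projSpan h1 (h2.trans hrank) (hqs.1 h3)
    exact ⟨A, ⟨hA, hs⟩, e, he⟩
  choose AS hAS eS heS using hdec
  have hmemS : ∀ A ∈ Fib k X v, ∃ S ∈ decompositions X q, ∃ e : Fin k ≃ S, ∀ i, (fun b => A (i, b)) ∈ (e i).1.submodule := by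
    intro A hA
    obtain ⟨S, h1, h2, h3, h4⟩ := hlS A hA
    exact ⟨S, ⟨h1, h2.trans hrank.symm, h3⟩, h4⟩
  constructor
  · obtain ⟨A, hA⟩ := hne
    obtain ⟨S, h1, h2, h3, -⟩ := hlS A hA
    exact subset_zclosure _ ⟨S, h1, h2, h3⟩
  have hperm : ∀ A ∈ Fib k X v, ∀ σ : Equiv.Perm (Fin k), (fun p => A (σ p.1, p.2)) ∈ Fib k X v := by
    intro A hA σ
    refine ⟨fun i => hA.1 (σ i), ?_⟩
    rw [← hA.2]
    funext b
    exact Equiv.sum_comp σ (fun i => A (i, b))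
  let Ψ : decompositions X q × Equiv.Perm (Fin k) → Fib k X v := fun s =>
    ⟨_, hperm _ (hAS s.1.1 s.1.2) s.2⟩
  have hΨ : Function.Bijective Ψ := by
    have hline : ∀ {w : ι → K} (hw : w ≠ 0) {x y : PP K ι}, w ∈ x.submodule → w ∈ y.submodule → x = y := by
      intro w hw x y h1 h2
      rw [eq_mk_of_mem hw h1, eq_mk_of_mem hw h2]
    constructor
    · rintro ⟨⟨S, hS⟩, σ⟩ ⟨⟨S', hS'⟩, σ'⟩ h
      have h1 : ∀ p : Fin k × ι, AS S hS (σ p.1, p.2) = AS S' hS' (σ' p.1, p.2) := fun p =>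
        congrFun (Subtype.ext_iff.1 h) p
      have h2 : ∀ i, (eS S hS (σ i)).1 = (eS S' hS' (σ' i)).1 := by
        intro i
        have e1 := heS S hS (σ i)
        have e2 := heS S' hS' (σ' i)
        have e3 : (fun b => AS S hS (σ i, b)) = fun b => AS S' hS' (σ' i, b) := funext fun b => h1 (i, b)
        rw [e3] at e1
        exact hline (hr _ (hAS S' hS') _) e1 e2
      have h3 : S = S' := by
        ext x
        constructor
        · intro hx
          have := h2 (σ.symm ((eS S hS).symm ⟨x, hx⟩))
          rw [Equiv.apply_symm_apply, Equiv.apply_symm_apply] at this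
          change x = _ at this
          rw [this]; exact Subtype.property _
        · intro hx
          have := h2 (σ'.symm ((eS S' hS').symm ⟨x, hx⟩))
          rw [Equiv.apply_symm_apply σ', Equiv.apply_symm_apply] at this
          change _ = x at this
          rw [← this]; exact Subtype.property _
      subst h3
      have h4 : σ = σ' := Equiv.ext fun i => (eS S hS).injective (Subtype.ext (h2 i))
      subst h4
      rfl
    · rintro ⟨A, hA⟩
      obtain ⟨S, hS, e, he⟩ := hmemS A hA
      let σ : Equiv.Perm (Fin k) := e.trans (eS S hS).symm
      refine ⟨(⟨S, hS⟩, σ), Subtype.ext ?_⟩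
      have hA' := hperm _ (hAS S hS) σ
      have h1 : ∀ i, ∃ t : K, t • (fun b => AS S hS (σ i, b)) = fun b => A (i, b) := by
        intro i
        have h2 := heS S hS (σ i)
        have h3 : eS S hS (σ i) = e i := by simp [σ]
        rw [h3] at h2
        have h4 := he i
        rw [eq_mk_of_mem (hr _ (hAS S hS) (σ i)) h2, Projectivization.submodule_mk, Submodule.mem_span_singleton] at h4
        exact h4
      choose t ht using h1
      have h5 := Fib_indep hf hr hA' (c := fun i => t i - 1) (by
        simp only [sub_smul, one_smul, Finset.sum_sub_distrib, ht]
        rw [sub_eq_zero]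
        funext b
        simp only [Finset.sum_apply]
        exact (congrFun hA.2 b).trans (congrFun hA'.2 b).symm)
      funext ⟨i, b⟩
      have h6 := congrFun h5 i
      simp only [Pi.zero_apply, sub_eq_zero] at h6
      have h7 := congrFun (ht i) b
      rw [h6, one_smul] at h7
      exact h7
  have := Nat.card_congr (Equiv.ofBijective Ψ hΨ)
  rw [Nat.card_prod, Nat.card_perm, Nat.card_fin] at this
  rw [← Nat.card_coe_set_eq, ← Nat.card_coe_set_eq, ← this]

theorem sec_deg [Infinite K] (hk : 1 ≤ k) {Y : Set (PP K ι)} {W : Set (ι → K)}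
    (hsum : ∀ A ∈ CK k (coneOf Y), sumv A ∈ W) (hW : GIrr W)
    (hcl : ∀ v, (∀ f : MvPolynomial ι K, (∀ w ∈ W, eval w f = 0) → eval v f = 0) → v ∈ W)
    (p : MvPolynomial ι K) (hp : ∃ w ∈ W, eval w p ≠ 0) {N : ℕ} (hN : 0 < N)
    (hfib : ∀ w ∈ W, eval w p ≠ 0 → (Fib k Y w).ncard = N ∧ ∀ A ∈ Fib k Y w, ∀ i, (fun b => A (i, b)) ≠ 0) (α : ℕ) :
    HasSecantDegree Y k α ↔ N = α * k.factorial := by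
  have key : ∀ w ∈ W, eval w p ≠ 0 → ∃ hw : w ≠ 0, Projectivization.mk K w hw ∈ secant k Y ∧
      N = (decompositions Y (Projectivization.mk K w hw)).ncard * k.factorial := by
    intro w hw hwp
    obtain ⟨h1, h2⟩ := hfib w hw hwp
    have hf : (Fib k Y w).Finite := Set.finite_of_ncard_pos (by omega)
    have hne : (Fib k Y w).Nonempty := Set.nonempty_of_ncard_ne_zero (by omega)
    have hw0 := Fib_ne hk hf h2 hne
    obtain ⟨h3, h4⟩ := decs_count hw0 hf h2 hne
    exact ⟨hw0, h3, by rw [← h4, h1]⟩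
  have hsecW : ∀ v ∈ coneOf (secant k Y), v ∈ W := by
    intro v hv
    apply hcl
    intro f hf
    exact vanish_secant (fun A hA => hf _ (hsum A hA)) v hv
  constructor
  · rintro ⟨Z, ⟨s, -, rfl⟩, hZ, hP⟩
    obtain ⟨x, hx, hxs⟩ := Set.not_subset.1 hZ
    have : ∃ f ∈ s, ∃ v ∈ x.submodule, eval v f ≠ 0 := by
      by_contra hc
      push Not at hc
      exact hxs hc
    obtain ⟨f, hf, v, hv, hfv⟩ := this
    obtain ⟨w, hw, h1, h2⟩ := hW.2 f p ⟨v, hsecW v (mem_coneOf.2 ⟨x, hx, hv⟩), hfv⟩ hp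
    obtain ⟨hw0, h3, h4⟩ := key w hw h2
    have h5 := hP _ ⟨h3, fun hz => h1 (hz f hf w (mem_mk_submodule _))⟩
    rw [h4, h5]
  · intro hα
    have hpos := Nat.factorial_pos k
    refine ⟨zeroLocus {p}, zeroLocus_closed _, ?_, ?_⟩
    · intro hsub
      obtain ⟨w, hw, hwp⟩ := hp
      obtain ⟨hw0, h3, -⟩ := key w hw hwp
      exact hwp (hsub h3 p rfl w (mem_mk_submodule _))
    · rintro x ⟨hx, hxp⟩
      have : ∃ v ∈ x.submodule, eval v p ≠ 0 := by
        by_contra hc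
        push Not at hc
        exact hxp (by rintro g rfl v hv; exact hc v hv)
      obtain ⟨v, hv, hvp⟩ := this
      obtain ⟨hw0, -, h4⟩ := key v (hsecW v (mem_coneOf.2 ⟨x, hx, hv⟩)) hvp
      rw [eq_mk_of_mem hw0 hv]
      rw [hα] at h4
      exact (Nat.eq_of_mul_eq_mul_right hpos h4).symm

end

section
open MvPolynomial
universe u w
set_option linter.unusedSectionVars false
set_option linter.style.haveILetI false
variable {K : Type*} [Field K] {ι : Type*} [Fintype ι] {k : ℕ}

/-- multidegree -/
def mdeg (m : Fin k × ι →₀ ℕ) : Fin k →₀ ℕ := Finsupp.mapDomain Prod.fst m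

theorem weight_mdeg (m : Fin k × ι →₀ ℕ) (i : Fin k) :
    Finsupp.weight (fun p : Fin k × ι => if p.1 = i then 1 else 0) m = mdeg m i := by
  classical
  unfold mdeg
  rw [Finsupp.weight_apply, Finsupp.mapDomain, Finsupp.sum_apply]
  refine Finsupp.sum_congr fun p _ => ?_
  rw [Finsupp.single_apply]
  split_ifs <;> simp

/-- multihomogeneous component -/
def mcomp (e : Fin k →₀ ℕ) (f : MvPolynomial (Fin k × ι) K) : MvPolynomial (Fin k × ι) K := by
  classical exact ∑ m ∈ f.support with mdeg m = e, monomial m (coeff m f)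

theorem mcomp_homog (e : Fin k →₀ ℕ) (f : MvPolynomial (Fin k × ι) K) (i : Fin k) :
    IsWeightedHomogeneous (fun p : Fin k × ι => if p.1 = i then 1 else 0) (mcomp e f) (e i) := by
  classical
  unfold mcomp
  apply IsWeightedHomogeneous.sum
  intro m hm
  apply isWeightedHomogeneous_monomial
  rw [weight_mdeg, (Finset.mem_filter.1 hm).2]

/-- polynomial of scalings -/
def scaleP (f : MvPolynomial (Fin k × ι) K) (v : Fin k × ι → K) : MvPolynomial (Fin k) K :=
  ∑ m ∈ f.support, monomial (mdeg m) (coeff m f * ∏ p, v p ^ m p)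

theorem eval_scaleP (f : MvPolynomial (Fin k × ι) K) (v : Fin k × ι → K) (t : Fin k → K) :
    eval t (scaleP f v) = eval (fun p => t p.1 * v p) f := by
  classical
  unfold scaleP
  rw [map_sum, eval_eq' (fun p => t p.1 * v p) f]
  refine Finset.sum_congr rfl fun m _ => ?_
  have h : (mdeg m).prod (fun i a => t i ^ a) = ∏ p, t p.1 ^ m p := by
    unfold mdeg
    rw [Finsupp.prod_mapDomain_index (by simp) (by intro b m n; exact pow_add _ _ _),
      Finsupp.prod_fintype _ _ (by simp)]
  rw [eval_monomial, h]
  simp only [mul_pow, Finset.prod_mul_distrib]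
  ring

theorem coeff_scaleP (f : MvPolynomial (Fin k × ι) K) (v : Fin k × ι → K) (e : Fin k →₀ ℕ) :
    coeff e (scaleP f v) = eval v (mcomp e f) := by
  classical
  unfold scaleP mcomp
  rw [coeff_sum, map_sum, Finset.sum_filter]
  refine Finset.sum_congr rfl fun m _ => ?_
  rw [coeff_monomial]
  split_ifs with h
  · rw [eval_monomial, Finsupp.prod_fintype _ _ (by simp)]
  · rfl

theorem mcomp_sum (f : MvPolynomial (Fin k × ι) K) (v : Fin k × ι → K) (h : ∀ e, eval v (mcomp e f) = 0) :
    eval v f = 0 := by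
  have h1 : scaleP f v = 0 := by
    ext e; rw [coeff_scaleP, h, coeff_zero]
  have h2 := eval_scaleP f v (fun _ => 1)
  rw [h1, map_zero] at h2
  simpa using h2.symm

theorem multi_closed [Infinite K] (f : MvPolynomial (Fin k × ι) K) :
    IsMultiZClosed (multiZeroLocus {f} : Set (Fin k → PP K ι)) := by
  refine ⟨Set.range fun e => mcomp e f, ?_, ?_⟩
  · rintro _ ⟨e, rfl⟩ i
    exact ⟨e i, mcomp_homog e f i⟩
  · ext u
    constructor
    · rintro h _ ⟨e, rfl⟩ v hv
      show eval _ (mcomp e f) = 0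
      rw [← coeff_scaleP]
      have : scaleP f (fun p => v p.1 p.2) = 0 := by
        apply MvPolynomial.funext
        intro t
        rw [eval_scaleP, map_zero]
        exact h f rfl (fun i => t i • v i) (fun i => Submodule.smul_mem _ _ (hv i))
      rw [this, coeff_zero]
    · rintro h g rfl v hv
      exact mcomp_sum _ _ fun e => h _ ⟨e, rfl⟩ v hv

namespace Dat
variable {X : Set (PP K ι)} {F : Type*} [Field F] [Algebra K F]

theorem girr_Sp {S : Set (ι → K)} (d : Dat k S F) : GIrr {v : ι → K | Sp d.q v} := by
  have hne : (CK k S).Nonempty := by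
    obtain ⟨v, hv⟩ := d.ne
    exact ⟨fun p => v p.2, fun _ => hv⟩
  refine ⟨?_, ?_⟩
  · obtain ⟨A, hA⟩ := hne
    exact ⟨_, d.sp_q_of (d.sp_iff.2 hA)⟩
  · rintro f g ⟨v, hv, hf⟩ ⟨w, hw, hg⟩
    have h1 : aeval d.q (f * g) ≠ 0 := by
      rw [map_mul]; exact mul_ne_zero (hv.ne hf) (hw.ne hg)
    rw [← aeval_aqp, Ne, d.gen] at h1
    push Not at h1
    obtain ⟨A, hA, h2⟩ := h1
    rw [eval_aqp, map_mul] at h2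
    exact ⟨_, d.sp_q_of (d.sp_iff.2 hA), left_ne_zero_of_mul h2, right_ne_zero_of_mul h2⟩

theorem dv_rename {S : Set (ι → K)} (d : Dat k S F) (δ : MvPolynomial d.J K) (v : ι → K) :
    eval v (rename (fun j : d.J => (j : ι)) δ) = d.dv δ v := by
  rw [eval_rename]; rfl

theorem main [CharZero K] [IsAlgClosed K] (hk : 1 ≤ k) {n : ℕ} (d : Dat k (coneOf X) F)
    (hn : zdim X = ((n : ℕ∞) : WithBot ℕ∞)) (hr : rho (coneOf X) = n + 1) :
    HoldsForGeneralTuples X k fun u => ∀ α : ℕ, HasSecantDegree X k α ↔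
        HasSecantDegree (X ∩ projSpan (contactLocus X (Set.range u))) k α := by
  haveI : Infinite K := IsAlgClosed.instInfinite
  have hS : ∃ v ∈ coneOf X, v ≠ 0 := by
    obtain ⟨v, hv⟩ := d.ne
    obtain ⟨x, hx, -⟩ := mem_coneOf.1 hv
    exact ⟨x.rep, mem_coneOf.2 ⟨x, hx, rep_mem x⟩, x.rep_nonzero⟩
  obtain ⟨L⟩ := d.exists_LamD
  obtain ⟨H, δ1, hδ1, hG1⟩ := exists_good (L := L) hS
  obtain ⟨N, hN, δ2, hδ2, hG2⟩ := d.count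
  obtain ⟨δ, hδ0, hδ, hfib⟩ : ∃ δ : MvPolynomial d.J K, δ ≠ 0 ∧ (∀ A ∈ CK k (coneOf X), d.dv δ (sumv A) ≠ 0 → Good L H A) ∧
      ∀ v, Sp d.q v → d.dv δ v ≠ 0 → (Fib k X v).ncard = N := by
    refine ⟨δ1 * δ2, mul_ne_zero hδ1 hδ2, fun A hA h => hG1 A hA ?_, fun v hv h => hG2 v hv ?_⟩
    · unfold dv at h; rw [map_mul] at h; exact left_ne_zero_of_mul h
    · unfold dv at h; rw [map_mul] at h; exact right_ne_zero_of_mul h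
  have hXdeg : ∀ α, HasSecantDegree X k α ↔ N = α * k.factorial := by
    refine sec_deg hk (W := {v | Sp d.q v}) (fun A hA => d.sp_q_of (d.sp_iff.2 hA)) d.girr_Sp ?_
      (rename (fun j : d.J => (j : ι)) δ) ?_ hN ?_
    · intro v hv f hf
      exact hv f fun w hw => hw f hf
    · obtain ⟨A, hA, h⟩ := d.exists_nice hδ0
      exact ⟨_, d.sp_q_of (d.sp_iff.2 hA), by rwa [dv_rename]⟩
    · intro w hw hwp
      rw [dv_rename] at hwp
      refine ⟨hfib w hw hwp, ?_⟩
      rintro A ⟨hA, rfl⟩ i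
      exact (hδ A hA hwp).rne i
  refine ⟨multiZeroLocus {d.dp δ}, multi_closed _, ?_, ?_⟩
  · obtain ⟨A, hA, h⟩ := d.exists_nice hδ0
    have hG := hδ A hA h
    refine ⟨fun i => Projectivization.mk K _ (hG.rne i), fun i => (mem_coneOf_iff _).1 (hA i), fun hT => h ?_⟩
    rw [← eval_dp]
    exact hT _ rfl (fun i b => A (i, b)) (fun i => mem_mk_submodule _)
  · intro u hu huT α
    have : ∃ v : Fin k → ι → K, (∀ i, v i ∈ (u i).submodule) ∧ eval (fun p => v p.1 p.2) (d.dp δ) ≠ 0 := by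
      by_contra hc
      push Not at hc
      exact huT (by rintro f rfl v hv; exact hc v hv)
    obtain ⟨v, hv, hvδ⟩ := this
    rw [eval_dp] at hvδ
    set A : Fin k × ι → K := fun p => v p.1 p.2 with hAdef
    have huA : ∀ i, (fun b => A (i, b)) ∈ (u i).submodule := hv
    have hA : A ∈ CK k (coneOf X) := fun i => mem_coneOf.2 ⟨u i, hu i, huA i⟩
    have hG := hδ A hA hvδ
    have hspan : vspan (contactLocus X (Set.range u)) = Lam L A :=
      le_antisymm (contact_le δ hδ hA hvδ huA) (le_contact hn hr δ hδ hA hvδ huA)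
    rw [hXdeg]
    symm
    have hYc : ∀ w ∈ coneOf (X ∩ projSpan (contactLocus X (Set.range u))), w ∈ coneOf X ∧ w ∈ Lam L A := by
      intro w hw
      obtain ⟨x, ⟨hx1, hx2⟩, hwx⟩ := mem_coneOf.1 hw
      refine ⟨mem_coneOf.2 ⟨x, hx1, hwx⟩, ?_⟩
      rw [← hspan]
      exact hx2 hwx
    have hYc' : ∀ w, w ≠ 0 → w ∈ coneOf X → w ∈ Lam L A → w ∈ coneOf (X ∩ projSpan (contactLocus X (Set.range u))) := by
      intro w hw0 hw hwL
      rw [mem_coneOf_iff hw0] at hw ⊢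
      refine ⟨hw, ?_⟩
      show Projectivization.submodule _ ≤ _
      rw [Projectivization.submodule_mk, Submodule.span_singleton_le_iff_mem, hspan]
      exact hwL
    have hFib : ∀ w ∈ Lam L A, d.dv δ w ≠ 0 →
        Fib k (X ∩ projSpan (contactLocus X (Set.range u))) w = Fib k X w := by
      intro w hw hwδ
      ext B
      constructor
      · rintro ⟨h1, h2⟩
        exact ⟨fun i => (hYc _ (h1 i)).1, h2⟩
      · rintro ⟨h1, rfl⟩
        have hB := hδ B h1 hwδ
        have h3 := hG.lam_eq hB (hG.congr hB hw)
        refine ⟨fun i => hYc' _ (hB.rne i) (h1 i) ?_, rfl⟩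
        rw [← h3]; exact hB.row i
    refine sec_deg hk (W := (Lam L A : Set (ι → K))) (fun B hB => sumv_mem fun i => (hYc _ (hB i)).2)
      (GIrr_submodule _) ?_ (rename (fun j : d.J => (j : ι)) δ) ?_ hN ?_ α
    · intro w hw
      by_contra hnot
      obtain ⟨ℓ, hℓ1, hℓ2⟩ := Submodule.exists_le_ker_of_notMem hnot
      have := hw (linP ℓ) (fun z hz => by rw [linP_eval]; first | exact hℓ1 hz | exact hℓ2 hz)
      rw [linP_eval] at this
      first | exact hℓ2 this | exact hℓ1 this
    · exact ⟨sumv A, sumv_mem hG.row, by rwa [dv_rename]⟩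
    · intro w hw hwp
      rw [dv_rename] at hwp
      rw [hFib w hw hwp]
      refine ⟨hfib w (hG.line w hw).1 hwp, ?_⟩
      rintro B ⟨hB, rfl⟩ i
      exact (hδ B hB hwp).rne i

end Dat

end

/-- **Corollary (corollary:sec:deg).**  Let `X ⊆ ℙ^r` be an integral non-degenerate
variety of dimension `n` (char `0`), weakly `k`-defective, with
`dim σ_{k+n-1}(X) = (k+n-1)(n+1) - 1 < r`.  Then the `k`-th secant degree of `X`
equals the `k`-th secant degree of the intersection of `X` with the linear span of
its general tangential `k`-contact locus. -/
theorem statement4 {K : Type*} [Field K] [IsAlgClosed K] [CharZero K]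
    {ι : Type*} [Fintype ι] (r n k : ℕ) (hι : Fintype.card ι = r + 1)
    (X : Set (PP K ι)) (hX : IsIntegralVariety X) (hXnd : Nondegenerate X)
    (hXdim : zdim X = ((n : ℕ∞) : WithBot ℕ∞)) (hk : 1 ≤ k)
    (hwd : WeaklyDefective X k)
    (hsec : zdim (secant (k + n - 1) X) =
      ((((k + n - 1) * (n + 1) - 1 : ℕ) : ℕ∞) : WithBot ℕ∞))
    (hlt : (k + n - 1) * (n + 1) - 1 < r) :
    HoldsForGeneralTuples X k fun u => ∀ α : ℕ,
      HasSecantDegree X k α ↔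
        HasSecantDegree (X ∩ projSpan (contactLocus X (Set.range u))) k α := by
  haveI : Infinite K := IsAlgClosed.instInfinite
  have hr : rho (coneOf X) = n + 1 := (zdim_eq_iff hX.1 hX.2).1 hXdim
  have hn : 1 ≤ n := by
    have := coneOf_irr_n hX hXnd (by omega)
    omega
  have hXne := hX.2.1
  have h1 := rho_sum_of_zdim hXne hsec
  have h2 : (k + n - 1) * rho (coneOf X) ≤ rho (SumSet (k + n - 1) (coneOf X)) := by
    rw [hr]; omega
  have hg := girr_of_irr hX.2
  have h3 := nondef (k := k) (by omega) hg h2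
  obtain ⟨F, iF, iA, x, hgen, hfrac, J, hJ, hind, halg⟩ := setup hg h3
  let d : Dat k (coneOf X) F := ⟨x, hgen, hfrac, J, hJ, hind, halg, fun v hv t => coneOf_smul hv t, fun v hv => by
    by_cases hv0 : v = 0
    · obtain ⟨y, hy⟩ := hXne
      rw [hv0]
      exact mem_coneOf.2 ⟨y, hy, Submodule.zero_mem _⟩
    · rw [mem_coneOf_iff hv0]
      apply mem_of_vanish hX.1
      intro f hf w hw
      rw [Projectivization.submodule_mk, Submodule.mem_span_singleton] at hw
      obtain ⟨t, rfl⟩ := hw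
      rw [eval_smul_sum]
      refine Finset.sum_eq_zero fun e _ => ?_
      rw [hv _ fun z hz => homog_vanish (fun s => hf _ (coneOf_smul hz s)) e, mul_zero], hg.1⟩
  exact d.main hk hXdim hr

end ContactLoci
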